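/- Every 1CSP instance E = (n, L, l) with unit demands and n ≤ 9 is a proper IRUP instance, i.e., Δ_p(E) < 1. -/

import Mathlib

open Finset
open scoped ENNReal NNReal

/-- A 1CSP instance with unit demands: `n` is a positive integer, the piece
lengths satisfy `0 < l 0 ≤ l 1 ≤ … ≤ l (n-1) ≤ L`. -/
def IsInstance (n : ℕ) (L : ℝ) (l : Fin n → ℝ) : Prop :=
  0 < n ∧ (∀ i, 0 < l i) ∧ (∀ i j : Fin n, i ≤ j → l i ≤ l j) ∧ (∀ i, l i ≤ L)

/-- a binary (0/1) pattern -/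
def IsBinary {n : ℕ} (a : Fin n → ℕ) : Prop := ∀ i, a i ≤ 1

/-- The set of feasible patterns `P^f(E)`. -/
def feasiblePatterns (n : ℕ) (L : ℝ) (l : Fin n → ℝ) : Set (Fin n → ℕ) :=
  {a | ∑ i, l i * (a i : ℝ) ≤ L}

/-- The set of proper patterns `P^p(E)` (for unit demands). -/
def properPatterns (n : ℕ) (L : ℝ) (l : Fin n → ℝ) : Set (Fin n → ℕ) :=
  {a | IsBinary a ∧ ∑ i, l i * (a i : ℝ) ≤ L}

/-- `z_D(P,E)`: minimum of `∑ x_a` over finitely supported `x : P → ℤ_{≥0}`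
with `∑ x_a • a = 𝟏`; (`⊤` if infeasible). -/
noncomputable def zD (n : ℕ) (P : Set (Fin n → ℕ)) : ℝ≥0∞ :=
  sInf {c : ℝ≥0∞ | ∃ x : (Fin n → ℕ) →₀ ℕ,
    (∀ a ∈ x.support, a ∈ P) ∧
    (∀ i, ∑ a ∈ x.support, x a * a i = 1) ∧
    c = ∑ a ∈ x.support, (x a : ℝ≥0∞)}

/-- `z_C(P,E)`: infimum of `∑ x_a` over finitely supported `x : P → ℝ_{≥0}`
with `∑ x_a • a = 𝟏`; (`⊤` if infeasible). -/
noncomputable def zC (n : ℕ) (P : Set (Fin n → ℕ)) : ℝ≥0∞ :=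
  sInf {c : ℝ≥0∞ | ∃ x : (Fin n → ℕ) →₀ NNReal,
    (∀ a ∈ x.support, a ∈ P) ∧
    (∀ i, ∑ a ∈ x.support, (x a : ℝ) * (a i : ℝ) = 1) ∧
    c = ∑ a ∈ x.support, (x a : ℝ≥0∞)}

noncomputable def zDf (n : ℕ) (L : ℝ) (l : Fin n → ℝ) : ℝ≥0∞ :=
  zD n (feasiblePatterns n L l)

noncomputable def zCf (n : ℕ) (L : ℝ) (l : Fin n → ℝ) : ℝ≥0∞ :=
  zC n (feasiblePatterns n L l)

noncomputable def zCp (n : ℕ) (L : ℝ) (l : Fin n → ℝ) : ℝ≥0∞ :=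
  zC n (properPatterns n L l)

/-- the gap `Δ(E) = z_D^f(E) - z_C^f(E)` -/
noncomputable def gap (n : ℕ) (L : ℝ) (l : Fin n → ℝ) : ℝ≥0∞ :=
  zDf n L l - zCf n L l

/-- the proper gap `Δ_p(E) = z_D^f(E) - z_C^p(E)` -/
noncomputable def properGap (n : ℕ) (L : ℝ) (l : Fin n → ℝ) : ℝ≥0∞ :=
  zDf n L l - zCp n L l

/-- the dominance relation `a ⪯ b`: all suffix sums of `a` are at most those of `b`. -/
def Dominates {n : ℕ} (a b : Fin n → ℕ) : Prop :=
  ∀ j : Fin n, ∑ i ∈ univ.filter (fun i => j ≤ i), a i ≤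
    ∑ i ∈ univ.filter (fun i => j ≤ i), b i

/-! ### Refutation trees over bitsets

A set of items is encoded by a number below `512`, and a family of sets by the number whose
binary digits are the indicator function of the family. -/

/-- Refutation trees: `br S a b` splits on whether the set `S` is feasible (`b`) or not (`a`),
`lp k` closes a branch by a dual solution of the continuous relaxation, `tr t F I` closes it by
comparing loads of feasible and infeasible sets. -/
inductive RefTree where
  | br (S : ℕ) (a b : RefTree)
  | lp (k : ℕ)
  | tr (t : ℕ) (F I : List ℕ)

namespace RefTree

/-- The positions below `3584` lacking binary digit `i`. -/
def lacksMask (i : ℕ) : ℕ :=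
  Nat.div (Nat.sub (Nat.pow 2 3584) 1) (Nat.succ (Nat.pow 2 (Nat.pow 2 i)))

/-- The positions below `3584` having binary digit `i`. -/
def hasMask (i : ℕ) : ℕ := Nat.mul (lacksMask i) (Nat.pow 2 (Nat.pow 2 i))

/-- The positions having digit `i + 1` but not digit `i`. -/
def moveMask (i : ℕ) : ℕ := Nat.land (hasMask (Nat.succ i)) (lacksMask i)

/-- Add to `x` the sets obtained by omitting item `0`. -/
def drop (x : ℕ) : ℕ := Nat.lor x (Nat.shiftRight (Nat.land x (hasMask 0)) 1)

/-- Add to `x` the sets obtained by replacing item `i + 1` by item `i`. -/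
def move (i x : ℕ) : ℕ := Nat.lor x (Nat.shiftRight (Nat.land x (moveMask i)) (Nat.pow 2 i))

/-- Along with `moves₂`, …, `moves₈`: one pass of the closure under dominance. -/
def moves₁ (x : ℕ) : ℕ := drop (move 0 x)
def moves₂ (x : ℕ) : ℕ := moves₁ (move 1 x)
def moves₃ (x : ℕ) : ℕ := moves₂ (move 2 x)
def moves₄ (x : ℕ) : ℕ := moves₃ (move 3 x)
def moves₅ (x : ℕ) : ℕ := moves₄ (move 4 x)
def moves₆ (x : ℕ) : ℕ := moves₅ (move 5 x)
def moves₇ (x : ℕ) : ℕ := moves₆ (move 6 x)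
def moves₈ (x : ℕ) : ℕ := moves₇ (move 7 x)

/-- Closure of a family under dominance. -/
def close (x : ℕ) : ℕ :=
  moves₈ (moves₇ (moves₆ (moves₅ (moves₄ (moves₃ (moves₂ (moves₁ (drop x))))))))

/-- The family of all sets dominated by `A`. -/
def down (A : ℕ) : ℕ := close (Nat.shiftLeft 1 A)

/-- Is `j` a member of the family `x`? -/
def bit (x j : ℕ) : Bool := Nat.beq (Nat.land (Nat.shiftRight x j) 1) 1

/-- The members of the family `x` which do not contain item `i`, if `A` does. -/
def disjStep (A i x : ℕ) : ℕ := cond (bit A i) (Nat.land x (lacksMask i)) x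

/-- The members of the family `x` which are disjoint from `A`. -/
def disj (A x : ℕ) : ℕ :=
  Nat.rec (motive := fun _ => ℕ → ℕ) (fun x => x) (fun i ih x => ih (disjStep A i x)) 9 x

/-- Record in the state `st` that `S` is infeasible. -/
def addI (sh st S : ℕ) : ℕ := Nat.lor st (Nat.shiftLeft (down (Nat.sub 511 S)) sh)

/-- Record in the state `st` that `A` is feasible. -/
def addF (sh st A : ℕ) : ℕ :=
  Nat.lor st (Nat.lor (down A)
    (close (Nat.shiftLeft (disj A (Nat.mod st (Nat.pow 2 sh))) (Nat.add 512 A))))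

/-- The family of all pairs of a set `X` and its total weight `w`, encoded by `512 * w + X`, the
weights being listed from the top. -/
def pairs (us : List ℕ) : ℕ :=
  List.rec (motive := fun _ => ℕ) 1
    (fun u us ih =>
      Nat.lor ih (Nat.shiftLeft ih (Nat.add (Nat.mul 512 u) (Nat.pow 2 us.length)))) us

/-- The concatenation of `t` copies of a family of sets. -/
def replicate (x t : ℕ) : ℕ :=
  Nat.mul x (Nat.div (Nat.sub (Nat.pow 2 (Nat.mul 512 t)) 1) (Nat.sub (Nat.pow 2 512) 1))

/-- The base `64` digit of `k` in position `i`. -/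
def digit (k i : ℕ) : ℕ := Nat.mod (Nat.div k (Nat.pow 64 i)) 64

/-- The weights of the items `8, …, 0` in the dual solution with base `64` digits `k`. -/
def weights (k : ℕ) : List ℕ :=
  [digit k 8, digit k 7, digit k 6, digit k 5, digit k 4, digit k 3, digit k 2, digit k 1,
    digit k 0]

/-- The sum of a list. -/
def total (us : List ℕ) : ℕ := List.rec (motive := fun _ => ℕ) 0 (fun u _ ih => Nat.add u ih) us

/-- Is the family `x` contained in `y`? -/
def contained (x y : ℕ) : Bool := Nat.beq (Nat.land x y) x

/-- Does the dual solution encoded by `k` exclude `m` bins? The last digit of `k` is a bound for the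
total weight of a feasible set, verified by looking at all sets whose complement is too light. -/
def lpCheck (m sh st k : ℕ) : Bool :=
  and (Nat.ble (Nat.succ (Nat.mul m (digit k 9))) (total (weights k)))
    (contained
      (Nat.mod (pairs (weights k))
        (Nat.pow 2 (Nat.mul 512 (Nat.sub (total (weights k)) (digit k 9)))))
      (replicate (Nat.mod (Nat.shiftRight st sh) (Nat.pow 2 512))
        (Nat.sub (total (weights k)) (digit k 9))))

/-- The number of sets in the list containing an item. -/
def occ (i : ℕ) (us : List ℕ) : ℕ :=
  List.rec (motive := fun _ => ℕ) 0 (fun u _ ih => cond (bit u i) (Nat.succ ih) ih) us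

/-- Compare, from the top item on, the cumulative numbers of occurrences of the items in `F`,
increased by `t` each, to those in `I`. -/
def suffixCheck (t : ℕ) (F I : List ℕ) : ℕ → ℕ → ℕ → ℕ → Bool :=
  fun n => Nat.rec (motive := fun _ => ℕ → ℕ → ℕ → Bool) (fun _ _ _ => true)
    (fun _ ih i a b => and
      (Nat.ble (Nat.add b (occ i I)) (Nat.add (Nat.add a t) (occ i F)))
      (ih (Nat.pred i) (Nat.add (Nat.add a t) (occ i F)) (Nat.add b (occ i I)))) n

/-- Are all members of the list `us` feasible (`c = true`) or infeasible (`c = false`) according to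
the state `st`? -/
def allIn (sh st : ℕ) (c : Bool) (us : List ℕ) : Bool :=
  List.rec (motive := fun _ => Bool) true
    (fun u _ ih => and (and (Nat.ble u 511) (bit st (cond c u (Nat.add sh (Nat.sub 511 u))))) ih) us

/-- Do `F`, `I` and `t` show that the total load is too large for `m` bins? -/
def trCheck (m sh st t : ℕ) (F I : List ℕ) : Bool :=
  and (and (Nat.ble 1 I.length) (Nat.ble (Nat.add F.length (Nat.mul m t)) I.length))
    (and (suffixCheck t F I 9 8 0 0) (and (allIn sh st true F) (allIn sh st false I)))

/-- Does the tree refute the state `st`? -/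
noncomputable def run (m sh : ℕ) (T : RefTree) : ℕ → Bool :=
  RefTree.rec (motive := fun _ => ℕ → Bool)
    (fun S _ _ iha ihb st => and (Nat.ble S 511)
      (and (or (bit st S) (iha (addI sh st S)))
        (or (bit (addF sh st S) (Nat.add sh (Nat.sub 511 S))) (ihb (addF sh st S)))))
    (fun k st => lpCheck m sh st k)
    (fun t F I st => trCheck m sh st t F I) T

end RefTree

namespace RefTree

lemma bit_eq (x j : ℕ) : bit x j = x.testBit j := by
  have : bit x j = Nat.beq ((x >>> j) &&& 1) 1 := rfl
  rw [this, Nat.testBit, Nat.and_one_is_mod, Nat.one_and_eq_mod_two]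
  rcases Nat.mod_two_eq_zero_or_one (x >>> j) with h | h <;> rw [h] <;> rfl

/-- The members of the family `M` from `q` up to `q + n` satisfy `p`, by evaluation. -/
def maskTest (M : ℕ) (p : ℕ → Bool) (q n : ℕ) : Bool :=
  Nat.rec (motive := fun _ => Bool) true
    (fun k ih => and (cond (bit M (Nat.add q k)) (p (Nat.add q k)) true) ih) n

lemma maskTest_spec {M : ℕ} {p : ℕ → Bool} {q n : ℕ} (h : maskTest M p q n = true) :
    ∀ k < n, M.testBit (q + k) = true → p (q + k) = true := by
  induction n with
  | zero => simp
  | succ n ih =>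
    have e : maskTest M p q (n + 1) =
        ((cond (bit M (q + n)) (p (q + n)) true) && maskTest M p q n) := rfl
    rw [e, Bool.and_eq_true, bit_eq] at h
    intro k hk hM
    rcases Nat.lt_succ_iff_lt_or_eq.1 hk with hk | rfl
    · exact ih h.2 k hk hM
    · simpa [hM] using h.1

lemma of_maskTest {M : ℕ} {p : ℕ → Bool} (hM : M < 2 ^ 3584)
    (h : ∀ q < 7, maskTest M p (Nat.mul 512 q) 512 = true) {j : ℕ} (hj : M.testBit j = true) :
    p j = true := by
  have hlt : j < 3584 := by
    by_contra hge
    have := Nat.testBit_lt_two_pow (hM.trans_le (Nat.pow_le_pow_right two_pos (not_lt.1 hge)))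
    rw [this] at hj
    exact absurd hj (by decide)
  have := maskTest_spec (h (j / 512) (by omega)) (j % 512) (Nat.mod_lt _ (by norm_num))
  have e : Nat.mul 512 (j / 512) + j % 512 = j := Nat.div_add_mod j 512
  rw [e] at this
  exact this hj

set_option exponentiation.threshold 4000 in
lemma mask_lt : ∀ i < 9, lacksMask i < 2 ^ 3584 ∧ hasMask i < 2 ^ 3584 := by
  decide +kernel

lemma maskTest_lacksMask : ∀ i < 9, ∀ q < 7,
    maskTest (lacksMask i) (fun j => not (bit j i)) (Nat.mul 512 q) 512 = true := by
  decide +kernel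

lemma maskTest_hasMask : ∀ i < 9, ∀ q < 7,
    maskTest (hasMask i) (fun j => bit j i) (Nat.mul 512 q) 512 = true := by
  decide +kernel

lemma testBit_lacksMask {i j : ℕ} (hi : i < 9) (h : (lacksMask i).testBit j = true) :
    j.testBit i = false := by
  have := of_maskTest (mask_lt i hi).1 (maskTest_lacksMask i hi) h
  rwa [Bool.not_eq_true', bit_eq] at this

lemma testBit_hasMask {i j : ℕ} (hi : i < 9) (h : (hasMask i).testBit j = true) :
    j.testBit i = true := by
  have := of_maskTest (mask_lt i hi).2 (maskTest_hasMask i hi) h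
  rwa [bit_eq] at this

/-- All members of the family `x` satisfy `Q`. -/
def All (Q : ℕ → Prop) (x : ℕ) : Prop := ∀ j, x.testBit j = true → Q j

/-- `Q` is inherited under dominance. -/
structure Inherited (Q : ℕ → Prop) : Prop where
  move : ∀ i < 8, ∀ j, j.testBit (i + 1) = true → j.testBit i = false → Q j → Q (j - 2 ^ i)
  drop : ∀ j, j.testBit 0 = true → Q j → Q (j - 1)

lemma All.or {Q : ℕ → Prop} {x y : ℕ} (hx : All Q x) (hy : All Q y) : All Q (Nat.lor x y) := by
  intro j hj
  have hj : (x ||| y).testBit j = true := hj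
  rw [Nat.testBit_or, Bool.or_eq_true] at hj
  exact hj.elim (hx j) (hy j)

lemma All.and {Q : ℕ → Prop} {M x : ℕ} (hx : All Q x) :
    All (fun j => M.testBit j = true ∧ Q j) (Nat.land x M) := by
  intro j hj
  have hj : (x &&& M).testBit j = true := hj
  rw [Nat.testBit_and, Bool.and_eq_true] at hj
  exact ⟨hj.2, hx _ hj.1⟩

lemma All.shiftRight {P Q : ℕ → Prop} {x s : ℕ} (hx : All P x) (h : ∀ j, P j → Q (j - s)) :
    All Q (Nat.shiftRight x s) := by
  intro j hj
  have hj : (x >>> s).testBit j = true := hj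
  rw [Nat.testBit_shiftRight] at hj
  simpa using h _ (hx _ hj)

lemma All.shiftLeft {P Q : ℕ → Prop} {x s : ℕ} (hx : All P x) (h : ∀ j, P j → Q (s + j)) :
    All Q (Nat.shiftLeft x s) := by
  intro j hj
  have hj : (x <<< s).testBit j = true := hj
  rw [Nat.testBit_shiftLeft, Bool.and_eq_true, decide_eq_true_eq] at hj
  simpa [Nat.add_sub_cancel' hj.1] using h _ (hx _ hj.2)

namespace Inherited

variable {Q : ℕ → Prop} {x : ℕ}

lemma all_drop (hQ : Inherited Q) (hx : All Q x) : All Q (RefTree.drop x) :=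
  hx.or (hx.and.shiftRight fun j hj => hQ.drop j (testBit_hasMask (by norm_num) hj.1) hj.2)

lemma all_move (hQ : Inherited Q) {i : ℕ} (hi : i < 8) (hx : All Q x) : All Q (RefTree.move i x) :=
  hx.or <| hx.and.shiftRight fun j hj => by
    have h : (hasMask (i + 1) &&& lacksMask i).testBit j = true := hj.1
    rw [Nat.testBit_and, Bool.and_eq_true] at h
    exact hQ.move i hi j (testBit_hasMask (by omega) h.1) (testBit_lacksMask (by omega) h.2) hj.2

lemma all_moves₁ (hQ : Inherited Q) (hx : All Q x) : All Q (moves₁ x) :=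
  hQ.all_drop (hQ.all_move (by norm_num) hx)

lemma all_moves₂ (hQ : Inherited Q) (hx : All Q x) : All Q (moves₂ x) :=
  hQ.all_moves₁ (hQ.all_move (by norm_num) hx)

lemma all_moves₃ (hQ : Inherited Q) (hx : All Q x) : All Q (moves₃ x) :=
  hQ.all_moves₂ (hQ.all_move (by norm_num) hx)

lemma all_moves₄ (hQ : Inherited Q) (hx : All Q x) : All Q (moves₄ x) :=
  hQ.all_moves₃ (hQ.all_move (by norm_num) hx)

lemma all_moves₅ (hQ : Inherited Q) (hx : All Q x) : All Q (moves₅ x) :=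
  hQ.all_moves₄ (hQ.all_move (by norm_num) hx)

lemma all_moves₆ (hQ : Inherited Q) (hx : All Q x) : All Q (moves₆ x) :=
  hQ.all_moves₅ (hQ.all_move (by norm_num) hx)

lemma all_moves₇ (hQ : Inherited Q) (hx : All Q x) : All Q (moves₇ x) :=
  hQ.all_moves₆ (hQ.all_move (by norm_num) hx)

lemma all_moves₈ (hQ : Inherited Q) (hx : All Q x) : All Q (moves₈ x) :=
  hQ.all_moves₇ (hQ.all_move (by norm_num) hx)

lemma all_close (hQ : Inherited Q) (hx : All Q x) : All Q (close x) :=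
  hQ.all_moves₈ <| hQ.all_moves₇ <| hQ.all_moves₆ <| hQ.all_moves₅ <| hQ.all_moves₄ <|
    hQ.all_moves₃ <| hQ.all_moves₂ <| hQ.all_moves₁ <| hQ.all_drop hx

end Inherited

lemma all_singleton {Q : ℕ → Prop} {k : ℕ} (h : Q k) : All Q (Nat.shiftLeft 1 k) := by
  intro j hj
  have hj : (1 <<< k).testBit j = true := hj
  rw [Nat.one_shiftLeft, Nat.testBit_two_pow] at hj
  have : k = j := by simpa using hj
  exact this ▸ h

lemma testBit_disj (A n : ℕ) (hn : n ≤ 9) (x j : ℕ)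
    (h : (Nat.rec (motive := fun _ => ℕ → ℕ) (fun x => x)
      (fun i ih x => ih (disjStep A i x)) n x : ℕ).testBit j = true) :
    x.testBit j = true ∧ ∀ i < n, A.testBit i = true → j.testBit i = false := by
  induction n generalizing x with
  | zero => exact ⟨h, by simp⟩
  | succ n ih =>
    obtain ⟨h1, h2⟩ := ih (by omega) _ h
    rw [disjStep, bit_eq] at h1
    rcases hA : A.testBit n with _ | _
    · rw [hA] at h1
      refine ⟨h1, fun i hi hAi => ?_⟩
      rcases Nat.lt_succ_iff_lt_or_eq.1 hi with hi | rfl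
      · exact h2 i hi hAi
      · rw [hA] at hAi; exact absurd hAi (by decide)
    · rw [hA] at h1
      have h1 : (x &&& lacksMask n).testBit j = true := h1
      rw [Nat.testBit_and, Bool.and_eq_true] at h1
      refine ⟨h1.1, fun i hi hAi => ?_⟩
      rcases Nat.lt_succ_iff_lt_or_eq.1 hi with hi | rfl
      · exact h2 i hi hAi
      · exact testBit_lacksMask (by omega) h1.2

/-- The weight of the set encoded by `X`, the weights being listed from the top. -/
def weight : List ℕ → ℕ → ℕ
  | [], _ => 0
  | u :: us, X => (if X.testBit us.length then u else 0) + weight us X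

lemma weight_add_two_pow (us : List ℕ) (n X : ℕ) (h : us.length ≤ n) :
    weight us (2 ^ n + X) = weight us X := by
  induction us with
  | nil => rfl
  | cons u us ih =>
    simp only [List.length_cons] at h
    rw [weight, weight, ih (by omega), Nat.testBit_two_pow_add_gt (by omega)]

lemma testBit_pairs (us : List ℕ) (X : ℕ) (hX : X < 2 ^ us.length) :
    (pairs us).testBit (512 * weight us X + X) = true := by
  induction us generalizing X with
  | nil =>
    obtain rfl : X = 0 := by simpa using hX
    exact Nat.testBit_one_zero
  | cons u us ih =>
    have e : pairs (u :: us) = pairs us ||| (pairs us <<< (512 * u + 2 ^ us.length)) := rfl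
    rw [e, Nat.testBit_or, Bool.or_eq_true]
    by_cases hX' : X < 2 ^ us.length
    · left
      rw [weight, Nat.testBit_lt_two_pow hX']
      simpa using ih _ hX'
    · right
      obtain ⟨Y, rfl⟩ := Nat.exists_eq_add_of_le (not_lt.1 hX')
      rw [List.length_cons, pow_succ] at hX
      have hY : Y < 2 ^ us.length := by omega
      rw [weight, weight_add_two_pow _ _ _ le_rfl, Nat.testBit_two_pow_add_eq,
        Nat.testBit_lt_two_pow hY]
      simp only [Bool.not_false, if_true]
      rw [show 512 * (u + weight us Y) + (2 ^ us.length + Y) =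
        512 * weight us Y + Y + (512 * u + 2 ^ us.length) by ring, Nat.testBit_shiftLeft]
      simpa using ih Y hY

lemma replicate_eq (x t : ℕ) : replicate x t = x * ∑ i ∈ range t, (2 ^ 512) ^ i := by
  have e (b : ℕ) (hb : 2 ≤ b) : x * ((b ^ t - 1) / (b - 1)) = x * ∑ i ∈ range t, b ^ i := by
    rw [Nat.geomSum_eq hb]
  rw [← e (2 ^ 512) (Nat.le_self_pow (by norm_num) 2), ← pow_mul]
  unfold replicate
  simp only [Nat.mul_eq, Nat.sub_eq, Nat.pow_eq]
  generalize 2 ^ (512 * t) - 1 = a, 2 ^ 512 - 1 = b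
  rfl

lemma replicate_succ (x t : ℕ) : replicate x (t + 1) = 2 ^ 512 * replicate x t + x := by
  rw [replicate_eq, replicate_eq]
  generalize 2 ^ 512 = b
  rw [sum_range_succ', mul_add, pow_zero, mul_one, mul_left_comm]
  simp only [pow_succ', mul_sum]

lemma testBit_of_testBit_replicate {x t v X : ℕ} (hx : x < 2 ^ 512) (hX : X < 512)
    (hv : v < t) (h : (replicate x t).testBit (512 * v + X) = true) : x.testBit X = true := by
  induction t generalizing v with
  | zero => omega
  | succ t ih =>
    rw [replicate_succ, Nat.testBit_two_pow_mul_add _ hx] at h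
    rcases Nat.eq_zero_or_pos v with rfl | hv0
    · simpa [hX] using h
    · rw [if_neg (by omega), show 512 * v + X - 512 = 512 * (v - 1) + X by omega] at h
      exact ih (by omega) h

lemma testBit_of_contained {x y j : ℕ} (h : contained x y = true) (hj : x.testBit j = true) :
    y.testBit j = true := by
  have h : x &&& y = x := Nat.eq_of_beq_eq_true h
  rw [← h, Nat.testBit_and, Bool.and_eq_true] at hj
  exact hj.2

end RefTree

namespace RefTree

/-- The number of members of the list containing an item. -/
lemma occ_eq (i : ℕ) (us : List ℕ) : occ i us = us.countP (fun u => u.testBit i) := by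
  induction us with
  | nil => rfl
  | cons u us ih =>
    have e : occ i (u :: us) = cond (bit u i) (Nat.succ (occ i us)) (occ i us) := rfl
    rw [e, ih, bit_eq, List.countP_cons]
    cases u.testBit i <;> simp

lemma total_eq (us : List ℕ) : total us = us.sum := by
  induction us with
  | nil => rfl
  | cons u us ih =>
    have e : total (u :: us) = u + total us := rfl
    rw [e, ih, List.sum_cons]

lemma allIn_cons (sh st : ℕ) (c : Bool) (u : ℕ) (us : List ℕ) : allIn sh st c (u :: us) =
    ((Nat.ble u 511 && bit st (cond c u (sh + (511 - u)))) && allIn sh st c us) := rfl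

lemma le_of_allIn {sh st : ℕ} {c : Bool} {us : List ℕ} (h : allIn sh st c us = true) :
    ∀ u ∈ us, u < 512 ∧ st.testBit (cond c u (sh + (511 - u))) = true := by
  induction us with
  | nil => simp
  | cons u us ih =>
    rw [allIn_cons, Bool.and_eq_true, Bool.and_eq_true, bit_eq, Nat.ble_eq] at h
    intro v hv
    rcases List.mem_cons.1 hv with rfl | hv
    · exact ⟨by omega, h.1.2⟩
    · exact ih h.2 v hv

/-- The combinatorial facts about an instance used by refutation trees: for `j < sh`, `Q j` says
that the set encoded by `j % 512` can be packed into `j / 512 + 1` bins, and `Q (sh + j)`, for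
`j < 512`, says that the complement of the set encoded by `j` is not feasible. -/
structure Sound (m sh : ℕ) (Q : ℕ → Prop) : Prop where
  inherited : Inherited Q
  inherited_top : Inherited fun X => Q (sh + X)
  add : ∀ A < 512, Q A → ∀ j < sh, (∀ i < 9, A.testBit i = true → j.testBit i = false) →
    Q j → Q (512 + A + j)
  not_both : ∀ S < 512, Q S → ¬ Q (sh + (511 - S))
  em : ∀ S < 512, Q S ∨ Q (sh + (511 - S))
  dual : ∀ k D : ℕ, (∀ X < 512, weight (weights k) X < (weights k).sum - D → Q (sh + X)) →
    (weights k).sum ≤ m * D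
  trade : ∀ (t : ℕ) (F I : List ℕ), (∀ S ∈ F, S < 512 ∧ Q S) →
    (∀ S ∈ I, S < 512 ∧ Q (sh + (511 - S))) → 1 ≤ I.length → F.length + m * t ≤ I.length →
    suffixCheck t F I 9 8 0 0 = true → False

variable {m sh : ℕ} {Q : ℕ → Prop}

lemma Inherited.all_down (h : Inherited Q) {A : ℕ} (hA : Q A) : All Q (down A) :=
  h.all_close (all_singleton hA)

lemma Sound.all_addI (h : Sound m sh Q) {st S : ℕ} (hst : All Q st)
    (hS : Q (sh + (511 - S))) : All Q (addI sh st S) :=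
  hst.or ((h.inherited_top.all_down hS).shiftLeft fun _ hj => hj)

lemma Sound.all_addF (h : Sound m sh Q) {st A : ℕ} (hst : All Q st) (hA : A < 512)
    (hS : Q A) : All Q (addF sh st A) := by
  refine hst.or ((h.inherited.all_down hS).or (h.inherited.all_close ?_))
  refine All.shiftLeft (P := fun j => j < sh ∧ (∀ i < 9, A.testBit i = true → j.testBit i = false) ∧
    Q j) (fun j hj => ?_) fun j hj => h.add A hA hS j hj.1 hj.2.1 hj.2.2
  obtain ⟨h1, h2⟩ := testBit_disj A 9 le_rfl _ _ hj
  have h1 : (st % 2 ^ sh).testBit j = true := h1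
  rw [Nat.testBit_mod_two_pow, Bool.and_eq_true, decide_eq_true_eq] at h1
  exact ⟨h1.1, h2, hst _ h1.2⟩

lemma Sound.not_lpCheck (h : Sound m sh Q) {st k : ℕ} (hst : All Q st) :
    lpCheck m sh st k ≠ true := by
  intro hc
  rw [lpCheck, Bool.and_eq_true, total_eq, Nat.ble_eq] at hc
  have h1 : m * digit k 9 < (weights k).sum := hc.1
  refine absurd (h.dual k (digit k 9) fun X hX hw => hst _ ?_) (not_le.2 h1)
  have h2 := testBit_pairs (weights k) X (hX.trans_eq (by simp [weights]))
  have h3 : ((pairs (weights k)) % 2 ^ (512 * ((weights k).sum - digit k 9))).testBit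
      (512 * weight (weights k) X + X) = true := by
    rw [Nat.testBit_mod_two_pow, h2, Bool.and_true, decide_eq_true_eq]
    have := Nat.mul_le_mul_left 512 hw
    omega
  have h4 := testBit_of_testBit_replicate (Nat.mod_lt _ (Nat.two_pow_pos _)) hX hw
    (testBit_of_contained hc.2 h3)
  have h5 : ((st >>> sh) % 2 ^ 512).testBit X = true := h4
  rw [Nat.testBit_mod_two_pow, Nat.testBit_shiftRight, Bool.and_eq_true] at h5
  exact h5.2

lemma Sound.not_trCheck (h : Sound m sh Q) {st t : ℕ} {F I : List ℕ} (hst : All Q st) :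
    trCheck m sh st t F I ≠ true := by
  intro hc
  simp only [trCheck, Bool.and_eq_true, Nat.ble_eq] at hc
  obtain ⟨⟨h1, h2⟩, h3, h4, h5⟩ := hc
  exact h.trade t F I (fun S hS => ⟨(le_of_allIn h4 S hS).1, hst _ (le_of_allIn h4 S hS).2⟩)
    (fun S hS => ⟨(le_of_allIn h5 S hS).1, hst _ (le_of_allIn h5 S hS).2⟩) h1 h2 h3

lemma run_br (S : ℕ) (a b : RefTree) (st : ℕ) :
    run m sh (br S a b) st = (Nat.ble S 511 &&
      ((bit st S || run m sh a (addI sh st S)) &&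
        (bit (addF sh st S) (sh + (511 - S)) || run m sh b (addF sh st S)))) := rfl

theorem Sound.not_run (h : Sound m sh Q) (T : RefTree) :
    ∀ st, All Q st → run m sh T st ≠ true := by
  induction T with
  | lp k => exact fun st hst => h.not_lpCheck hst
  | tr t F I => exact fun st hst => h.not_trCheck hst
  | br S a b iha ihb =>
    intro st hst hc
    simp only [run_br, bit_eq, Bool.and_eq_true, Bool.or_eq_true, Nat.ble_eq] at hc
    obtain ⟨hS, h1, h2⟩ := hc
    replace hS : S < 512 := by omega
    have hF : ¬ Q S := fun hQ => by
      have := h.all_addF hst hS hQ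
      exact h2.elim (fun h2 => h.not_both S hS hQ (this _ h2)) (ihb _ this)
    have hI := (h.em S hS).resolve_left hF
    exact h1.elim (fun h1 => hF (hst _ h1)) (iha _ (h.all_addI hst hI))

end RefTree

/-- The items in `X` can be packed into `k` bins of capacity `L`. -/
def Packable {ι : Type*} (l : ι → ℝ) (L : ℝ) (k : ℕ) (X : Finset ι) : Prop :=
  ∃ f : ι → ℕ, (∀ i ∈ X, f i < k) ∧ ∀ c < k, ∑ i ∈ X with f i = c, l i ≤ L

/-- Every dual solution of the continuous relaxation has value at most `m`. -/
def DualBound {ι : Type*} [Fintype ι] (l : ι → ℝ) (L m : ℝ) : Prop :=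
  ∀ (u : ι → ℝ) (D : ℝ), (∀ i, 0 ≤ u i) →
    (∀ S : Finset ι, ∑ i ∈ S, l i ≤ L → ∑ i ∈ S, u i ≤ D) → ∑ i, u i ≤ m * D

lemma Packable.mono {ι : Type*} [DecidableEq ι] {l : ι → ℝ} {L : ℝ} {k : ℕ} {X Y : Finset ι}
    (hl : ∀ i, 0 ≤ l i) (h : Packable l L k Y) (hXY : X ⊆ Y) : Packable l L k X := by
  obtain ⟨f, hf, hc⟩ := h
  refine ⟨f, fun i hi => hf i (hXY hi), fun c hk => le_trans ?_ (hc c hk)⟩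
  exact sum_le_sum_of_subset_of_nonneg (filter_subset_filter _ hXY) fun i _ _ => hl i

lemma packable_one {ι : Type*} {l : ι → ℝ} {L : ℝ} {X : Finset ι} :
    Packable l L 1 X ↔ ∑ i ∈ X, l i ≤ L := by
  constructor
  · rintro ⟨f, hf, hc⟩
    have := hc 0 one_pos
    rwa [filter_true_of_mem fun i hi => Nat.lt_one_iff.1 (hf i hi)] at this
  · intro h
    refine ⟨fun _ => 0, fun _ _ => one_pos, fun c hc => ?_⟩
    rw [Nat.lt_one_iff.1 hc]
    simpa using h

/-- Replacing an item by a smaller one preserves packability. -/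
lemma Packable.swap {ι : Type*} [DecidableEq ι] {l : ι → ℝ} {L : ℝ} {k : ℕ} {X : Finset ι}
    {a b : ι} (h : Packable l L k X) (hab : l b ≤ l a) (ha : a ∈ X) (hb : b ∉ X) :
    Packable l L k (insert b (X.erase a)) := by
  have hne : a ≠ b := fun h => hb (h ▸ ha)
  have hmem : ∀ i, i ∈ insert b (X.erase a) ↔ Equiv.swap a b i ∈ X := by
    intro i
    by_cases h1 : i = a
    · subst h1; simp [hb, hne]
    by_cases h2 : i = b
    · subst h2; simp [ha]
    · simp [Equiv.swap_apply_of_ne_of_ne h1 h2, h1, h2]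
  obtain ⟨f, hf, hc⟩ := h
  refine ⟨fun i => f (Equiv.swap a b i), fun i hi => hf _ ((hmem i).1 hi), fun c hk => ?_⟩
  refine le_trans ?_ (hc c hk)
  rw [sum_equiv (Equiv.swap a b) (t := X.filter fun i => f i = c)
    (g := fun i => l (Equiv.swap a b i))]
  · refine sum_le_sum fun i hi => ?_
    have hi : i ∈ X := (mem_filter.1 hi).1
    by_cases h1 : i = a
    · subst h1; simpa using hab
    · rw [Equiv.swap_apply_of_ne_of_ne h1 (by rintro rfl; exact hb hi)]
  · intro i
    rw [mem_filter, mem_filter, hmem]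
  · simp

lemma Packable.union {ι : Type*} [DecidableEq ι] {l : ι → ℝ} {L : ℝ} {k : ℕ} {X A : Finset ι}
    (h : Packable l L k X) (hA : ∑ i ∈ A, l i ≤ L) (hd : Disjoint X A) :
    Packable l L (k + 1) (X ∪ A) := by
  obtain ⟨f, hf, hc⟩ := h
  refine ⟨fun i => if i ∈ X then f i else k, fun i hi => ?_, fun c hk => ?_⟩
  · by_cases hX : i ∈ X
    · simpa [hX] using (hf i hX).trans (Nat.lt_succ_self k)
    · simp [hX]
  · rcases Nat.lt_succ_iff_lt_or_eq.1 hk with hk | rfl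
    · refine le_of_eq_of_le (sum_congr ?_ fun _ _ => rfl) (hc c hk)
      ext i
      by_cases hX : i ∈ X <;> simp [hX, hk.ne']
    · refine le_of_eq_of_le (sum_congr ?_ fun _ _ => rfl) hA
      ext i
      by_cases hX : i ∈ X
      · have h1 := (hf i hX).ne
        have h2 := disjoint_left.1 hd hX
        simp [hX, h1, h2]
      · simp [hX]

/-- The set of items encoded by the last nine binary digits of `j`. -/
def itemSet (j : ℕ) : Finset (Fin 9) := univ.filter fun i => j.testBit i = true

lemma mem_itemSet {j : ℕ} {i : Fin 9} : i ∈ itemSet j ↔ j.testBit i = true := by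
  simp [itemSet]

lemma itemSet_mod (j : ℕ) : itemSet (j % 512) = itemSet j := by
  ext i
  rw [mem_itemSet, mem_itemSet, show 512 = 2 ^ 9 from rfl, Nat.testBit_mod_two_pow]
  simp

lemma itemSet_mul_add (d j : ℕ) : itemSet (512 * d + j) = itemSet j := by
  rw [← itemSet_mod, Nat.mul_add_mod, itemSet_mod]

lemma testBit_sub_move : ∀ i : Fin 8, ∀ r < 512, r.testBit (i + 1) = true → r.testBit i = false →
    2 ^ i.val ≤ r ∧ itemSet (r - 2 ^ i.val) = insert i.castSucc ((itemSet r).erase i.succ) := by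
  decide +kernel

lemma testBit_sub_drop : ∀ r < 512, r.testBit 0 = true → itemSet (r - 1) = (itemSet r).erase 0 := by
  decide +kernel

lemma itemSet_compl : ∀ S < 512, (itemSet (511 - S))ᶜ = itemSet S := by
  decide +kernel

lemma exists_itemSet_compl : ∀ S : Finset (Fin 9), ∃ X < 512, itemSet X = Sᶜ := by
  intro S
  refine ⟨Nat.ofBits fun i : Fin 9 => decide (i ∉ S), Nat.ofBits_lt_two_pow _, ?_⟩
  ext i
  rw [mem_itemSet, Nat.testBit_ofBits_lt _ _ i.2, mem_compl, decide_eq_true_eq]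

lemma testBit_low {j i : ℕ} (hi : i < 9) : (j % 512).testBit i = j.testBit i := by
  rw [show 512 = 2 ^ 9 from rfl, Nat.testBit_mod_two_pow]
  simp [hi]

lemma itemSet_move {i j : ℕ} (hi : i < 8) (h1 : j.testBit (i + 1) = true)
    (h2 : j.testBit i = false) : (j - 2 ^ i) / 512 = j / 512 ∧
      itemSet (j - 2 ^ i) =
        insert (⟨i, by omega⟩ : Fin 9) ((itemSet j).erase ⟨i + 1, by omega⟩) := by
  obtain ⟨hle, he⟩ := testBit_sub_move ⟨i, hi⟩ (j % 512) (Nat.mod_lt _ (by norm_num))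
    (by rw [testBit_low (by show i + 1 < 9; omega)]; exact h1)
    (by rw [testBit_low (by show i < 9; omega)]; exact h2)
  dsimp only at hle he
  have hj := Nat.div_add_mod j 512
  have hr := Nat.mod_lt j (show 0 < 512 by norm_num)
  have e : j - 2 ^ i = 512 * (j / 512) + (j % 512 - 2 ^ i) := by
    generalize 2 ^ i = p at *
    omega
  rw [itemSet_mod] at he
  refine ⟨by generalize 2 ^ i = p at *; omega, ?_⟩
  rw [e, itemSet_mul_add, he]
  rfl

lemma itemSet_drop {j : ℕ} (h : j.testBit 0 = true) : (j - 1) / 512 = j / 512 ∧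
      itemSet (j - 1) = (itemSet j).erase 0 := by
  have he := testBit_sub_drop (j % 512) (Nat.mod_lt _ (by norm_num))
    (by rw [testBit_low (by norm_num)]; exact h)
  have hle : 1 ≤ j % 512 := by
    rcases Nat.eq_zero_or_pos (j % 512) with h0 | h0
    · have := testBit_low (j := j) (i := 0) (by norm_num)
      rw [h0, h] at this
      simp at this
    · exact h0
  have hj := Nat.div_add_mod j 512
  have hr := Nat.mod_lt j (show 0 < 512 by norm_num)
  have e : j - 1 = 512 * (j / 512) + (j % 512 - 1) := by omega
  rw [itemSet_mod] at he
  refine ⟨by omega, ?_⟩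
  rw [e, itemSet_mul_add, he]

lemma DualBound.sum_le {ι : Type*} [Fintype ι] {l : ι → ℝ} {L m : ℝ} (h : DualBound l L m)
    (hl : ∀ i, 0 ≤ l i) : ∑ i, l i ≤ m * L :=
  h l L hl fun _ hS => hS

namespace RefTree

/-- The intended meaning of the positions in the states of a refutation tree for `d + 2` bins. -/
def Meaning (l : Fin 9 → ℝ) (L : ℝ) (d j : ℕ) : Prop :=
  if j / 512 = d then L < ∑ i ∈ (itemSet j)ᶜ, l i else Packable l L (j / 512 + 1) (itemSet j)

variable {l : Fin 9 → ℝ} {L : ℝ} {d : ℕ}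

lemma meaning_bottom (hd : 1 ≤ d) {S : ℕ} (hS : S < 512) :
    Meaning l L d S ↔ ∑ i ∈ itemSet S, l i ≤ L := by
  rw [Meaning, Nat.div_eq_of_lt hS, if_neg (by omega), packable_one]

lemma meaning_top {X : ℕ} (hX : X < 512) :
    Meaning l L d (512 * d + X) ↔ L < ∑ i ∈ (itemSet X)ᶜ, l i := by
  rw [Meaning, itemSet_mul_add, if_pos (by omega)]

lemma inherited_meaning (hl : Monotone l) (h0 : ∀ i, 0 ≤ l i) : Inherited (Meaning l L d) where
  move := by
    intro i hi j h1 h2 h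
    obtain ⟨e1, e2⟩ := itemSet_move hi h1 h2
    have hle : l ⟨i, by omega⟩ ≤ l ⟨i + 1, by omega⟩ := hl (by simp)
    have ha : (⟨i + 1, by omega⟩ : Fin 9) ∈ itemSet j := mem_itemSet.2 h1
    have hb : (⟨i, by omega⟩ : Fin 9) ∉ itemSet j := by simp [mem_itemSet, h2]
    rw [Meaning, e1, e2]
    rw [Meaning] at h
    split_ifs at h ⊢
    · refine h.trans_le ?_
      have s1 := sum_add_sum_compl (itemSet j) l
      have s2 := sum_add_sum_compl
        (insert (⟨i, by omega⟩ : Fin 9) ((itemSet j).erase ⟨i + 1, by omega⟩)) l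
      rw [sum_insert (by simp [hb])] at s2
      have s3 := add_sum_erase (itemSet j) l ha
      linarith
    · exact h.swap hle ha hb
  drop := by
    intro j h1 h
    obtain ⟨e1, e2⟩ := itemSet_drop h1
    rw [Meaning, e1, e2]
    rw [Meaning] at h
    split_ifs at h ⊢
    · refine h.trans_le (sum_le_sum_of_subset_of_nonneg ?_ fun i _ _ => h0 i)
      exact compl_subset_compl.2 (erase_subset _ _)
    · exact h.mono h0 (erase_subset _ _)

lemma Inherited.top {Q : ℕ → Prop} (h : Inherited Q) (d : ℕ) :
    Inherited fun X => Q (512 * d + X) := by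
  have key : ∀ i < 9, ∀ X : ℕ, (512 * d + X).testBit i = X.testBit i := fun i hi X => by
    rw [← testBit_low hi, Nat.mul_add_mod, testBit_low hi]
  constructor
  · intro i hi j h1 h2 hj
    have := h.move i hi _ ((key _ (by omega) _).trans h1) ((key _ (by omega) _).trans h2) hj
    have hle := Nat.ge_two_pow_of_testBit h1
    rw [pow_succ] at hle
    rwa [Nat.add_sub_assoc (by omega)] at this
  · intro j h1 hj
    have := h.drop _ ((key 0 (by omega) _).trans h1) hj
    have hle := Nat.ge_two_pow_of_testBit h1
    rwa [Nat.add_sub_assoc hle] at this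

lemma weight_weights (k X : ℕ) : weight (weights k) X = ∑ i ∈ itemSet X, digit k i := by
  rw [itemSet, sum_filter]
  simp only [weights, weight, List.length_cons, List.length_nil, Fin.sum_univ_succ]
  simp
  ring

lemma sum_weights (k : ℕ) : (weights k).sum = ∑ i : Fin 9, digit k i := by
  simp [weights, Fin.sum_univ_succ]
  ring

lemma dual_meaning {m : ℕ} (hD : DualBound l L m) (k D : ℕ)
    (h : ∀ X < 512, weight (weights k) X < (weights k).sum - D → Meaning l L d (512 * d + X)) :
    (weights k).sum ≤ m * D := by
  have := hD (fun i => digit k i) D (fun i => Nat.cast_nonneg _) fun S hS => ?_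
  · rw [sum_weights]
    exact_mod_cast this
  · obtain ⟨X, hX, e⟩ := exists_itemSet_compl S
    have h1 : ¬ weight (weights k) X < (weights k).sum - D := fun hw => by
      have := (meaning_top hX).1 (h X hX hw)
      rw [e, compl_compl] at this
      exact absurd hS (not_le.2 this)
    rw [weight_weights, sum_weights, e] at h1
    have h2 := sum_add_sum_compl S fun i : Fin 9 => digit k i
    have h3 : ∑ i ∈ S, digit k i ≤ D := by omega
    exact_mod_cast h3

lemma sum_loads (F : List ℕ) :
    (F.map fun S => ∑ i ∈ itemSet S, l i).sum = ∑ i : Fin 9, (occ i F : ℝ) * l i := by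
  induction F with
  | nil => simp [occ]
  | cons S F ih =>
    rw [List.map_cons, List.sum_cons, ih, itemSet, sum_filter, ← sum_add_distrib]
    refine sum_congr rfl fun i _ => ?_
    rw [occ_eq, occ_eq, List.countP_cons]
    split_ifs <;> push_cast <;> ring

lemma suffixCheck_zero (t : ℕ) (F I : List ℕ) (i a b : ℕ) : suffixCheck t F I 0 i a b = true := rfl

lemma suffixCheck_succ (t : ℕ) (F I : List ℕ) (n i a b : ℕ) : suffixCheck t F I (n + 1) i a b =
    (Nat.ble (b + occ i I) (a + t + occ i F) &&
      suffixCheck t F I n (i - 1) (a + t + occ i F) (b + occ i I)) := rfl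

lemma sum_le_sum_of_suffixCheck (hl : Monotone l) (h0 : ∀ i, 0 ≤ l i) {t : ℕ} {F I : List ℕ}
    (h : suffixCheck t F I 9 8 0 0 = true) :
    ∑ i : Fin 9, (occ i I : ℝ) * l i ≤ ∑ i : Fin 9, (occ i F : ℝ) * l i + t * ∑ i, l i := by
  simp only [suffixCheck_succ, suffixCheck_zero, Bool.and_eq_true, and_true, Nat.ble_eq,
    Nat.reduceSub, zero_add] at h
  obtain ⟨h8, h7, h6, h5, h4, h3, h2, h1, h0'⟩ := h
  have step : ∀ (i j : Fin 9) (a b : ℕ), i ≤ j → b ≤ a →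
      0 ≤ ((a : ℝ) - b) * (l j - l i) := fun i j a b hij hab =>
    mul_nonneg (sub_nonneg.2 (by exact_mod_cast hab)) (sub_nonneg.2 (hl hij))
  have g8 := step 7 8 _ _ (by decide) h8
  have g7 := step 6 7 _ _ (by decide) h7
  have g6 := step 5 6 _ _ (by decide) h6
  have g5 := step 4 5 _ _ (by decide) h5
  have g4 := step 3 4 _ _ (by decide) h4
  have g3 := step 2 3 _ _ (by decide) h3
  have g2 := step 1 2 _ _ (by decide) h2
  have g1 := step 0 1 _ _ (by decide) h1
  have g0 := mul_nonneg (sub_nonneg.2 (Nat.cast_le (α := ℝ).2 h0')) (h0 0)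
  push_cast at g0 g1 g2 g3 g4 g5 g6 g7 g8
  have ex (f : Fin 9 → ℝ) : ∑ i, f i = f 0 + f 1 + f 2 + f 3 + f 4 + f 5 + f 6 + f 7 + f 8 := by
    simp only [Fin.sum_univ_succ, Fin.sum_univ_zero]
    simp
    ring
  rw [ex, ex, ex]
  simp only [Fin.coe_ofNat_eq_mod, Nat.reduceMod]
  linarith

lemma trade_meaning {m : ℕ} (hl : Monotone l) (h0 : ∀ i, 0 ≤ l i) (hL : 0 ≤ L)
    (hD : DualBound l L m) (t : ℕ) (F I : List ℕ) (hF : ∀ S ∈ F, ∑ i ∈ itemSet S, l i ≤ L)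
    (hI : ∀ S ∈ I, L < ∑ i ∈ itemSet S, l i) (h1 : 1 ≤ I.length)
    (h2 : F.length + m * t ≤ I.length) (h3 : suffixCheck t F I 9 8 0 0 = true) : False := by
  have hsum := sum_le_sum_of_suffixCheck hl h0 h3
  rw [← sum_loads, ← sum_loads] at hsum
  have f1 : (F.map fun S => ∑ i ∈ itemSet S, l i).sum ≤ F.length * L := by
    have := List.sum_le_card_nsmul (F.map fun S => ∑ i ∈ itemSet S, l i) L (by simpa using hF)
    simpa using this
  have f2 : I.length * L < (I.map fun S => ∑ i ∈ itemSet S, l i).sum := by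
    have := List.sum_lt_sum_of_ne_nil (l := I) (by rintro rfl; simp at h1) (fun _ => L)
      (fun S => ∑ i ∈ itemSet S, l i) hI
    simpa using this
  have f3 := mul_le_mul_of_nonneg_left (hD.sum_le h0) (Nat.cast_nonneg (α := ℝ) t)
  have f4 : (F.length + m * t : ℝ) * L ≤ I.length * L :=
    mul_le_mul_of_nonneg_right (by exact_mod_cast h2) hL
  nlinarith

lemma add_eq_lor_of_land_eq_zero {a b : ℕ} (h : a &&& b = 0) : a + b = a ||| b := by
  induction a using Nat.strong_induction_on generalizing b with
  | _ a ih =>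
    rcases Nat.eq_zero_or_pos a with rfl | ha
    · simp
    · have h1 : (a ||| b) / 2 = a / 2 ||| b / 2 := Nat.or_div_two
      rw [← ih (a / 2) (by omega) (by rw [← Nat.and_div_two, h])] at h1
      have h2 : (a ||| b) % 2 = 1 ↔ a % 2 = 1 ∨ b % 2 = 1 := Nat.or_mod_two_eq_one
      have h3 : (a &&& b) % 2 = 1 ↔ a % 2 = 1 ∧ b % 2 = 1 := Nat.and_mod_two_eq_one
      omega

theorem sound_meaning (hl : Monotone l) (h0 : ∀ i, 0 ≤ l i) (hL : 0 ≤ L) (hd : 1 ≤ d)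
    (hD : DualBound l L (d + 2 : ℕ)) (hN : ¬ Packable l L (d + 2) univ) :
    Sound (d + 2) (512 * d) (Meaning l L d) where
  inherited := inherited_meaning hl h0
  inherited_top := (inherited_meaning hl h0).top d
  add := by
    intro A hA hQA j hj hdisj hQj
    rw [meaning_bottom hd hA] at hQA
    have hlt : j / 512 < d := by omega
    rw [Meaning, if_neg hlt.ne] at hQj
    have hdis : Disjoint (itemSet j) (itemSet A) := by
      rw [disjoint_right]
      intro i hi hi'
      rw [mem_itemSet] at hi hi'
      rw [hdisj i i.2 hi] at hi'
      exact absurd hi' (by decide)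
    have hU := hQj.union hQA hdis
    have hlow : A + j % 512 < 512 ∧ itemSet (A + j % 512) = itemSet j ∪ itemSet A := by
      have hand : A &&& j % 512 = 0 := by
        refine Nat.eq_of_testBit_eq fun i => ?_
        rw [Nat.testBit_and, Nat.zero_testBit]
        by_cases hi : i < 9
        · rw [testBit_low hi]
          rcases h : A.testBit i with _ | _
          · rfl
          · rw [hdisj i hi h, Bool.and_false]
        · rw [Nat.testBit_lt_two_pow (hA.trans_le (Nat.pow_le_pow_right two_pos (not_lt.1 hi) :
            2 ^ 9 ≤ _)), Bool.false_and]
      rw [add_eq_lor_of_land_eq_zero hand]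
      refine ⟨Nat.or_lt_two_pow (n := 9) hA (Nat.mod_lt _ (by norm_num)), ?_⟩
      ext i
      rw [mem_union, mem_itemSet, mem_itemSet, mem_itemSet, Nat.testBit_or, testBit_low i.2,
        Bool.or_eq_true, or_comm]
    have e1 : 512 + A + j = 512 * (j / 512 + 1) + (A + j % 512) := by
      have := Nat.div_add_mod j 512
      omega
    have e2 : (512 + A + j) / 512 = j / 512 + 1 := by omega
    rw [Meaning, e2]
    rw [e1, itemSet_mul_add, hlow.2]
    split_ifs with h
    · by_contra hle
      rw [not_lt] at hle
      have := hU.union hle disjoint_compl_right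
      rw [union_compl, h] at this
      exact hN this
    · exact hU
  not_both := by
    intro S hS h1 h2
    rw [meaning_bottom hd hS] at h1
    rw [meaning_top (by omega), itemSet_compl S hS] at h2
    exact absurd h1 (not_le.2 h2)
  em := by
    intro S hS
    rw [meaning_bottom hd hS, meaning_top (by omega), itemSet_compl S hS]
    exact le_or_gt _ _
  dual := fun k D h => dual_meaning hD k D h
  trade := by
    intro t F I hF hI h1 h2 h3
    refine trade_meaning hl h0 hL hD t F I (fun S hS => ?_) (fun S hS => ?_) h1 h2 h3
    · exact (meaning_bottom hd (hF S hS).1).1 (hF S hS).2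
    · have := hI S hS
      rwa [meaning_top (by omega), itemSet_compl S this.1, and_iff_right this.1] at this

end RefTree

namespace RefTree

def threeBinsPart1 : RefTree :=
  br 160 (br 151 (br 96 (lp 18300341325922304) (br 147 (br 100 (tr 1 [] [100, 147, 264]) (br 113
  (br 145 (br 112 (br 144 (lp 36600612875403264) (br 107 (br 105 (br 104 (lp 73196827687780352)
  (lp 383716992194711617)) (br 259 (lp 310801639483641921) (br 106 (lp 255905153122046016) (lp
  438613478556311617)))) (br 259 (br 109 (lp 365698125845241921) (lp 182989800410976320)) (lp
  128093314049380352)))) (br 139 (br 137 (br 260 (tr 1 [] [113, 138, 260]) (br 111 (br 136 (lp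
  54900884408369152) (br 144 (lp 310528890806997057) (br 259 (lp 237609209825857601) (br 261 (lp
  328824834069635137) (br 105 (lp 273928347708035137) (lp 182712723464261696)))))) (br 136 (lp
  54900884408369152) (lp 328829162356478017)))) (br 144 (br 259 (lp 274209752924819521) (br 138 (lp
  219313266563223616) (lp 383725648718078017))) (br 259 (br 258 (lp 146393585582084160) (br 107 (lp
  237609209825857601) (lp 292505696187457601))) (br 261 (br 107 (lp 328824834069635137) (lp
  91497099220488192)) (lp 182712723464261696))))) (br 259 (br 144 (br 141 (lp 329106239286419521)
  (lp 164693857131565120)) (br 258 (lp 146393585582084160) (lp 292505696187457601))) (br 144 (lp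
  109797370769969152) (lp 91497099220488192))))) (br 259 (br 258 (br 112 (br 146 (lp
  182989800410976320) (br 148 (lp 128093314049380352) (br 152 (lp 219586015223353408) (lp
  164689528861495360)))) (br 146 (lp 146393585582084160) (br 148 (lp 237886286756061248) (br 152 (lp
  182989800394461248) (lp 128093314032603200))))) (br 260 (br 112 (br 148 (lp 128093314049380352)
  (br 152 (lp 347397854296019009) (lp 329097582746280001))) (br 148 (lp 383998397361434689) (br 152
  (lp 365698125812211777) (lp 255905153088495681)))) (br 112 (br 152 (br 105 (lp 347397854296019009)
  (lp 255905153122046016)) (lp 237604881572302913)) (br 152 (br 105 (lp 274205424638234689) (lp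
  420317535243608193)) (lp 383716992144384130))))) (br 112 (br 105 (br 104 (lp 73196827687780352)
  (br 146 (lp 255905153122046016) (lp 475209693368688705))) (br 260 (lp 128093314049380352) (lp
  255905153122046016))) (br 261 (br 260 (lp 91497099220488192) (br 105 (lp 365421048882012225) (lp
  511533159487385729))) (lp 182712723464261696))))) (br 145 (br 139 (br 137 (br 136 (lp
  54900884408369152) (br 259 (br 144 (lp 292510024457785409) (br 258 (lp 164693857115050048) (br 107
  (lp 255909481358823489) (lp 329106239253389377)))) (br 144 (br 114 (lp 219313266563223616) (lp
  402025920251043905)) (br 260 (lp 91497099220488192) (br 106 (lp 182712723464261696) (lp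
  347125105602601025)))))) (br 116 (br 261 (br 260 (br 140 (br 144 (lp 109797370769969152) (br 259
  (br 109 (lp 310805967720423489) (lp 219590343476650048)) (lp 91497099220488192))) (br 144 (lp
  164693857131565120) (lp 146393585582084160))) (br 144 (lp 219313266563223616) (br 108 (lp
  493237216207974529) (lp 402021591964196993)))) (br 144 (lp 219313266563223616) (lp
  182712723464261696))) (br 144 (lp 182994128664531008) (lp 164693857115050048)))) (br 259 (br 140
  (br 144 (lp 109797370769969152) (br 109 (lp 365702454082023489) (lp 219590343476650048))) (br 144
  (lp 164693857131565120) (lp 146393585582084160))) (br 144 (lp 109797370769969152) (lp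
  91497099220488192)))) (br 258 (br 116 (br 114 (br 146 (lp 146393585582084160) (br 148 (lp
  237886286756061248) (br 152 (lp 182989800394461248) (lp 128093314032603200)))) (br 146 (lp
  219590343476650048) (lp 91497099220488192))) (lp 164693857115050048)) (br 260 (lp
  91497099220488192) (lp 182712723464261696)))))) (br 113 (br 149 (br 98 (tr 1 [] [98, 149, 264])
  (br 260 (br 259 (br 112 (br 148 (lp 128093314049380352) (br 152 (br 105 (lp 438890555469996097)
  (lp 219586015223353408)) (br 258 (lp 164689528861495360) (lp 329097582746280001)))) (br 148 (br
  141 (lp 475491098535411777) (lp 237886286756061248)) (br 258 (br 152 (lp 182989800394461248) (lp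
  128093314032603200)) (br 152 (lp 365698125812211777) (lp 255905153088495681))))) (br 112 (br 148
  (lp 128093314049380352) (br 152 (lp 73196827687780352) (lp 109793042499899392))) (lp
  91497099220488192))) (br 152 (lp 73196827687780352) (br 100 (lp 347116449095491649) (lp
  274201096384680001))))) (br 259 (br 153 (br 258 (br 112 (br 150 (br 152 (lp 219586015223353408)
  (lp 164689528861495360)) (br 152 (lp 73196827687780352) (lp 201285743673872448))) (br 152 (lp
  182989800394461248) (lp 128093314032603200))) (br 152 (lp 73196827687780352) (br 99 (lp
  274201096384680001) (lp 365693797558657089)))) (br 258 (br 112 (br 150 (lp 164689528861495360) (br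
  154 (lp 201285743673872448) (br 156 (lp 109793042499899392) (lp 146389257312014400)))) (lp
  128093314032603200)) (br 260 (br 156 (lp 109793042499899392) (lp 219304610022821953)) (br 97 (lp
  219304610022821953) (lp 219304610023084096))))) (br 153 (br 152 (lp 73196827687780352) (br 261
  (br 99 (lp 383712663907868737) (lp 109793042499899392)) (br 97 (lp 292219962733891649) (lp
  219304610023084096)))) (br 261 (br 260 (lp 109793042499899392) (br 97 (lp 328816177546010689) (lp
  219304610023084096))) (lp 219304610023084096))))) (br 140 (lp 91497099220488192) (br 148 (lp
  237886286756061248) (br 152 (lp 182989800394461248) (lp 128093314032603200))))))) (br 155 (br 153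
  (br 152 (lp 73196827687780352) (br 99 (br 97 (br 96 (lp 18300341325922304) (lp
  328816177546268737)) (br 259 (lp 310797311197057089) (br 98 (lp 219304610023084096) (lp
  420308878720245825)))) (br 259 (br 101 (lp 402290012371034177) (lp 201285743673872448)) (lp
  109793042499899392)))) (br 97 (br 96 (lp 18300341325922304) (br 259 (lp 255900824835199041) (br
  154 (lp 219304610023084096) (lp 365412392358387777)))) (br 154 (br 258 (lp 201285743673872448) (br
  98 (lp 219304610023084096) (lp 109793042499899392))) (br 156 (lp 109793042499899392) (lp
  146389257312014400))))) (br 97 (br 96 (lp 18300341325922304) (br 259 (br 157 (lp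
  292497039647318081) (lp 146389257312014400)) (lp 109793042499899392))) (br 156 (lp
  109793042499899392) (lp 146389257312014400))))) (br 114 (br 155 (br 153 (br 113 (br 192 (br 263
  (br 262 (br 112 (br 107 (br 105 (br 259 (br 258 (br 104 (br 152 (lp 237881957429284928) (lp
  182985471067426880)) (br 152 (lp 201285742616907840) (lp 146389256255049792))) (br 104 (br 152 (br
  91 (lp 383989738707882049) (lp 475482439881859137)) (br 260 (lp 365689467158143041) (lp
  274196765984165953))) (br 260 (br 152 (lp 402290010257104961) (lp 292497037533388865)) (br 152 (lp
  310797309083127873) (lp 438604818811723906))))) (br 261 (br 104 (br 152 (br 91 (lp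
  530097519986483265) (lp 146389256255311872)) (br 260 (lp 91492769893453824) (lp
  365408060900909121))) (br 260 (lp 109793041442934784) (lp 420308875549352001))) (br 104 (br 152
  (lp 292497037533909056) (lp 182704064810192960)) (lp 219304607909154880)))) (br 108 (br 259 (br
  258 (br 106 (br 152 (lp 201285742616907840) (lp 146389256255049792)) (lp 256182228978507840)) (br
  260 (lp 457186496618704961) (br 106 (lp 475205361910947969) (lp 274201094270750785)))) (br 261 (br
  260 (lp 109793041442934784) (br 106 (lp 584716928377172097) (lp 383712660736974913))) (lp
  219304607909154880))) (br 258 (lp 164689527804530752) (br 91 (lp 274201094270750785) (lp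
  329097580632350785))))) (br 259 (br 258 (br 108 (lp 256182228978507840) (lp 164689527804530752))
  (br 108 (lp 512082982980304961) (lp 329097580632350785))) (lp 109793041442934784))) (br 259 (br
  258 (br 146 (lp 128093312975638592) (br 148 (lp 219586014149615680) (br 152 (lp
  164689527788015680) (lp 109793041426157632)))) (br 260 (br 108 (br 148 (lp 438890553322520641) (br
  152 (lp 329097580599320641) (lp 219304607875604545))) (lp 255905150974566465)) (br 152 (br 146 (br
  145 (lp 201008664612966465) (lp 365416717424271489)) (lp 237604879425343553)) (lp
  328816174325047426)))) (br 261 (br 260 (lp 73196826614042624) (br 145 (lp 273924016250298433) (br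
  105 (lp 310520231062675521) (lp 438332069061603457)))) (lp 146112178251370560)))) (br 112 (br 104
  (br 152 (lp 438604818812506177) (lp 273915359726932033)) (lp 328816174375374913)) (lp
  219027529888698433))) (lp 54896555081334784)) (br 263 (br 152 (br 259 (br 258 (br 106 (br 104 (lp
  219581617177104448) (br 112 (lp 182985402364727360) (lp 146389187535835200))) (br 112 (br 108 (lp
  237881888726327360) (lp 146389187552350272)) (br 108 (lp 201285673897435200) (lp
  109792972723458112)))) (br 107 (br 105 (br 104 (br 59 (lp 347389058203521089) (lp
  438881759377498177)) (br 112 (br 260 (lp 365689329752744001) (lp 274196628578766913)) (br 260 (lp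
  292496900094959681) (lp 201004198920982593)))) (br 112 (br 260 (br 108 (lp 420585816114344001) (lp
  292496900127989825)) (br 145 (lp 237600413766389825) (lp 420304341154406529))) (br 260 (br 108 (lp
  347393386456559681) (lp 219304470470205505)) (br 145 (lp 164407984108605505) (lp
  310515696667730049))))) (br 112 (br 108 (lp 475482302475944001) (lp 292496900127989825)) (br 108
  (lp 402289872818159681) (lp 219304470470205505))))) (br 261 (br 112 (br 105 (br 104 (br 59 (lp
  475196499229941825) (lp 128088916003131392)) (br 260 (lp 91492701190754304) (lp
  365407854792810561))) (br 260 (lp 91492701190754304) (br 106 (lp 511515567368450177) (lp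
  328811639980433473)))) (br 260 (lp 54896486361862144) (br 145 (lp 219022995493756993) (br 105 (lp
  255619210306134081) (lp 365130708052881537))))) (br 112 (br 151 (br 262 (br 146 (lp
  182703927404793920) (lp 255896357029548096)) (br 104 (lp 347107583243587649) (lp
  273915153618833473))) (br 57 (lp 383703798055964737) (lp 255896357029548096))) (br 262 (lp
  109511497747009600) (lp 164126509132156993))))) (br 259 (br 260 (br 112 (br 258 (br 150 (lp
  128088916002869312) (lp 164685130815246400)) (br 104 (lp 329088786653782081) (lp
  255896357029027905))) (br 258 (lp 91492701173977152) (lp 182703927371243585))) (br 104 (lp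
  237596085479804993) (br 112 (lp 383703798055182466) (lp 273915153568505986)))) (br 261 (br 260 (lp
  73192429641273344) (lp 310507040144367681)) (br 262 (lp 146103384305832000) (lp
  219014338970390593))))) (lp 36596214829154304))) (br 152 (br 259 (br 258 (br 108 (br 148 (br 192
  (lp 219586014149615680) (lp 201285673897435200)) (br 192 (lp 164689527788015680) (lp
  146389187535835200))) (br 192 (lp 128093312975638592) (lp 109792972723458112))) (br 192 (br 260
  (br 108 (lp 365698123664736321) (lp 329101908869132353)) (br 145 (lp 347120774144860289) (lp
  328820502595379329))) (br 260 (br 108 (lp 329097443160375361) (lp 292501228364771393)) (br 145 (lp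
  292219753388318849) (lp 273919481838837889))))) (br 261 (br 260 (br 192 (lp 73196826614042624)
  (lp 54896486361862144)) (br 192 (br 106 (lp 401735854232711297) (lp 420036125782192257)) (br 106
  (lp 328534493223989377) (lp 346834764773470337)))) (br 192 (lp 146112178251370560) (lp
  109511497747009600)))) (br 192 (lp 109793041426157632) (lp 91492701173977152)))) (br 192 (br 259
  (br 258 (br 142 (lp 109793041426157632) (br 150 (lp 146389256255049792) (br 154 (lp
  182985471067426880) (br 156 (lp 219581685879545920) (lp 128088984705568832))))) (br 260 (br 156
  (lp 402285681970262081) (lp 255896494434426945)) (br 97 (lp 219300279622307905) (lp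
  402004275713024129)))) (br 261 (br 260 (lp 91492769893453824) (br 97 (lp 310511574539051073) (lp
  493215570629767297))) (lp 182704064810192960))) (br 104 (br 259 (br 258 (br 154 (lp
  164685130815246400) (br 156 (lp 201281345627365440) (lp 109788644453388352))) (br 260 (br 156 (lp
  365685001465901121) (lp 219295813930065985)) (br 97 (lp 182699599117946945) (lp
  347103254956482689)))) (br 261 (br 260 (lp 73192429641273344) (br 97 (lp 255610553782509633) (lp
  420014209621045377))) (lp 146103384305832000))) (br 112 (lp 128088916002869312) (lp
  91492701173977152))))) (br 259 (br 258 (br 156 (br 192 (lp 219581685879545920) (lp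
  201281345627365440)) (br 192 (lp 128088984705568832) (lp 109788644453388352))) (br 192 (br 156 (lp
  438881896782381121) (lp 255896494434426945)) (br 156 (lp 402281216278020161) (lp
  219295813930065985)))) (br 192 (lp 91492769893453824) (lp 73192429641273344)))) (br 259 (br 258
  (br 116 (br 108 (br 192 (lp 182989799320723520) (lp 164689459068543040)) (br 192 (lp
  201290070870204480) (lp 182989730618024000))) (br 192 (lp 146393584508604480) (lp
  128093244256424000))) (br 192 (br 260 (br 137 (lp 292505694040498241) (br 108 (lp
  365698123664736321) (lp 329101908869132353))) (lp 219308936145932353)) (br 260 (br 137 (lp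
  255905013536137281) (br 108 (lp 329097443160375361) (lp 292501228364771393))) (lp
  182708255641571393)))) (br 260 (br 192 (lp 73196826614042624) (lp 54896486361862144)) (br 192 (lp
  292224287783264321) (lp 237323267026722881)))))

def threeBinsPart2 : RefTree :=
  br 152 (br 151 (br 263 (br 262 (br 259 (br 258 (br 192 (br 112 (br 108 (br 106 (br 150 (br 162
  (lp 201285742616907840) (lp 274478171184439360)) (br 162 (lp 237881957429284928) (lp
  146389256255311872))) (br 162 (lp 256182228978507840) (lp 109793041442934784))) (lp
  164689527804530752)) (br 108 (br 106 (br 162 (lp 164689527788015680) (lp 237881956355547200)) (br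
  162 (lp 219586014149615680) (lp 201285741543170112))) (lp 128093312975638592))) (br 150 (br 112
  (br 108 (br 106 (br 162 (lp 182985402364727360) (lp 256177830932258880)) (br 162 (lp
  237881888726327360) (lp 219581616119881792))) (lp 146389187552350272)) (br 108 (br 106 (br 162 (lp
  146389187535835200) (lp 219581616103366720)) (br 162 (lp 201285673897435200) (lp
  182985401290989632))) (lp 109792972723458112))) (br 162 (lp 219581617177104448) (lp
  292774045744635968)))) (br 193 (br 192 (br 112 (br 105 (br 104 (br 260 (lp 146389256255311872)
  (br 89 (lp 329093251289059393) (lp 292497037533909056))) (br 260 (lp 475482438824636481) (br 89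
  (lp 292497036476682305) (lp 493501304116879489)))) (br 260 (lp 109793041442934784) (lp
  219304607909154880))) (br 260 (br 148 (lp 402290008109629505) (lp 402290009166852161)) (br 146 (lp
  347116444817825921) (br 89 (lp 219304606818897985) (lp 383712659630203009))))) (br 105 (br 112 (br
  260 (br 104 (lp 475477973132652609) (lp 438881758320275521)) (br 147 (br 89 (lp
  255896355972321345) (lp 438600283360338049)) (br 89 (lp 329088785597075521) (lp
  511792712985092225)))) (br 260 (lp 365689328662491201) (br 89 (lp 182703926314537025) (lp
  328811638873661569)))) (br 112 (br 260 (lp 438881757263052865) (lp 402004068547960961)) (br 260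
  (lp 365689327605268545) (lp 292215424061284481))))) (br 260 (br 112 (br 149 (br 148 (lp
  91492701190754304) (lp 420581418068095041)) (lp 128088916003131392)) (br 148 (lp
  329088647100907585) (lp 347388988410310721))) (br 147 (br 112 (br 146 (lp 182703927404793920) (br
  89 (lp 401999670501712001) (lp 420299943108157569))) (br 105 (br 89 (lp 292211026015035521) (lp
  310511298621481089)) (lp 273915083809104001))) (br 89 (lp 475192100126466177) (lp
  255896357029548096)))))) (br 63 (br 59 (br 112 (br 261 (br 105 (br 60 (br 104 (br 260 (lp
  128088916003131392) (br 58 (br 89 (lp 602999541152886913) (lp 255896357029548096)) (br 89 (lp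
  420300011811119169) (lp 639600154011512961)))) (br 260 (lp 91492701190754304) (br 58 (br 89 (lp
  493210896715755649) (lp 511511169322201217)) (br 89 (lp 347107582186364993) (lp
  529811509574381697))))) (br 260 (tr 1 [] [59, 192, 260]) (br 104 (br 89 (lp 438600352063299649)
  (lp 292497037533909056)) (br 89 (lp 365407922438545473) (lp 548111849826562177))))) (br 60 (br 260
  (lp 91492701190754304) (br 58 (lp 182703927404793920) (lp 493215294762004609))) (br 260 (lp
  109793041442934784) (lp 219304607909154880)))) (br 58 (br 146 (lp 182703927404793920) (br 162 (lp
  255896357029548096) (lp 219295811816656960))) (br 146 (lp 219304607909154880) (br 162 (lp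
  292497037533909056) (lp 54896555081334784))))) (br 261 (br 193 (br 260 (br 192 (lp
  73196826614042624) (lp 54896486361862144)) (br 192 (br 146 (lp 365130775698616449) (br 89 (lp
  255619277951868993) (lp 401726990510993537))) (br 146 (lp 346830435446435969) (br 89 (lp
  237318937699688513) (lp 383426650258813057))))) (br 260 (lp 54896486361862144) (br 146 (lp
  328530095194255489) (br 89 (lp 346826037400187009) (lp 365126310006632577))))) (br 192 (lp
  146112178251370560) (lp 109511497747009600)))) (br 261 (br 149 (br 112 (br 192 (br 105 (br 104
  (br 260 (lp 146389256255311872) (br 89 (lp 420304477503103041) (lp 292497037533909056))) (br 260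
  (lp 109793041442934784) (br 89 (lp 383708262690725953) (lp 584712530330923137)))) (br 260 (lp
  109793041442934784) (lp 219304607909154880))) (br 148 (lp 91492701190754304) (lp
  128088916003131392))) (br 192 (br 260 (lp 73196826614042624) (br 146 (lp 401731456202977409) (br
  89 (lp 273919618204049473) (lp 438327671015354497)))) (lp 54896486361862144))) (br 192 (br 260 (lp
  146389256255311872) (br 89 (lp 456900692315480129) (lp 292497037533909056))) (lp
  128088916003131392))) (br 112 (br 146 (lp 219304607909154880) (br 162 (lp 292497037533909056) (lp
  54896555081334784))) (lp 146112178251370560)))) (br 261 (br 112 (br 105 (br 104 (br 260 (lp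
  146389256255311872) (br 89 (lp 475201032567660609) (lp 292497037533909056))) (br 260 (lp
  109793041442934784) (br 89 (lp 402008602942906433) (lp 603012870583103617)))) (br 260 (lp
  109793041442934784) (lp 219304607909154880))) (br 260 (lp 73196826614042624) (br 146 (lp
  420031796455157889) (br 89 (lp 292219958456229953) (lp 456628011267534977))))) (br 112 (br 146 (lp
  219304607909154880) (br 162 (lp 292497037533909056) (lp 54896555081334784))) (lp
  146112178251370560))))) (br 193 (br 192 (lp 54896555081334784) (lp 328802980236628033)) (lp
  36596214829154304))) (br 192 (lp 54896555081334784) (lp 36596214829154304))) (br 193 (br 263 (br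
  261 (br 192 (br 92 (br 260 (lp 146389256255311872) (br 89 (lp 511797247380037697) (lp
  292497037533909056))) (lp 237881957429284928)) (br 259 (br 260 (br 258 (br 92 (lp
  292774045744635968) (lp 219581617177104448)) (lp 512074187945029697)) (br 89 (lp
  329088785597075521) (lp 548388927797469313))) (br 260 (lp 128088916003131392) (br 89 (lp
  456896226623496257) (lp 676196368823890049))))) (br 192 (br 262 (br 162 (lp 292497037533909056)
  (lp 54896555081334784)) (lp 54896555081334784)) (br 262 (br 162 (lp 255896357029548096) (lp
  219295811816656960)) (lp 328802980236628033)))) (br 192 (lp 54896555081334784) (lp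
  36596214829154304))) (br 261 (br 60 (br 260 (lp 128088916003131392) (br 89 (lp 639595755965264001)
  (lp 255896357029548096))) (br 92 (lp 292774045744635968) (lp 219581617177104448))) (br 56 (lp
  36596214829154304) (br 88 (lp 219295811816656960) (lp 255896357029548096)))))) (br 259 (br 260 (br
  193 (br 192 (br 258 (br 112 (br 150 (br 162 (lp 146389256255049792) (lp 219581684822581312)) (br
  162 (lp 182985471067426880) (lp 256177899634958400))) (br 162 (lp 109793041426157632) (lp
  182985469993689152))) (br 112 (br 104 (lp 438881895725674561) (lp 438881894668451905)) (lp
  292497036443136065))) (br 258 (br 112 (br 150 (br 162 (lp 128088916002869312) (lp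
  201281344570400832)) (br 162 (lp 164685130815246400) (lp 237877559382777920))) (br 162 (lp
  91492701173977152) (lp 164685129741508672))) (br 112 (br 104 (lp 402281215221313601) (lp
  329088785596559425)) (lp 255896355938775105)))) (br 258 (br 112 (br 150 (br 162 (lp
  128088916002869312) (lp 201281344570400832)) (br 162 (lp 164685130815246400) (lp
  237877559382777920))) (br 162 (lp 91492701173977152) (lp 164685129741508672))) (br 112 (br 104
  (lp 438872963284484161) (lp 365680533659729985)) (lp 237596015686594625)))) (br 104 (br 193 (br
  192 (br 89 (lp 255896493377720385) (lp 438600489468436609)) (br 89 (lp 219295812873359425) (lp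
  383699468711895169))) (br 89 (lp 347098855853269121) (lp 365399128459714689))) (br 112 (br 193 (br
  192 (br 87 (br 89 (lp 402004273598832770) (lp 548112054877171906)) (tr 0 [87, 104] [90, 99])) (br
  87 (br 89 (lp 347103252842291330) (lp 474910693868449986)) (tr 0 [87, 104] [90, 99]))) (br 55 (br
  89 (lp 602709270099149059) (lp 438310013364089026)) (tr 0 [55, 104] [58, 99]))) (br 63 (br 193
  (br 192 (br 162 (br 79 (lp 365126515057242306) (tr 0 [79, 112] [90, 99])) (br 79 (lp
  255614948607795330) (tr 0 [79, 112] [89, 99]))) (br 162 (br 79 (lp 328525834552881346) (tr 0 [79,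
  112] [90, 99])) (br 79 (lp 237314608355614850) (tr 0 [79, 112] [89, 99])))) (br 47 (br 89 (lp
  419728195954688259) (lp 291925154048520386)) (tr 0 [47, 112] [58, 99]))) (br 162 (br 79 (lp
  401727195561603266) (tr 0 [79, 112] [90, 99])) (br 79 (lp 292215629112156290) (tr 0 [79, 112]
  [89, 99]))))))) (br 261 (br 260 (br 192 (lp 91492769893453824) (lp 73192429641273344)) (br 193
  (br 192 (br 89 (lp 347107788294463553) (lp 529811784385179777)) (br 89 (lp 292206767537922113) (lp
  456610423376457857))) (br 89 (lp 420009810517831809) (lp 438310083124277377)))) (br 192 (lp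
  182704064810192960) (lp 146103384305832000))))

def threeBinsPart3 : RefTree :=
  br 163 (br 161 (threeBinsPart1) (br 113 (br 153 (br 194 (threeBinsPart2) (br 112 (br 261 (br
  260 (br 105 (br 104 (br 152 (lp 128088916003131392) (br 101 (br 100 (lp 73192429641273344) (lp
  438872963284484161)) (lp 219577219130597440))) (br 149 (br 148 (lp 91492701190754304) (br 152 (lp
  420581418068095041) (br 101 (lp 365680533659729985) (lp 182981004318220352)))) (br 152 (lp
  237877490680078400) (lp 182981004318220352)))) (br 148 (lp 91492701190754304) (br 152 (lp
  237877490680078400) (lp 182981004318220352)))) (br 104 (br 152 (lp 438595886371315777) (br 100 (lp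
  273906427285741633) (lp 200995472621178945))) (br 259 (br 152 (lp 237596015720140865) (br 55 (lp
  310502572337930370) (tr 0 [55, 104] [58, 99]))) (lp 328807241934184513)))) (lp 36596214829154304))
  (br 260 (br 141 (br 140 (lp 54896486361862144) (br 148 (lp 329088647100907585) (br 152 (br 105
  (lp 347388988410310721) (lp 201281275851186240)) (br 258 (lp 146384789489328192) (lp
  237596015686594625))))) (br 148 (lp 164685061038809152) (br 152 (lp 201281275851186240) (lp
  146384789489328192)))) (br 152 (br 140 (lp 219018597447508033) (lp 164403586062356545)) (br 47 (lp
  346817242363867331) (tr 0 [47, 112] [58, 99])))))) (br 162 (br 156 (br 112 (br 193 (br 192 (br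
  258 (br 150 (lp 146389256255049792) (br 154 (lp 182985471067426880) (lp 219581685879545920))) (br
  260 (lp 91492769893453824) (lp 182704064810192960))) (br 259 (br 258 (br 150 (lp
  128088916002869312) (br 154 (lp 164685130815246400) (lp 201281345627365440))) (br 260 (lp
  365680671065129025) (lp 328802982350037121))) (br 261 (br 260 (lp 73192429641273344) (lp
  401713937014599809)) (lp 146103384305832000)))) (br 258 (br 150 (lp 128088916002869312) (br 154
  (lp 164685130815246400) (lp 201281345627365440))) (br 260 (lp 73192429641273344) (lp
  146103384305832000)))) (br 192 (lp 109793041426157632) (lp 91492701173977152))) (br 62 (lp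
  109788644453388352) (lp 128088984705568832))) (br 112 (br 104 (br 100 (br 193 (br 192 (lp
  91492769893453824) (br 61 (br 60 (lp 73192429641273344) (lp 365680671065129025)) (lp
  182981073020919872))) (br 60 (lp 73192429641273344) (lp 182981073020919872))) (br 193 (br 192 (lp
  256177899634958400) (lp 237877559382777920)) (br 194 (lp 237877559382777920) (lp
  219577219130597440)))) (br 193 (br 192 (lp 219581684822581312) (lp 201281344570400832)) (br 194
  (lp 201281344570400832) (lp 182981004318220352)))) (br 193 (br 192 (lp 182985469993689152) (lp
  164685129741508672)) (br 194 (lp 164685129741508672) (lp 146384789489328192)))))) (br 259 (br 152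
  (br 194 (br 258 (br 116 (br 114 (br 108 (br 106 (br 162 (br 192 (lp 164689527788015680) (lp
  146389187535835200)) (br 192 (lp 237881956355547200) (lp 219581616103366720))) (br 162 (br 62 (lp
  201285673897435200) (lp 219586014149615680)) (br 62 (lp 182985401290989632) (lp
  201285741543170112)))) (br 62 (lp 109792972723458112) (lp 128093312975638592))) (br 108 (br 162
  (br 62 (lp 164689459068543040) (lp 182989799320723520)) (br 62 (lp 146389186462097472) (lp
  73196826614042624))) (br 62 (lp 182989730618024000) (lp 201290070870204480)))) (br 62 (lp
  128093244256424000) (lp 146393584508604480))) (br 260 (br 193 (br 192 (lp 73196826614042624) (lp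
  292496897947484225)) (lp 54896486361862144)) (br 193 (br 192 (lp 146112178251370560) (lp
  255619209232392321)) (lp 109511497747009600)))) (br 140 (lp 54896486361862144) (br 148 (lp
  164685061038809152) (lp 201281275851186240)))) (br 193 (br 162 (br 192 (lp 109793041426157632) (lp
  91492701173977152)) (br 192 (lp 182985469993689152) (lp 164685129741508672))) (br 162 (lp
  91492701173977152) (br 194 (lp 164685129741508672) (lp 146384789489328192))))) (br 261 (br 193
  (br 260 (br 192 (lp 73196826614042624) (lp 54896486361862144)) (br 192 (lp 146112178251370560)
  (lp 310234220617543809))) (br 260 (lp 54896486361862144) (lp 109511497747009600))) (br 192 (lp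
  146112178251370560) (lp 109511497747009600)))))) (br 195 (br 113 (br 193 (br 112 (br 263 (br 261
  (br 192 (br 260 (br 151 (br 149 (br 148 (lp 109793041442934784) (br 105 (br 104 (br 258 (tr 1 []
  [104, 149, 258]) (br 152 (lp 146389256255311872) (br 100 (lp 91492769893453824) (lp
  438881894668451905)))) (br 152 (lp 548674867392168001) (br 101 (lp 438881894668451905) (lp
  219581684822581312)))) (br 152 (lp 274478171184439360) (lp 219581684822581312)))) (br 104 (br 153
  (br 152 (lp 146389256255311872) (br 259 (br 101 (lp 475478109480828993) (lp 256177899634958400))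
  (lp 91492769893453824))) (br 100 (lp 91492769893453824) (lp 256177899634958400))) (br 102 (lp
  219581684822581312) (lp 274478171184439360)))) (br 153 (br 152 (lp 146389256255311872) (br 259 (br
  101 (lp 512074324293206081) (lp 256177899634958400)) (lp 91492769893453824))) (br 100 (lp
  91492769893453824) (lp 256177899634958400)))) (lp 54896555081334784)) (br 151 (br 149 (br 259 (br
  88 (tr 1 [] [88, 164, 259]) (br 258 (br 148 (lp 219581616119881792) (br 152 (lp
  256177830932258880) (lp 201281344570400832))) (br 148 (lp 438881757263052865) (br 152 (lp
  512074186887807041) (lp 402281214164090945))))) (br 260 (br 148 (lp 91492701190754304) (br 152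
  (lp 128088916003131392) (lp 73192429641273344))) (lp 401995408804159553))) (br 103 (br 260 (br
  259 (br 258 (br 150 (br 102 (lp 201281344570400832) (lp 256177830932258880)) (br 153 (br 102 (lp
  237877559382777920) (lp 292774045744635968)) (br 154 (lp 237877559382777920) (lp
  182981073020919872)))) (br 153 (br 101 (lp 438877428976468033) (lp 493773915338326081)) (lp
  365680671065129025))) (br 152 (lp 128088916003131392) (lp 73192429641273344))) (br 259 (tr 1 []
  [88, 164, 259]) (lp 401995408804159553))) (br 259 (br 88 (tr 1 [] [88, 164, 259]) (br 258 (br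
  150 (lp 256177830932258880) (lp 292774045744635968)) (lp 548670401700184129))) (br 260 (lp
  128088916003131392) (lp 401995408804159553))))) (br 259 (br 88 (tr 1 [] [88, 164, 259]) (br 153
  (br 258 (br 152 (lp 292774045744635968) (lp 237877559382777920)) (br 152 (lp 585266616512561217)
  (lp 475473643788845121))) (br 258 (br 154 (lp 237877559382777920) (lp 182981073020919872)) (lp
  365680671065129025)))) (br 260 (br 152 (lp 128088916003131392) (lp 73192429641273344)) (lp
  401995408804159553))))) (br 192 (lp 54896555081334784) (br 57 (lp 328802980236628033) (lp
  219295811816656960)))) (br 192 (lp 54896555081334784) (lp 36596214829154304))) (br 141 (br 140 (br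
  258 (tr 1 [] [113, 140, 258]) (br 192 (lp 73196826614042624) (br 60 (lp 54896486361862144) (lp
  292496897947484225)))) (br 148 (br 192 (lp 402290008109629505) (br 61 (lp 365689327605268545) (lp
  182985401290989632))) (br 152 (br 192 (br 105 (lp 475482437734383681) (lp 237881956355547200)) (br
  258 (lp 219581616103366720) (lp 438881757230022721))) (br 192 (br 258 (lp 182985469993689152) (lp
  365689465010667585)) (br 258 (lp 164685129741508672) (lp 329088784506306625)))))) (br 106 (br 102
  (br 192 (lp 182985469993689152) (lp 164685129741508672)) (br 192 (lp 237881956355547200) (lp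
  219581616103366720))) (br 192 (lp 201285741543170112) (lp 182985401290989632))))) (br 112 (br 60
  (br 261 (br 260 (br 149 (br 148 (lp 91492701190754304) (br 105 (br 104 (br 258 (tr 1 [] [104,
  149, 258]) (br 152 (lp 128088916003131392) (br 100 (lp 73192429641273344) (lp
  365680533659729985)))) (br 152 (lp 475473506383446081) (br 101 (lp 365680533659729985) (lp
  182981004318220352)))) (br 152 (lp 237877490680078400) (lp 182981004318220352)))) (br 104 (br 153
  (br 152 (lp 128088916003131392) (br 101 (br 100 (lp 73192429641273344) (lp 438872963284484161))
  (lp 219577219130597440))) (br 100 (lp 73192429641273344) (lp 219577219130597440))) (br 102 (lp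
  182981004318220352) (lp 237877490680078400)))) (br 57 (lp 383695068551979073) (lp
  219295811816656960))) (br 56 (lp 36596214829154304) (lp 219295811816656960))) (br 149 (br 148 (lp
  219581616119881792) (br 152 (lp 256177830932258880) (lp 201281344570400832))) (br 150 (br 102 (lp
  201281344570400832) (lp 256177830932258880)) (br 153 (br 152 (lp 292774045744635968) (lp
  237877559382777920)) (br 154 (lp 237877559382777920) (lp 182981073020919872)))))) (br 259 (br 258
  (br 106 (br 102 (br 194 (lp 164685129741508672) (lp 146384789489328192)) (br 194 (lp
  219581616103366720) (lp 201281275851186240))) (br 194 (lp 182985401290989632) (lp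
  164685061038809152))) (br 148 (lp 329088647100907585) (br 152 (lp 402281076725661761) (lp
  292488104001945665)))) (lp 54896486361862144)))) (br 140 (br 193 (br 192 (lp 73196826614042624)
  (br 61 (br 60 (lp 54896486361862144) (lp 292496897947484225)) (lp 146389186462097472))) (br 60 (lp
  54896486361862144) (lp 146389186462097472))) (br 148 (br 193 (br 192 (lp 201285741543170112) (lp
  182985401290989632)) (br 194 (lp 182985401290989632) (lp 164685061038809152))) (br 152 (br 193 (br
  192 (lp 237881956355547200) (lp 219581616103366720)) (br 194 (lp 219581616103366720) (lp
  201281275851186240))) (br 193 (br 192 (lp 182985469993689152) (lp 164685129741508672)) (br 194 (lp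
  164685129741508672) (lp 146384789489328192))))))) (br 113 (br 112 (br 105 (br 104 (br 153 (br 57
  (br 258 (tr 1 [] [89, 164, 258]) (br 56 (lp 36596214829154304) (br 152 (lp 128088916003131392)
  (br 100 (lp 73192429641273344) (lp 438872963284484161))))) (br 152 (lp 128088916003131392) (br
  101 (br 100 (lp 73192429641273344) (lp 438872963284484161)) (lp 219577219130597440)))) (br 100
  (lp 73192429641273344) (lp 219577219130597440))) (br 149 (br 148 (lp 91492701190754304) (br 152
  (lp 475473506383446081) (br 101 (lp 365680533659729985) (lp 182981004318220352)))) (br 102 (lp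
  182981004318220352) (lp 237877490680078400)))) (br 148 (lp 91492701190754304) (br 152 (lp
  237877490680078400) (lp 182981004318220352)))) (br 141 (br 140 (lp 54896486361862144) (br 148 (lp
  329088647100907585) (br 152 (br 105 (lp 402281076725661761) (lp 201281275851186240)) (br 258 (lp
  146384789489328192) (lp 292488104001945665))))) (br 148 (lp 164685061038809152) (br 152 (lp
  201281275851186240) (lp 146384789489328192))))) (br 140 (lp 54896486361862144) (br 148 (lp
  164685061038809152) (br 152 (lp 201281275851186240) (lp 146384789489328192))))))

def threeBinsPart4 : RefTree :=
  br 99 (br 97 (br 96 (lp 18300341325922304) (br 160 (br 259 (lp 219304610022821953) (br 261 (lp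
  328816177546010689) (br 153 (lp 292219962733891649) (lp 438327745069195393)))) (br 192 (br 259 (lp
  182704064809930817) (br 261 (lp 273915359726673985) (br 262 (lp 365126654643413121) (lp
  237319144914554945)))) (br 259 (lp 146103384305569857) (br 261 (lp 219014338970132545) (br 262 (lp
  291925293634691201) (lp 182418124158013505))))))) (br 161 (br 160 (br 104 (br 100 (br 98 (br 262
  (lp 182708395210707008) (lp 255623747921776704)) (br 152 (lp 420031801806561345) (lp
  347116449095491649))) (br 152 (lp 310520234283372609) (lp 237604881572302913))) (br 259 (lp
  237604881572302913) (br 261 (lp 365416720644972609) (br 145 (lp 273924019470995521) (lp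
  201008666760187968))))) (br 192 (br 104 (br 100 (br 259 (br 98 (lp 328811846088269953) (lp
  474919627366609026)) (br 98 (br 261 (lp 420023141005013121) (br 262 (lp 511234435921752257) (lp
  438042006297518209))) (br 261 (lp 292215631276154945) (br 89 (lp 346830711380779073) (lp
  492938492659118209))))) (br 259 (lp 201004336359411777) (br 261 (lp 547834979020714114) (br 89 (lp
  255619416464035905) (lp 401727197742375041))))) (br 259 (lp 201004336359411777) (br 261 (lp
  310515902825635905) (br 262 (lp 420027469291856001) (lp 273919688013516865))))) (br 104 (br 100
  (br 98 (br 262 (br 259 (lp 273910825331728513) (br 58 (lp 419732734660849857) (lp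
  346821779996291201))) (lp 346540305036615809)) (br 259 (lp 401718266357887106) (br 261 (lp
  237314610519613505) (br 57 (lp 273629350372057153) (lp 401436791398215809))))) (br 259 (lp
  164403655855050817) (br 261 (lp 456333277759811714) (br 57 (lp 200718395707494465) (lp
  328525836733653121))))) (br 259 (lp 164403655855050817) (br 261 (lp 255614882069094465) (br 262
  (lp 346826108283134081) (lp 219018667256975425))))))) (br 194 (br 262 (br 193 (br 192 (br 104 (br
  100 (br 98 (lp 146107849997815872) (br 162 (br 152 (lp 620746001331011777) (lp
  420023139948048513)) (br 261 (lp 273915358669709377) (lp 328530438774333505)))) (br 259 (br 162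
  (lp 328811845031305345) (lp 456619353703198850)) (br 162 (lp 529534706414268609) (br 88 (lp
  565849513912447106) (lp 511234433807822978))))) (br 148 (br 146 (lp 164408121547296832) (br 162
  (lp 438323411497529473) (lp 292215630219190337))) (br 162 (lp 328811845031305345) (lp
  456619353703198850)))) (br 149 (br 104 (br 162 (br 60 (br 100 (br 261 (lp 346821778939326593) (br
  98 (lp 401432462054404289) (lp 510943959817928897))) (br 259 (lp 273910824274763905) (br 58 (lp
  438033005153366209) (lp 675347614599237890)))) (br 100 (lp 492925162171154626) (lp
  273910824274763905))) (br 100 (br 259 (lp 365117721144995970) (br 261 (lp 219014337913167937) (lp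
  364836246185324673))) (br 259 (lp 383417992694476930) (br 261 (lp 419732732546920578) (lp
  565554640819077314))))) (br 162 (br 259 (lp 273910824274763905) (br 261 (lp 365122050488807553)
  (lp 456333276702847169))) (br 259 (lp 383417992694476930) (lp 237314609462648897)))) (br 259 (lp
  255610552725282945) (br 58 (lp 401432462054404289) (lp 328521507389845633))))) (br 104 (br 100 (br
  162 (br 98 (lp 109507169493454912) (br 152 (lp 492643619565748417) (lp 328521438687146113))) (br
  261 (lp 310221166080700545) (lp 456043074352857281))) (br 259 (br 162 (lp 255610484022583425) (lp
  456324480609829058)) (br 162 (lp 419732664901185729) (br 88 (lp 747968297154142530) (lp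
  602146388881985794))))) (br 148 (br 146 (lp 127807441042935872) (br 162 (lp 346821710236627073)
  (lp 328521437630181505))) (br 162 (lp 255610484022583425) (lp 456324480609829058))))) (br 193 (br
  192 (br 100 (br 98 (lp 200722930102440000) (br 85 (lp 328530438774333505) (lp
  529253300157296769))) (br 85 (lp 565849513912447106) (lp 438042005240553601))) (br 100 (br 98 (lp
  328240032430170241) (br 85 (lp 255329077765611585) (lp 419451258644213889))) (br 85 (lp
  437747132147183746) (lp 346540303979651201)))) (br 100 (br 98 (lp 145821909345898560) (br 85 (lp
  382850645785587841) (lp 401150918392033409))) (br 85 (lp 565268700167160002) (lp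
  328239963727470721))))) (br 104 (br 56 (br 100 (lp 237028737513431105) (lp 419446791895003266))
  (br 100 (lp 200713997660987457) (br 152 (lp 383132052042559618) (lp 346817312190115970)))) (br 148
  (lp 219014269210468417) (lp 346817312190115970)))))) (br 147 (br 161 (br 160 (br 145 (br 144 (lp
  36600612875403264) (br 259 (lp 255905153121783873) (br 261 (lp 383716992194453569) (br 105 (lp
  328820505832853569) (lp 511528831267119233))))) (br 146 (br 262 (lp 201008666760187968) (lp
  273924019471257664)) (br 104 (lp 438332073356042305) (lp 365416720644972609)))) (br 192 (br 145
  (br 259 (lp 219304607908892737) (br 261 (lp 328816174375116865) (br 262 (lp 438327740841336961)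
  (lp 273919688013516865)))) (br 259 (br 146 (lp 365412389187231873) (lp 511520170465570946)) (br
  146 (br 261 (lp 474923955653456001) (br 262 (lp 584435522119676097) (lp 474642549396480129))) (br
  261 (lp 310515902825635905) (br 89 (lp 365130982930260033) (lp 511238764208599169)))))) (br 259
  (br 145 (lp 182703927404531777) (br 146 (lp 310511368430690433) (lp 438318809456849026))) (br 261
  (br 145 (lp 273915153618575425) (br 146 (lp 401722594644734081) (lp 255614882069094465))) (br 146
  (br 262 (br 102 (lp 492933820858773697) (lp 365126379832615041)) (br 145 (lp 219018667256975425)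
  (lp 383140848135577729))) (br 57 (lp 291929621921538113) (lp 419737062947696769))))))) (br 193 (br
  192 (br 262 (br 146 (lp 164408121547296832) (br 162 (br 104 (lp 639046272880492737) (lp
  438323411497529473)) (br 261 (lp 292215630219190337) (lp 346830710323814465)))) (br 146 (lp
  219023201651920960) (br 85 (lp 346830710323814465) (lp 547553571706777729)))) (br 262 (br 259 (br
  146 (lp 292211095824244865) (br 162 (lp 529525705270116546) (lp 401718264243957890))) (br 261 (br
  146 (lp 383422322038288513) (br 162 (lp 365122050488807553) (lp 237314609462648897))) (br 146 (lp
  474633548252328129) (br 162 (lp 529244231367409857) (lp 383136517734805633))))) (br 146 (lp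
  364840575529132161) (br 85 (lp 273629349315092545) (lp 437751530193694849))))) (br 262 (br 146 (lp
  127807441042935872) (br 261 (br 162 (lp 346821710236627073) (br 194 (lp 328521437630181505) (lp
  219014269210468417))) (br 162 (lp 510943891115229377) (br 194 (lp 474343345902338241) (lp
  255329009062912065))))) (br 146 (lp 164122180895379520) (br 162 (lp 419451189941514369) (br 53 (lp
  255329009062912065) (lp 401150917335068801))))))) (br 259 (tr 1 [] [104, 148, 259]) (br 163 (br
  161 (br 160 (lp 146112180398592000) (br 192 (br 261 (lp 401727197742379073) (br 89 (lp
  456342277847003201) (lp 602450059125342337))) (br 57 (lp 364840576586100801) (br 58 (lp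
  492648017612259457) (lp 328525836733657153))))) (br 193 (br 192 (br 262 (br 162 (lp
  255619416464040000) (br 88 (lp 438042005240557633) (lp 383426925135933505))) (br 85 (lp
  438042005240557633) (lp 310234496568664128))) (br 262 (br 162 (br 58 (lp 602155186031972545) (lp
  438033005153370241)) (br 261 (lp 310225564127211585) (lp 456047472399368321))) (br 85 (lp
  346540303979655233) (lp 510662484858257537)))) (br 262 (br 162 (lp 200718395707498560) (br 194 (br
  88 (lp 547254300566900929) (lp 401432392294744193)) (br 261 (lp 291925223875031105) (lp
  328239963727474753)))) (br 162 (lp 237033135559942208) (br 53 (lp 328239963727474753) (lp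
  474061871999631489)))))) (br 195 (br 193 (br 192 (lp 109511635185700864) (br 57 (lp
  328240031373209665) (br 58 (lp 437747199792922753) (lp 291925291520766017)))) (br 262 (br 194 (lp
  182418123101052992) (br 56 (lp 309939691121029185) (lp 273624951268585537))) (br 53 (lp
  309939691121029185) (lp 218732862953496640)))) (lp 72910954681339904)))))

def threeBinsPart5 : RefTree :=
  br 161 (br 192 (br 99 (br 263 (br 100 (br 98 (br 97 (br 160 (br 96 (lp 18300341325922304) (br
  259 (lp 182708395193929793) (br 261 (lp 292219962717118529) (br 153 (lp 255623747904999489) (lp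
  401731530240303233))))) (br 259 (lp 146107849981038657) (br 261 (lp 237319144897781825) (br 262
  (lp 328530439814520961) (lp 200722930085662785))))) (br 160 (br 262 (lp 146112180381814848) (lp
  219027533092884544)) (br 259 (lp 255619416430485633) (br 261 (lp 346830711347228801) (br 262 (lp
  438042006263967937) (lp 364849576639733889)))))) (br 160 (br 152 (lp 346839372148777025) (lp
  273924019437707329)) (br 259 (lp 365130982879932546) (br 261 (lp 219023201618370625) (br 89 (lp
  273638281722994753) (lp 383149848172441729)))))) (br 160 (br 152 (lp 237327804625588289) (lp
  401735858493595778)) (br 259 (lp 328534768067813506) (br 261 (lp 401450119705145474) (br 89 (lp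
  182426986806251585) (lp 291938553255698561)))))) (br 97 (br 96 (lp 18300341325922304) (br 160 (lp
  328539100616069185) (lp 255338010190286913))) (br 160 (br 100 (br 98 (lp 219027533092884544) (lp
  419754724859846721)) (lp 310243157336657985)) (br 100 (br 98 (lp 419464656744358017) (lp
  328253361827618881)) (lp 237042066910875713))))) (br 259 (tr 1 [] [112, 140, 259]) (br 160 (br
  101 (br 100 (lp 109515965569699840) (lp 401458781580435521)) (br 102 (lp 200731589813473344) (lp
  291947214057246785))) (br 89 (br 88 (br 101 (br 100 (lp 401168713464950849) (lp
  309957418548207681)) (br 102 (lp 382872770185535617) (lp 218746123631464513))) (br 102 (br 101 (br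
  100 (lp 346553633360326721) (lp 255342338443583553)) (lp 328257690080911489)) (lp
  401173041718239362))) (br 145 (tr 1 [] [104, 145, 262]) (br 90 (br 101 (br 100 (lp
  456065199809773697) (lp 364853904893030529)) (lp 437769256530358465)) (br 146 (tr 1 [] [104, 146,
  261]) (br 100 (lp 291938553255702593) (lp 474365471342477442))))))))) (br 153 (br 99 (br 263 (br
  259 (br 139 (lp 255333407059091586) (br 141 (lp 291929621871210626) (br 97 (lp 109507169476677697)
  (lp 200718395673944193)))) (br 100 (br 261 (br 141 (lp 164122180861829185) (br 97 (lp
  182418124141240385) (lp 273629350338506881))) (br 98 (br 57 (br 97 (lp 145821909329121345) (br 152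
  (lp 273347875378831489) (lp 237033135526387841))) (br 97 (lp 255329078805799041) (lp
  237033135526387841))) (br 57 (lp 200436920714272833) (lp 291648146911539329)))) (br 261 (lp
  309948418444243074) (br 57 (lp 127525966049710145) (lp 218737192246976641))))) (br 100 (br 141 (lp
  236751660566716481) (br 97 (lp 182136649181564993) (lp 309662615231275137))) (lp
  163840705902153793))) (br 259 (tr 1 [] [112, 140, 259]) (br 263 (br 101 (br 57 (br 100 (lp
  255051932099424321) (lp 182140977434861633)) (br 58 (br 100 (lp 346263158296690817) (lp
  273352203632128129)) (br 100 (lp 218737192246980673) (lp 364563429829394562)))) (br 261 (tr 1 []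
  [104, 146, 261]) (br 262 (br 145 (tr 1 [] [104, 145, 262]) (lp 327967215017275585)) (br 102 (lp
  236755988820009089) (lp 291371000205156482))))) (br 101 (br 100 (lp 291366671951867969) (lp
  218455717287305281)) (br 102 (lp 273070728672452737) (lp 327685740057600130)))))) (br 97 (br 259
  (lp 109507169476677697) (br 261 (lp 182418124141240385) (lp 255329078805799041))) (br 259 (lp
  200718395673944193) (br 58 (lp 346540305003065537) (lp 273629350338506881)))))) (br 194 (br 162
  (br 99 (br 100 (br 263 (br 262 (br 193 (br 192 (br 98 (lp 109511635168923712) (br 152 (lp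
  474361142015443137) (lp 310234495461372033))) (br 60 (br 58 (br 98 (lp 328240032396619969) (br 152
  (lp 364559100502360257) (lp 237033134452650113))) (br 98 (lp 255329077732061313) (lp
  237033134452650113))) (br 98 (lp 182418123067498625) (lp 346540302855585986)))) (br 98 (lp
  72910954664562752) (br 152 (lp 346258760250179777) (lp 218732794200469633)))) (br 193 (br 192 (br
  98 (lp 164126715273547840) (lp 419464655670620289)) (br 98 (lp 255047602772385921) (lp
  309662614157537409))) (br 98 (lp 109225694517006400) (lp 291362273905356929)))) (br 193 (br 192
  (br 98 (lp 164126715273547840) (lp 474079735775244417)) (br 98 (lp 291362342624829569) (lp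
  345977354009981057))) (br 98 (lp 109225694517006400) (lp 327677013757800577)))) (br 263 (br 262
  (br 193 (br 192 (br 152 (lp 383149847098699969) (lp 510957355753816322)) (br 259 (lp
  401155314240733442) (br 58 (lp 291648145837797569) (lp 455770325625884930)))) (br 152 (lp
  273347805585617089) (lp 364554633736372482))) (br 193 (br 192 (lp 328253360753877121) (lp
  236751659492974721)) (lp 345977285290504385))) (br 193 (br 192 (lp 382868440858501249) (lp
  273066399345418369)) (lp 382292025142948033)))) (br 259 (tr 1 [] [112, 140, 259]) (br 101 (br 193
  (br 263 (br 192 (br 262 (br 100 (lp 182426986806255680) (lp 456065198736031937)) (br 100 (lp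
  237042066910879808) (lp 401168712391209089))) (br 262 (br 58 (br 100 (lp 419174111887511745) (lp
  346263157222949057)) (br 100 (lp 291648145837801601) (lp 510385337011036418))) (br 100 (lp
  364277625542688897) (lp 291366670878126209)))) (br 192 (br 100 (lp 237042066910879808) (lp
  455783792495833217)) (br 100 (lp 400592365395132545) (lp 327681410730569857)))) (br 56 (br 100 (lp
  163840705902157888) (lp 436907036528099521)) (br 100 (lp 127525966049714240) (lp
  327962816970768577)))) (br 261 (tr 1 [] [104, 146, 261]) (br 263 (br 193 (br 192 (br 262 (lp
  255342338443583616) (lp 145830771994136640)) (br 262 (lp 400878168608096513) (lp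
  345981682263273665))) (br 262 (lp 182140977434861696) (lp 218455717287305344))) (br 193 (br 192
  (lp 145830771994136640) (lp 382296422115717313)) (lp 218455717287305344))))))) (br 100 (br 99 (br
  263 (br 261 (br 193 (br 192 (lp 200722929011925057) (br 60 (lp 145821908255383617) (lp
  255329076658319490))) (lp 273343476258586753)) (br 193 (br 192 (lp 255338009116549185) (br 57 (lp
  182136648107827265) (lp 255047601698648193))) (br 262 (lp 382569169701851329) (lp
  345972955963474049)))) (br 193 (br 192 (lp 309953089221173313) (lp 218451387960270913)) (lp
  382287695815917697))) (br 259 (tr 1 [] [112, 140, 259]) (br 193 (br 192 (br 88 (lp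
  382868440858505281) (lp 273638280649257025)) (br 57 (br 56 (lp 273066399345422401) (br 88 (lp
  236751659492978753) (lp 200436919640535105))) (br 261 (lp 200436919640535105) (lp
  309662613083799681)))) (br 263 (br 262 (br 88 (lp 437184181087002817) (lp 327958487643738241)) (lp
  400587967348625537)) (lp 436902707201069185))))) (br 193 (br 192 (br 152 (br 88 (br 99 (lp
  528694814806126722) (lp 291657145941762113)) (br 99 (lp 364849574492254338) (lp
  437764926129586306))) (lp 492657083147370691)) (br 263 (br 259 (br 148 (tr 1 [] [104, 148, 259])
  (lp 382855041634287811)) (br 261 (br 99 (lp 273347873231351938) (lp 327962884616503426)) (br 57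
  (br 99 (lp 309662613083795586) (lp 364277624468947074)) (br 99 (lp 382573566674616514) (lp
  437188578059768002))))) (br 99 (lp 382292092788682882) (lp 436907104173834370)))) (br 152 (br 88
  (br 140 (br 57 (br 56 (br 31 (lp 509532117112737986) (tr 0 [31, 100] [46, 77])) (br 31 (lp
  400587897555407042) (tr 0 [31, 100] [46, 77]))) (br 31 (lp 546409804737048898) (tr 0 [31, 100]
  [46, 77]))) (br 57 (br 56 (br 31 (lp 454917105727586498) (tr 0 [31, 100] [46, 77])) (br 31 (lp
  345972886170255554) (tr 0 [31, 100] [46, 77]))) (br 31 (lp 491794793351897410) (tr 0 [31, 100]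
  [46, 77])))) (br 140 (br 31 (lp 437184111293784322) (tr 0 [31, 100] [46, 77])) (br 31 (lp
  382569099908632834) (tr 0 [31, 100] [46, 77])))) (br 31 (lp 473775928059388227) (tr 0 [31, 100]
  [46, 77])))))) (br 99 (br 263 (br 261 (br 100 (lp 200432522667765825) (br 259 (br 31 (lp
  327954020877746371) (tr 0 [31, 100] [46, 77])) (br 31 (lp 236747192726990978) (tr 0 [31, 100]
  [46, 77])))) (br 100 (lp 236747262520209473) (br 31 (lp 273061932579434626) (tr 0 [31, 100] [46,
  77])))) (br 100 (lp 273062002372653121) (br 31 (lp 345691412284321922) (tr 0 [31, 100] [46,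
  77])))) (br 56 (br 100 (lp 327677013757804609) (br 31 (lp 400306423669473410) (tr 0 [31, 100]
  [46, 77]))) (br 100 (lp 255047534052917313) (br 31 (lp 291362204112142466) (tr 0 [31, 100] [46,
  77]))))))

def threeBinsPart6 : RefTree :=
  br 272 (br 113 (br 112 (br 263 (threeBinsPart4) (br 147 (br 96 (lp 18300341325922304) (br 145
  (br 144 (lp 36600612875403264) (br 160 (lp 401735858543923265) (br 192 (lp 328534768118140993) (lp
  255333407109419073)))) (br 161 (br 160 (br 146 (lp 273924019471257664) (br 99 (lp
  383435586994442305) (lp 511247426067112001))) (br 192 (br 146 (lp 529257629501104257) (br 99 (lp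
  310234496568660033) (lp 419746063034884161))) (br 146 (lp 419455587988021377) (br 99 (lp
  237033135559938113) (lp 328244361773981761))))) (br 193 (br 192 (br 146 (lp 219023201651920960)
  (br 99 (br 85 (lp 675079674121695362) (lp 492657085345177729)) (br 85 (lp 401445790428438593) (lp
  602168651811401857)))) (br 146 (lp 401155315381575809) (br 99 (br 85 (lp 510376611852071042) (lp
  382855043832094849)) (br 85 (lp 309944089167536193) (lp 474066270046138497))))) (br 146 (lp
  164122180895379520) (br 99 (br 162 (lp 364554703579914369) (br 53 (lp 492076271599890562) (lp
  637898179872047298))) (br 162 (lp 455765929793958017) (br 53 (lp 291643748915355713) (lp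
  437465657187512449))))))))) (br 99 (br 161 (br 160 (br 97 (br 96 (lp 18300341325922304) (lp
  365135315444961345)) (br 98 (lp 255623747921776704) (lp 492947154517631041))) (br 192 (br 149 (lp
  401445791485403201) (br 97 (lp 291934225019179073) (lp 492657086402142337))) (br 149 (lp
  309944090224500801) (br 97 (lp 218732864010457153) (lp 382855044889059457))))) (br 193 (br 192 (br
  98 (lp 200722930102440000) (br 85 (lp 383145518878957633) (lp 583868380261920897))) (br 98 (lp
  364554772282613889) (br 85 (lp 291643817618055233) (lp 455765998496657537)))) (br 98 (lp
  145821909345898560) (br 162 (lp 437465658244477057) (br 53 (lp 273343477365874753) (lp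
  419165385638031489)))))) (br 163 (br 161 (br 160 (lp 146112180398592000) (br 192 (lp
  510957357951627329) (lp 401155316438544449))) (br 193 (br 192 (br 85 (lp 492657085345181761) (lp
  310234496568664128)) (br 85 (lp 382855043832098881) (lp 546977224710701185))) (br 162 (lp
  237033135559942208) (br 53 (lp 364554703579918401) (lp 510376611852075137))))) (br 195 (br 193 (br
  192 (lp 109511635185700864) (lp 364554771225653313)) (br 53 (lp 346254430973472833) (lp
  218732862953496640))) (lp 72910954681339904)))))) (br 162 (br 161 (br 145 (br 192 (br 144 (br
  259 (lp 219313266562961473) (br 261 (lp 328829162356219969) (br 137 (lp 273932675994619969) (lp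
  438345058149474433)))) (br 160 (br 259 (lp 182712723463999553) (br 261 (lp 273928347707777089) (br
  262 (lp 365143971951550593) (lp 219031861346177089)))) (br 259 (lp 146112178251108417) (br 261 (lp
  219027529888440385) (br 262 (lp 291942881525768321) (lp 364858233163096194)))))) (br 259 (lp
  109511497746747457) (br 261 (lp 164126509131898945) (br 262 (lp 218741520517046401) (lp
  273356531902193794))))) (br 192 (br 259 (br 160 (br 146 (lp 310524562519892097) (br 99 (lp
  164412451914518593) (lp 438336401575784578))) (br 146 (lp 255623744700555393) (br 99 (lp
  292219959512670338) (lp 365135311150002306)))) (br 160 (br 261 (br 146 (lp 401740186763669633) (lp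
  255628076158296129)) (lp 492955811007443137)) (br 138 (br 90 (lp 401454447975215297) (lp
  328539096337887361)) (br 146 (lp 328539096337887361) (lp 438050662787334274))))) (br 259 (br 146
  (lp 200722723944013953) (br 99 (lp 237318938756128898) (lp 291933950141280386))) (br 261 (br 101
  (lp 346548961526431874) (lp 255337735329165441)) (lp 309952746714312897))))) (br 193 (br 192 (br
  140 (br 261 (br 146 (lp 438050661730369729) (br 79 (lp 510961684023890114) (tr 0 [79, 112] [86,
  101]))) (lp 510966013367697665)) (br 148 (br 146 (lp 365135310093037761) (br 79 (lp
  438046332386558146) (tr 0 [79, 112] [86, 101]))) (br 79 (lp 365130980749226178) (tr 0 [79, 112]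
  [86, 101])))) (br 101 (br 138 (tr 1 [] [101, 138, 272]) (br 259 (br 79 (br 99 (lp
  291929619740504258) (lp 346544631125655746)) (tr 0 [79, 112] [86, 101])) (br 79 (lp
  401159642510807234) (tr 0 [79, 112] [86, 101])))) (br 259 (lp 291933949084315841) (br 261 (lp
  346548960469467329) (lp 401163971854614785))))) (br 101 (br 138 (tr 1 [] [101, 138, 272]) (br 47
  (br 140 (lp 455770188203712770) (br 99 (lp 346540165433409794) (lp 401155176818561282))) (tr 0
  [47, 112] [54, 101]))) (br 138 (lp 382863631602434305) (br 140 (lp 328248620217286849) (lp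
  273633608832135361)))))) (br 193 (br 192 (br 148 (br 140 (br 79 (lp 401450117574443138) (tr 0
  [79, 112] [85, 85])) (br 79 (lp 328534765937111170) (tr 0 [79, 112] [85, 85]))) (br 79 (lp
  456342274592227523) (tr 0 [79, 112] [85, 85]))) (br 259 (br 79 (br 99 (lp 364840573331325123) (lp
  255333404928389250)) (tr 0 [79, 112] [85, 85])) (br 79 (lp 309948416313540738) (tr 0 [79, 112]
  [85, 85])))) (br 259 (br 99 (br 194 (br 31 (lp 492357605865840964) (tr 0 [31, 112] [54, 85]))
  (br 31 (lp 309939552574783683) (tr 0 [31, 112] [54, 85]))) (br 194 (br 31 (lp 401150777715085571)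
  (tr 0 [31, 112] [54, 85])) (br 31 (lp 218732724424028290) (tr 0 [31, 112] [54, 85])))) (br 194
  (br 31 (lp 510380800485388547) (tr 0 [31, 112] [54, 85])) (br 31 (lp 273347735809179778) (tr 0
  [31, 112] [54, 85]))))))) (br 193 (br 114 (br 192 (br 145 (br 144 (lp 164416780201365568) (br
  160 (br 259 (lp 292228619240480897) (br 106 (lp 474659867728031937) (lp 383444243484258433))) (br
  259 (lp 237327801421144193) (br 261 (lp 310243153058476161) (lp 383158504695804097))))) (br 161
  (br 160 (lp 127816237102403648) (br 259 (lp 346839367870591169) (br 90 (lp 492670071145251073) (lp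
  419754719507923137)))) (lp 219027529888440448))) (br 259 (br 86 (lp 364849232002171137) (br 102
  (lp 273638006861869249) (lp 182426780664602753))) (br 261 (br 86 (lp 419464243387322625) (br 102
  (lp 328253018247020737) (lp 237041792049754241))) (br 86 (lp 474079254772470081) (br 102 (lp
  382868029632168193) (lp 291656803434901697)))))) (br 144 (lp 292232947527327809) (br 259 (br 160
  (lp 401744515016962178) (br 192 (lp 328543424591179906) (lp 255342063582457986))) (br 160 (lp
  237332132878884929) (br 192 (lp 401458776228511874) (lp 309957074967609474)))))) (lp
  164126509131899008))) (br 108 (br 105 (br 104 (br 163 (threeBinsPart5) (br 259 (tr 1 [] [112,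
  140, 259]) (br 195 (br 193 (br 192 (lp 72915420356808704) (br 57 (br 56 (lp 327677081403539521)
  (lp 291362341551095873)) (br 58 (lp 364273295141916801) (lp 255047601698652225)))) (br 56 (br 194
  (lp 218451387960275008) (lp 382287695815921729)) (br 194 (lp 182136648107831360) (lp
  309658216111034433)))) (lp 109225694517010432)))) (br 161 (br 192 (br 160 (br 101 (br 261 (br 140
  (lp 255628076158296129) (br 259 (lp 164412451914518593) (lp 456355267924996226))) (br 138 (br 137
  (lp 219031861346177089) (br 262 (lp 346843700402069633) (lp 291947214056988737))) (br 262 (br 99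
  (lp 328543428869103745) (lp 419759053112881281)) (br 99 (lp 200731589813211201) (lp
  291947214056988737))))) (br 137 (lp 219031861346177089) (br 262 (lp 346843700402069633) (lp
  383162838300762241)))) (br 140 (br 92 (br 138 (br 261 (br 102 (lp 474369799595770050) (lp
  364858233146323074)) (br 262 (br 102 (lp 273642609976287361) (lp 437773584783651010)) (br 137 (lp
  164131043526840385) (lp 474088393355309250)))) (br 261 (lp 200727258338959425) (br 262 (lp
  510684608167428290) (lp 401173041717981314)))) (br 137 (lp 291942881508991106) (br 101 (lp
  328539096321110146) (lp 401454447958438082)))) (br 259 (lp 127811906701627457) (br 261 (lp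
  364853904892768386) (br 262 (lp 437769256530096322) (lp 328257690080649346)))))) (br 60 (br 140
  (br 58 (br 138 (br 262 (br 102 (lp 200441248967565441) (lp 327971543270568130)) (br 137 (lp
  255056260352712834) (lp 345986011590045890))) (br 261 (lp 145826237582417985) (br 262 (lp
  382582226402164930) (lp 291371000204898434)))) (br 137 (lp 273356531885420674) (br 101 (lp
  145826237582417985) (lp 364567758082687170)))) (br 259 (lp 91211226197266497) (br 261 (lp
  273352203631865986) (br 262 (lp 327967215017013442) (lp 236755988819746946))))) (br 137 (lp
  218741520500269186) (br 138 (lp 309952746697535682) (br 99 (lp 91211226197266497) (lp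
  255337735312388226)))))) (br 194 (br 162 (br 193 (br 192 (br 140 (br 138 (lp 364853903819288769)
  (br 261 (lp 291938552181960833) (lp 419468983923654849))) (br 259 (lp 219023200544628865) (br 146
  (lp 346553632286322881) (lp 547276492578771202)))) (br 259 (br 138 (lp 364563427681911042) (br 99
  (lp 164122179788087425) (lp 309948416296763586))) (br 140 (br 261 (br 101 (lp 218737191173238913)
  (lp 419178439067062530)) (br 138 (lp 273352202558386369) (lp 528404133583806786))) (br 261 (lp
  419174110813507842) (lp 473789122198655298))))) (br 140 (br 138 (lp 346263088503472385) (br 261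
  (lp 291648077118324929) (lp 382577828355657985))) (br 259 (lp 237033065733173441) (br 146 (lp
  327962816970506497) (lp 473784656506413378))))) (br 193 (br 192 (br 140 (lp 182426985732513857)
  (br 259 (lp 310234494387630210) (lp 528976219972325571))) (br 259 (br 99 (lp 237033133378908290)
  (lp 382859369887584451)) (br 140 (lp 291648144764059778) (lp 400873838207062211)))) (br 140 (br 31
  (lp 327958417850519746) (tr 0 [31, 100] [46, 77])) (br 259 (br 31 (lp 273343406465368258) (tr 0
  [31, 100] [46, 77])) (br 31 (lp 491794724632162627) (tr 0 [31, 100] [46, 77])))))) (br 140 (br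
  31 (lp 255047464259698818) (tr 0 [31, 100] [46, 77])) (br 259 (br 31 (lp 200432452874547330) (tr
  0 [31, 100] [46, 77])) (br 31 (lp 345972817450520771) (tr 0 [31, 100] [46, 77]))))))) (br 161
  (br 192 (br 160 (br 137 (br 133 (lp 237332132878884929) (lp 328547757122658433)) (lp
  127816237102403648)) (br 92 (br 137 (br 261 (br 133 (lp 182431315059548225) (lp
  456073856316358850)) (lp 255346666696876161)) (br 90 (lp 364858233146323137) (lp
  291942881508995201))) (br 137 (br 133 (lp 310243153041698946) (lp 383158504679026882)) (lp
  219027529871663233)))) (br 60 (br 137 (br 58 (lp 400886826188423426) (br 133 (lp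
  291656803418128514) (lp 346271814803275970))) (br 261 (lp 218741520500273281) (lp
  273356531885420737))) (br 137 (br 133 (lp 237041792032977026) (lp 291656803418124482)) (lp
  164126509115121793)))) (br 193 (br 192 (lp 91215691889512512) (br 259 (lp 237037462705942721) (br
  58 (lp 346267485476241665) (lp 291652474091094209)))) (lp 145826237582418048)))) (br 160 (lp
  146116508635107393) (br 192 (lp 109515963422216257) (lp 182426780647825538))))

def threeBinsPart7 : RefTree :=
  br 99 (br 98 (br 161 (br 97 (br 96 (lp 18300341325922304) (br 192 (br 263 (br 160 (br 262 (lp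
  365135315427926145) (br 266 (lp 438050668138995841) (br 147 (lp 219027533092622401) (lp
  328539100615811137)))) (br 262 (lp 291934225002143873) (br 266 (lp 346549305106768001) (br 268 (lp
  255338010190028865) (lp 164126715273285697))))) (br 160 (br 266 (lp 510966020850065537) (br 147
  (lp 291942885803692097) (lp 401454453326880833))) (br 266 (lp 401164385211392129) (br 268 (lp
  309953090294652993) (lp 218741795377909825))))) (br 263 (br 262 (lp 218732863993421953) (br 266
  (lp 255047603845865601) (br 268 (lp 182136649181306945) (lp 109225694516744257)))) (br 266 (lp
  291362343698309249) (br 51 (lp 145540434369187905) (lp 218451389033750593)))))) (br 192 (br 263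
  (br 160 (br 262 (lp 146112180381814848) (br 266 (lp 219027533092884544) (br 268 (lp
  291942885803696192) (lp 182431318280507456)))) (br 262 (lp 401445791451590849) (br 266 (lp
  510675951660839105) (br 268 (lp 474079736848466049) (lp 291657147014979713))))) (br 160 (br 266
  (lp 219027533092884544) (br 268 (lp 291942885803696192) (lp 182431318280507456))) (br 266 (lp
  565291031765463233) (br 268 (lp 528694816953090177) (lp 346272227119603841))))) (br 263 (br 262
  (lp 309944090190688449) (br 266 (lp 382573569895575745) (br 268 (lp 345977355083202689) (lp
  200155445754077313)))) (br 266 (lp 418888309748019393) (br 268 (lp 382292094935646337) (lp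
  236470185606520961)))))) (br 266 (br 263 (br 193 (br 192 (br 262 (lp 109511635168923712) (lp
  164126715273547840)) (br 262 (lp 291643817584242881) (lp 364273297289130177))) (br 262 (lp
  72910954664562752) (lp 109225694517006400))) (br 193 (br 192 (lp 164126715273547840) (lp
  400588037141573825)) (lp 109225694517006400))) (br 268 (br 193 (br 192 (lp 218741795377913920) (br
  56 (lp 363991822329200769) (lp 327677082476757121))) (lp 145540434369192000)) (br 193 (br 192 (lp
  127530500461170752) (br 56 (lp 327395607516819649) (lp 291080867664376001))) (lp
  181855174221373568))))) (br 161 (br 192 (br 160 (br 104 (br 100 (br 268 (lp 492670077570658369)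
  (lp 346562295235092545)) (br 145 (lp 273646942524280897) (lp 474374134291243137))) (br 145 (lp
  200731589813211201) (lp 328543428869103745))) (br 104 (br 89 (br 88 (br 100 (br 266 (lp
  546995088486056065) (br 268 (lp 382868441931984961) (lp 473802658861297794))) (br 266 (lp
  364572498652569729) (br 83 (lp 200445852098498625) (lp 492102930394263682)))) (br 100 (br 266 (lp
  492380008381431937) (br 268 (lp 328253361827360833) (lp 419187578756673666))) (br 266 (lp
  309957418547945601) (br 83 (lp 364572498652307586) (lp 437487850289639554))))) (br 100 (lp
  437764928276807809) (lp 419468984997392577))) (br 262 (lp 255342338443321473) (br 266 (lp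
  455788121822343362) (br 83 (lp 145830771993874497) (lp 382872770185015426)))))) (br 104 (br 266
  (br 57 (br 56 (br 100 (lp 400592366468612225) (lp 254770457139486849)) (br 100 (lp
  364277626616168577) (lp 218455717287043201))) (br 100 (lp 327962886763724929) (lp
  309666943484309697))) (br 100 (br 268 (br 56 (lp 273066400418902081) (lp 236751660566458433)) (br
  263 (lp 291085196991410306) (lp 327399936843853954))) (br 56 (br 51 (lp 291085196991668354) (lp
  345700208376819842)) (br 51 (lp 254770457139224706) (lp 309385468524376194))))) (br 262 (lp
  182140977434599553) (br 266 (lp 327685740057080002) (br 268 (lp 273070728671932546) (lp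
  218455717286781058)))))) (br 263 (br 104 (br 100 (br 193 (br 192 (br 262 (lp 528976222119809217)
  (br 266 (lp 638206382329057473) (lp 528694815879352449))) (br 262 (lp 400873840354545857) (br 266
  (lp 473503320059433153) (lp 382292093861908609)))) (br 262 (lp 382573500102365377) (br 266 (lp
  455202979807252673) (lp 363991753609728129)))) (br 193 (br 192 (br 262 (lp 510680278840393985) (lp
  455783792495571137)) (br 262 (lp 382577897075130625) (lp 327681410730307777))) (br 262 (lp
  364277556822950145) (lp 436907036527837441)))) (br 193 (br 192 (lp 346553632286322881) (lp
  255051931025420481)) (lp 327962816970506497))) (br 100 (br 193 (br 192 (br 266 (lp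
  692821462433681601) (lp 583309895983976577)) (br 266 (lp 509818059911876801) (lp
  418606833714352257))) (br 266 (lp 491517719659696321) (lp 400306493462171777))) (br 193 (br 192
  (lp 510398872600195265) (lp 363996150582751425)) (lp 473221776380281089)))))) (br 161 (br 105 (br
  192 (br 101 (br 160 (br 104 (br 100 (lp 109515965569699840) (br 145 (lp 364862566768058433) (lp
  565589758535020673))) (br 145 (lp 291947214056988737) (lp 419759053112881281))) (br 104 (br 89 (br
  88 (br 100 (br 85 (lp 455783793569316929) (lp 619910440123388033)) (br 266 (lp 437487850289901697)
  (lp 273361203735830593))) (br 100 (br 85 (lp 401168713464692801) (lp 565295360018763905)) (br 266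
  (lp 382872770185277569) (lp 510403201926971522)))) (br 100 (lp 510680279914139777) (lp
  492384336634724545))) (br 262 (lp 328257690080653441) (br 85 (lp 218746123631206465) (lp
  528703473459675330))))) (br 160 (br 104 (lp 200731589813473344) (br 145 (lp 383162838300762241)
  (lp 510974677356654785))) (br 263 (br 262 (br 104 (lp 565299688272052481) (lp 401173041717981377))
  (br 104 (lp 455788121822605505) (lp 291661475268534401))) (lp 510403201927229633)))) (br 263 (br
  101 (br 100 (br 262 (lp 382577898148876417) (br 53 (lp 291366671951609921) (lp
  418892638001320065))) (br 57 (br 266 (br 104 (lp 273070728672194689) (br 145 (lp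
  382300751442231490) (lp 236755988819751041))) (br 104 (lp 364000479909527682) (lp
  327685740057084034))) (br 104 (lp 364281954869461185) (lp 236755988819751041)))) (br 262 (br 104
  (lp 418896966254608641) (lp 291371000204898497)) (br 104 (lp 327685740057342145) (lp
  436915762827378946)))) (br 101 (br 100 (br 53 (lp 327681411804053569) (lp 455207377853763713)) (br
  266 (lp 309385468524638337) (lp 400315219761971330))) (lp 364000479909785793)))) (br 160 (lp
  127816237102403648) (br 192 (lp 346557961613357249) (lp 255056260352454849)))) (br 105 (br 104 (br
  266 (br 101 (br 193 (br 263 (br 192 (br 262 (br 100 (lp 182426986806255680) (lp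
  583595630477725953)) (br 100 (lp 237042066910879808) (lp 528699144132903105))) (br 262 (br 100 (lp
  455488851739697345) (lp 437192908460282113)) (br 100 (lp 528118331444584641) (lp
  382296422115459265)))) (br 192 (br 100 (lp 237042066910879808) (lp 583314224237527233)) (br 100
  (lp 564433071297028289) (lp 418611161967902913)))) (br 56 (br 100 (lp 163840705902157888) (lp
  527836787765432577)) (br 100 (lp 127525966049714240) (lp 418892568208101633)))) (br 263 (br 193
  (br 192 (br 262 (lp 255342338443583616) (lp 145830771994136640)) (br 262 (lp 491807919845429569)
  (lp 436911433500606721))) (br 262 (lp 182140977434861696) (lp 218455717287305344))) (br 193 (br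
  192 (lp 145830771994136640) (lp 473226173353050369)) (lp 218455717287305344)))) (br 193 (br 192
  (lp 291657147015245888) (br 56 (lp 473221845099503745) (lp 436907105247060097))) (lp
  200155445754343488))) (br 193 (br 192 (br 101 (lp 419468983923654849) (lp 492384335560982785)) (br
  101 (lp 309666942410571969) (lp 364281953795719425))) (br 101 (lp 382577828355657985) (lp
  437192839740805441)))) (br 193 (br 192 (lp 91215691889512512) (lp 327967213943275777)) (lp
  145826237582418048))))

def threeBinsPart8 : RefTree :=
  br 272 (br 193 (br 192 (br 263 (br 147 (br 145 (br 112 (br 144 (lp 36600612875403264) (br 160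
  (br 262 (lp 201008666760187968) (br 266 (lp 529547697616330881) (br 99 (lp 273924019470995521) (lp
  401735858543665217)))) (br 262 (lp 164408121547296832) (br 266 (lp 438046334584103041) (br 268 (lp
  328534768117882945) (lp 219023201651658817)))))) (br 144 (lp 164416780201365568) (br 160 (lp
  127816237102403648) (lp 219027529888440448)))) (br 161 (br 112 (br 160 (br 148 (br 146 (br 262
  (lp 201008666760187968) (br 266 (lp 273924019471257664) (br 268 (lp 146112180398592000) (lp
  219027533109399616)))) (br 268 (lp 146112180398592000) (lp 255623747921514561))) (br 97 (lp
  255623747921514561) (br 152 (lp 255623747921776704) (lp 182708395210707008)))) (br 262 (br 148 (br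
  146 (lp 164408121547296832) (lp 255619416464040000)) (lp 146107849997815872)) (br 266 (br 146 (lp
  638769195967066305) (br 148 (lp 620468924417589377) (br 97 (lp 383145519935660161) (lp
  401445791485141121)))) (br 268 (br 148 (lp 419746063034626113) (lp 291934225018921025)) (br 97 (lp
  200722930102177857) (lp 364849576672764033)))))) (br 160 (lp 127816237102403648) (lp
  219027529888440448))) (br 262 (br 112 (br 148 (br 146 (lp 164408121547296832) (br 162 (lp
  255619416464040000) (lp 109511635185700864))) (lp 146107849997815872)) (lp 219027529888440448)) (br
  146 (br 266 (lp 219023201651920960) (br 268 (lp 109511635185700864) (lp 164126715290062912))) (br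
  148 (br 162 (br 266 (lp 310234496568664128) (lp 109511635185700864)) (lp 109511635185700864)) (lp
  200722930102440000)))))) (br 99 (br 98 (br 95 (br 161 (br 160 (br 97 (br 96 (lp
  18300341325922304) (br 262 (lp 182708395210707008) (br 149 (lp 346835042838257729) (lp
  456346610361442433)))) (br 262 (lp 182708395210707008) (br 266 (lp 255623747921776704) (lp
  146112180398592000)))) (br 262 (lp 146107849997815872) (br 152 (br 266 (lp 583868381318623425) (br
  97 (lp 291934225018921025) (lp 401445791485145153))) (br 266 (lp 383145519935660161) (lp
  291934225018921025))))) (br 262 (lp 146107849997815872) (br 266 (lp 200722930102440000) (lp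
  109511635185700864)))) (br 97 (br 96 (lp 18300341325922304) (br 262 (lp 182708395210707008) (br
  149 (lp 365135315444703297) (lp 474646882967888001)))) (br 262 (lp 182708395210707008) (br 266 (lp
  255623747921776704) (lp 146112180398592000))))) (br 161 (br 160 (lp 146112180398592000) (br 262
  (lp 255619416464040000) (br 85 (lp 401445791485145153) (lp 602168652868108417)))) (br 262 (br 162
  (lp 255619416464040000) (lp 109511635185700864)) (br 84 (lp 109511635185700864) (lp
  310234496568664128))))) (br 161 (br 160 (lp 146112180398592000) (br 262 (lp 255619416464040000)
  (br 85 (lp 510957357951369281) (lp 711680219334332545)))) (br 262 (br 162 (lp 255619416464040000)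
  (lp 109511635185700864)) (br 84 (lp 109511635185700864) (lp 310234496568664128)))))) (br 147 (br
  145 (br 144 (lp 36600612875403264) (br 160 (br 266 (lp 273924019471257664) (br 99 (lp
  346839372182065217) (lp 474651211254734913))) (br 266 (lp 219023201651920960) (br 268 (lp
  383149848222507073) (lp 273638281756282945))))) (br 161 (br 160 (br 97 (br 96 (lp
  18300341325922304) (lp 328539100632584257)) (br 146 (br 266 (lp 273924019471257664) (br 98 (lp
  219027533109399616) (lp 146112180398592000))) (br 148 (lp 146112180398592000) (lp
  255623747921776704)))) (br 146 (br 266 (lp 219023201651920960) (br 268 (lp 474361143139250241) (lp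
  419464656777388161))) (br 148 (br 266 (lp 310234496568664128) (br 268 (lp 474361143139250241) (lp
  255338010206801985))) (br 266 (lp 200722930102440000) (br 83 (lp 255338010206801985) (lp
  346549305123545153)))))) (br 146 (br 266 (lp 219023201651920960) (br 268 (lp 109511635185700864)
  (lp 164126715290062912))) (br 148 (br 162 (br 266 (lp 310234496568664128) (lp 109511635185700864))
  (lp 109511635185700864)) (lp 200722930102440000))))) (br 161 (br 99 (br 160 (br 97 (br 96 (lp
  18300341325922304) (br 149 (lp 438050668155772993) (lp 255623747921776704))) (br 148 (lp
  146112180398592000) (lp 255623747921776704))) (br 98 (br 266 (lp 200722930102440000) (br 97 (lp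
  346549305123545153) (lp 456060871589769281))) (br 85 (lp 456060871589769281) (lp
  310234496568664128)))) (br 160 (lp 146112180398592000) (br 85 (lp 565572438055993409) (lp
  310234496568664128)))) (br 148 (br 162 (br 266 (lp 310234496568664128) (lp 109511635185700864))
  (lp 109511635185700864)) (lp 200722930102440000))))) (br 266 (br 162 (br 134 (lp
  164126509131899008) (br 147 (br 146 (br 57 (br 56 (lp 164122180895379520) (br 145 (lp
  346544633323200641) (br 262 (lp 127807441042935872) (br 88 (lp 492366541595357377) (lp
  510666814201802945))))) (lp 127807441042935872)) (br 263 (br 99 (br 57 (br 98 (br 97 (lp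
  291643818674757761) (br 262 (lp 109507169493454912) (br 88 (lp 437465726946914497) (lp
  309944090224238721)))) (br 88 (lp 546977224710439105) (br 161 (lp 401155316438282369) (lp
  200718395707498560)))) (br 98 (lp 109507169493454912) (lp 200718395707498560))) (br 262 (lp
  200718395707498560) (br 88 (lp 638188450924482753) (lp 492366542652326017)))) (br 148 (lp
  237033135559942208) (lp 145821909345898560)))) (br 99 (br 263 (br 98 (br 262 (lp
  109507169493454912) (br 97 (lp 291643818674757761) (br 88 (lp 437465726946914497) (lp
  455765999553360065)))) (br 262 (lp 200718395707498560) (br 88 (lp 619888179375001793) (lp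
  474066271102845057)))) (br 98 (lp 145821909345898560) (lp 237033135559942208))) (br 57 (br 56 (lp
  237033135559942208) (br 88 (lp 711099405589045441) (br 161 (lp 565277497316888705) (lp
  200718395707498560)))) (lp 200718395707498560))))) (br 57 (br 56 (lp 218732862953496640) (lp
  510376679497552001)) (lp 182418123101052992))) (br 268 (br 161 (br 100 (br 148 (br 56 (lp
  437470056290730049) (lp 401155316438286401)) (br 263 (lp 218732864010199105) (lp
  255047603862642753))) (br 56 (lp 291648146961604673) (lp 255333407109161025))) (br 56 (lp
  400869511077838913) (lp 364554771225395265))) (br 161 (br 56 (br 146 (br 145 (lp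
  200436920747561025) (lp 309662615264305281)) (lp 182136649198080065)) (br 146 (br 145 (lp
  164122180895117377) (lp 273347875411861633)) (lp 145821909345636417))) (br 56 (lp
  291362342657859713) (lp 255047602805416065)))))) (br 162 (br 266 (br 134 (lp 164126509131899008)
  (br 56 (br 100 (br 98 (lp 145821909345898560) (lp 237033135559942208)) (lp 164122180895379520))
  (br 100 (br 98 (lp 109507169493454912) (lp 200718395707498560)) (lp 127807441042935872)))) (br 268
  (lp 72910954681339904) (lp 109225694533521472))) (br 56 (br 194 (br 266 (lp 218732862953496640)
  (lp 72910954681339904)) (lp 72910954681339904)) (lp 182418123101052992)))) (br 163 (br 113 (br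
  162 (br 112 (threeBinsPart7) (br 161 (br 160 (lp 127816237102403648) (br 192 (lp
  346557961613357249) (lp 255056260352454849))) (br 193 (br 192 (lp 91215691889512512) (lp
  327967213943275777)) (lp 145826237582418048)))) (br 162 (lp 0) (br 193 (br 192 (br 99 (lp
  364568169325539393) (lp 437483520962871361)) (br 57 (br 56 (br 53 (br 99 (lp 254766127812456513)
  (lp 309381139197608001)) (br 99 (lp 363991821255721089) (lp 418606832640872577))) (br 140 (br 53
  (lp 273066399345164353) (lp 382292092788428929)) (br 53 (lp 218451387960012865) (lp
  327677081403277441)))) (br 99 (lp 291362341550833793) (lp 345977352935985281)))) (br 56 (br 53 (br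
  52 (br 140 (br 45 (lp 363991753609990209) (lp 509532186905440385)) (br 45 (lp 309376742224838721)
  (lp 454917175520288897))) (br 99 (lp 418602435668103297) (lp 473217447053254785))) (br 99 (lp
  527828129111367873) (lp 582443140496519361))) (br 99 (lp 418883909554036929) (lp
  473498920939188417)))))) (br 161 (br 160 (lp 127816237102403648) (br 192 (lp 437773584783393025)
  (lp 327971543270310145))) (br 193 (br 192 (lp 91215691889512512) (lp 400882496861131073)) (lp
  145826237582418048)))) (br 195 (br 193 (br 192 (lp 72915420356808704) (br 263 (br 262 (lp
  400588034994102401) (br 53 (lp 327677081403281473) (lp 436902774846546049))) (br 53 (lp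
  363991821255725121) (lp 473217514698989697)))) (br 56 (br 266 (br 194 (lp 218451387960275008) (lp
  418602435668107329)) (br 45 (lp 418602435668107329) (lp 254766127812460608))) (lp
  182136648107831360))) (lp 109225694517010432)))

def threeBinsPart9 : RefTree :=
  br 267 (br 273 (br 265 (br 264 (threeBinsPart3) (br 116 (threeBinsPart6) (br 144 (lp
  182717051734069313) (br 160 (lp 146116508635107393) (br 192 (br 79 (lp 109515963422216257) (lp
  255628072953847938)) (br 272 (lp 200727052197306498) (lp 182426780647825538))))))) (br 264 (lp 0)
  (threeBinsPart8))) (br 272 (lp 0) (br 194 (br 268 (br 193 (br 163 (br 192 (br 161 (br 153 (br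
  104 (br 160 (br 97 (br 96 (lp 18300341325922304) (br 152 (br 266 (lp 219027533092884544) (br 141
  (lp 364858238497988673) (lp 547285158731985025))) (br 266 (lp 401454453310103681) (br 141 (lp
  291942885786918977) (lp 474369806020915329))))) (br 152 (br 100 (br 98 (br 266 (lp
  219027533092884544) (br 274 (lp 291942885803696192) (lp 109515965569699840))) (lp
  109515965569699840)) (lp 200731589813473344)) (lp 146112180381814848))) (br 99 (br 98 (br 263 (br
  262 (lp 109511635168923712) (br 97 (br 266 (lp 309953090277875841) (br 274 (lp 364568170382241921)
  (lp 218741795361136705))) (br 266 (lp 474079736831946945) (br 274 (lp 583309897040679105) (lp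
  291657146998468673))))) (br 266 (lp 164126715273547840) (br 148 (br 274 (lp 637924977145303233)
  (br 97 (lp 273356875465760833) (lp 346272227103092801))) (br 274 (lp 419183250486866049) (lp
  273356875465760833))))) (br 89 (br 88 (br 100 (br 266 (lp 237042066910879808) (br 77 (lp
  346272227103092801) (lp 565013953761529985))) (lp 145830771994136640)) (br 100 (br 266 (lp
  455783793552539777) (br 77 (lp 291657146998468673) (lp 510398873656905857))) (lp
  437487850273124545))) (br 100 (lp 182426986806255680) (lp 255342338443583616)))) (br 263 (br 262
  (br 100 (lp 182426986806255680) (lp 255342338443583616)) (br 101 (br 100 (br 266 (lp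
  528699145189871745) (br 77 (lp 364572498635800641) (lp 583314225294237825))) (lp
  510403201910456513)) (lp 583318553547784449))) (br 100 (br 266 (lp 237042066910879808) (br 77 (lp
  419187578740424769) (lp 637929305398861953))) (lp 145830771994136640))))) (br 160 (lp
  127816237102403648) (lp 91215691889512512))) (br 96 (lp 18300341325922304) (br 160 (lp
  146112180381814848) (lp 109511635168923712)))) (br 139 (br 84 (tr 1 [] [84, 139, 288]) (br 104
  (br 88 (br 138 (lp 145830771994136640) (br 140 (lp 237042066910879808) (lp 164126715273547840)))
  (br 138 (lp 255342338443583616) (br 140 (lp 182426986806255680) (lp 109511635168923712)))) (lp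
  91215691889512512))) (br 88 (br 162 (br 266 (br 140 (lp 237042066910879808) (lp
  164126715273547840)) (br 140 (br 274 (lp 291657147015245888) (lp 72915420356808704)) (lp
  218741795377913920))) (lp 72915420356808704)) (br 98 (lp 109511635168923712) (lp
  182426986806255680))))) (br 274 (br 162 (br 148 (br 141 (br 140 (br 104 (br 57 (br 56 (br 100
  (br 266 (lp 163840705902157888) (br 84 (lp 600466336172507329) (lp 454925902877057153))) (lp
  218455717287305344)) (br 88 (br 101 (br 100 (br 266 (lp 491522116615692481) (br 84 (lp
  564151596320063681) (lp 418611163024613505))) (lp 473226173336277249)) (lp 527841184721424705)) (br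
  262 (br 100 (lp 127525966049714240) (lp 182140977434861696)) (br 101 (br 100 (br 266 (lp
  382296423172427905) (lp 418611163024613505)) (lp 364000479893012673)) (lp 418615491278160129)))))
  (br 100 (lp 127525966049714240) (lp 182140977434861696))) (lp 145826237582418048)) (br 263 (br 262
  (lp 72910954664562752) (br 88 (br 266 (lp 327677082460238017) (br 84 (lp 400306562164609217) (lp
  309381140254310529))) (br 266 (lp 345977355066683585) (lp 309381140254310529)))) (br 266 (lp
  109225694517006400) (br 84 (lp 436621302017052865) (lp 345695880106754177))))) (br 263 (br 262 (lp
  72910954664562752) (br 88 (br 266 (lp 327677082460238017) (br 84 (lp 400306562164609217) (lp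
  418606834771054785))) (br 266 (lp 345977355066683585) (lp 418606834771054785)))) (br 266 (lp
  109225694517006400) (br 84 (lp 436621302017052865) (lp 454921574623498433))))) (br 263 (br 262 (lp
  72910954664562752) (br 97 (br 266 (lp 218451389016973441) (lp 254766128869159041)) (br 88 (lp
  327677082460238017) (lp 345977355066683585)))) (br 266 (lp 109225694517006400) (lp
  291080868721602689)))) (br 263 (br 262 (lp 182136648107831360) (br 53 (lp 454921572476285057) (lp
  418606832624099457))) (br 53 (lp 491236312328728705) (lp 218451387960275008)))) (br 263 (br 140
  (br 76 (lp 309381139180834881) (lp 254770457122717761)) (lp 145540434352414785)) (br 140 (br 76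
  (lp 345695879033278529) (lp 291085196975161409)) (lp 181855174204858433))))) (br 192 (lp
  72915420356808704) (br 263 (br 262 (lp 182136648107831360) (br 266 (lp 473217514682216577) (br 45
  (lp 363991821238952001) (lp 509532254534402177)))) (br 266 (lp 218451387960275008) (br 45 (lp
  400306561091395649) (lp 545846994386845825)))))) (br 104 (br 266 (br 140 (br 77 (br 146 (tr 1 []
  [77, 146, 288]) (br 76 (br 56 (lp 218451387960275008) (lp 182136648107831360)) (br 56 (lp
  163840705902157888) (lp 127525966049714240)))) (br 56 (br 100 (lp 163840705902157888) (lp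
  218455717287305344)) (br 100 (lp 127525966049714240) (lp 182140977434861696)))) (br 262 (lp
  72910954664562752) (lp 109225694517006400))) (br 76 (br 274 (lp 254766127812460608) (lp
  109225694517010432)) (br 140 (lp 200155445754343488) (lp 145540434369192000)))) (lp
  145826237582418048))) (br 97 (br 96 (lp 18300341325922304) (br 192 (br 263 (br 160 (br 274 (lp
  364858238497726593) (br 139 (lp 437773591192019074) (lp 510688943902830722))) (br 274 (lp
  273356875465498753) (br 276 (lp 382587035657711746) (lp 327971955553345666)))) (br 160 (br 274 (lp
  437773591208796289) (br 139 (lp 255346670974799937) (lp 583604296613900418))) (br 274 (lp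
  327971955570122881) (br 276 (lp 437202115762335874) (lp 182145580549017665))))) (br 263 (br 274
  (lp 181855174204596353) (br 276 (lp 254484653892448386) (lp 218169914040262786))) (br 274 (lp
  218169914057040001) (br 276 (lp 290799393744892034) (lp 254484653892706434)))))) (br 161 (br 160
  (lp 182431318280507456) (br 192 (br 88 (lp 455502387311816897) (lp 400887307207192769)) (br 263
  (lp 272784925441929409) (lp 309099665294373057)))) (br 193 (br 192 (lp 127530500461170752) (br 56
  (lp 400025087204671745) (lp 363710347352228097))) (lp 181855174221373568))))) (lp
  109225694517010432)))) (br 264 (lp 0) (br 163 (br 161 (br 160 (br 99 (br 97 (br 96 (lp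
  18300341325922304) (br 269 (br 268 (br 275 (br 273 (br 143 (lp 474369806037692481) (lp
  146112180398592000)) (br 141 (lp 437773591208800321) (lp 291942885803696192))) (lp
  109515965569699840)) (br 273 (br 143 (lp 364858238514503745) (lp 401454453343395905)) (br 141 (lp
  328262023685611585) (lp 510688943919607937)))) (br 270 (br 273 (br 143 (lp 437773591225311361) (lp
  219027533109399616)) (lp 182431318280507456)) (br 143 (lp 255346670991315009) (lp
  291942885820207169))))) (br 269 (br 268 (br 144 (lp 36600612875403264) (br 273 (br 272 (lp
  146112180398592000) (br 98 (lp 291942885803696192) (lp 565585430281470017))) (br 140 (lp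
  109515965569699840) (lp 291942885803696192)))) (br 145 (br 144 (lp 36600612875403264) (br 272 (lp
  419754724892876865) (br 98 (lp 182431318280507456) (lp 346562295235092545)))) (br 272 (lp
  219027533109399616) (lp 182431318280507456)))) (br 144 (lp 36600612875403264) (br 272 (lp
  219027533109399616) (lp 182431318280507456))))) (br 100 (br 268 (br 272 (lp 146112180398592000)
  (lp 109515965569699840)) (lp 36600612875403264)) (lp 36600612875403264))) (br 275 (br 269 (br 192
  (br 268 (br 273 (br 272 (lp 109511635185700864) (br 141 (br 99 (lp 437483522036351041) (lp
  510398873673683009)) (br 97 (lp 364568170399019073) (lp 583309897057456257)))) (br 140 (br 77 (lp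
  473802658844790849) (lp 291657147015245888)) (br 274 (lp 218741795377913920) (lp
  327971955570126913)))) (br 145 (br 272 (lp 328253361860649025) (br 141 (lp 255060932202864705) (br
  97 (lp 273356875482275905) (lp 400887307223969921)))) (br 146 (br 273 (br 272 (lp
  474079736881754241) (br 97 (lp 273356875482275905) (lp 400887307223969921))) (lp
  510117467416182977)) (br 273 (br 272 (lp 309953090311168065) (lp 273356875482275905)) (br 274 (lp
  382587035674488961) (lp 236760660653383745)))))) (br 268 (br 273 (br 272 (lp 72910954681339904)
  (br 141 (br 99 (lp 309381140271087681) (lp 363996151656239169)) (br 97 (lp 254766128885936193) (lp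
  418606834787831937)))) (br 140 (br 274 (lp 200155445754343488) (lp 327399936827347009)) (br 274
  (lp 145540434369192000) (lp 218169914057044033)))) (br 98 (br 146 (br 273 (br 272 (lp
  345977355116490881) (br 97 (lp 181855174221373505) (lp 272784925458706561))) (lp
  345414405146558657)) (br 273 (br 272 (lp 218451389050265665) (lp 181855174221373505)) (br 274 (lp
  254484653909225601) (lp 327114133597077634)))) (br 272 (lp 236751660599746625) (lp
  363714676696039554))))) (br 270 (br 273 (br 192 (br 272 (lp 164126715290062912) (br 97 (lp
  327971955586637953) (lp 455502387328331969))) (br 272 (lp 109225694533521472) (br 97 (lp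
  218169914073555073) (lp 309099665310888129)))) (br 192 (lp 127530500461170752) (lp
  181855174221373568))) (br 192 (br 272 (lp 218741795394424897) (lp 182145580565532737)) (br 272 (lp
  145540434385702977) (lp 254484653925736578))))) (br 192 (lp 72915420356808704) (lp
  109225694517010432)))) (br 160 (lp 0) (br 269 (br 275 (br 268 (br 193 (br 192 (br 273 (br 272
  (lp 109511635185700864) (br 99 (br 98 (lp 218741795377913920) (br 77 (lp 419183249429905473) (lp
  637924976088342657))) (br 77 (lp 492098601067237441) (lp 291657147015245888)))) (br 140 (br 76 (lp
  72915420356808704) (lp 291657147015245888)) (lp 218741795377913920))) (br 273 (br 272 (lp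
  72910954681339904) (br 99 (br 98 (lp 400306562181386369) (br 77 (lp 291080867664642113) (lp
  454921573566537857))) (br 77 (lp 345695879049793601) (lp 509536584951689345)))) (br 274 (br 76 (lp
  254766127812460608) (br 140 (lp 200155445754343488) (lp 145540434369192000))) (lp
  382010618885464129)))) (br 141 (br 140 (br 273 (br 272 (lp 72910954681339904) (br 162 (lp
  200155445754343488) (br 45 (lp 400306493462175809) (lp 545846926757625985)))) (br 274 (br 162 (lp
  200155445754343488) (br 194 (lp 254766127812460608) (lp 109225694517010432))) (lp
  109225694517010432))) (br 273 (br 272 (lp 72910954681339904) (br 45 (lp 345691482077024321) (br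
  77 (lp 491231915372474497) (lp 436621233314357377)))) (lp 145540434369192000))) (br 272 (lp
  72910954681339904) (lp 145540434369192000)))) (br 273 (br 193 (br 192 (br 272 (lp
  164126715290062912) (lp 127530500461170752)) (br 272 (lp 327677082510045313) (lp
  363710347369005249))) (br 272 (lp 109225694533521472) (lp 181855174221373568))) (br 193 (br 192
  (lp 127530500461170752) (lp 436339827056857345)) (lp 181855174221373568)))) (br 192 (lp
  72915420356808704) (lp 109225694517010432))) (br 273 (br 193 (br 192 (br 272 (lp
  164126715290062912) (lp 127530500461170752)) (br 272 (lp 109225694533521472) (lp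
  400025087221186817))) (br 272 (lp 109225694533521472) (lp 181855174221373568))) (br 192 (lp
  127530500461170752) (lp 181855174221373568)))))) (br 160 (lp 0) (br 275 (br 195 (br 193 (br 273
  (br 192 (br 272 (lp 109511635185700864) (lp 72915420356808704)) (br 272 (lp 72910954681339904)
  (lp 400306561107910721))) (br 192 (lp 72915420356808704) (br 45 (lp 436621300943581249) (lp
  254766127812460608)))) (br 273 (br 272 (lp 72910954681339904) (br 45 (lp 454917175520292929) (lp
  254766127812460608))) (br 44 (lp 109225694517010432) (lp 254766127812460608)))) (br 272 (lp
  72910954681339904) (lp 109225694517010432))) (br 192 (lp 72915420356808704) (lp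
  109225694517010432))))))

def threeBinsPart10 : RefTree :=
  br 168 (br 264 (br 112 (br 63 (br 259 (br 62 (br 196 (br 56 (lp 36596214829154304) (br 260 (br
  258 (br 150 (br 102 (br 60 (lp 311065521201098880) (lp 256173432885747840)) (br 60 (lp
  219577218073632832) (lp 164685129758281792))) (br 102 (br 60 (lp 201276946524151872) (lp
  146384858208800832)) (br 60 (lp 256173432886009920) (lp 201281344570658880)))) (br 61 (br 104 (br
  152 (br 60 (lp 512065390795309121) (lp 402281214164607041)) (br 60 (lp 402272418071593025) (lp
  292488241440890945))) (br 152 (br 60 (lp 438872961170554945) (lp 329088784539852865)) (br 60 (br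
  87 (lp 639864034671227010) (tr 0 [87, 104] [89, 101])) (br 87 (lp 475187769725173890) (tr 0 [87,
  104] [89, 101]))))) (br 104 (br 152 (lp 420581554416787521) (lp 310788581693071425)) (br 152 (lp
  347389124792033345) (br 87 (lp 511788450229534850) (tr 0 [87, 104] [89, 101])))))) (br 104 (br
  152 (br 193 (br 192 (br 88 (lp 54896555081334784) (lp 347389125849256001)) (br 88 (lp
  292488240384184385) (lp 329088785597075521))) (br 163 (br 57 (lp 310788445344895041) (lp
  511788314938843265)) (br 57 (lp 274187900132003905) (lp 219295811816656960)))) (br 193 (br 59 (lp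
  219295812873359425) (lp 237596153125539905)) (br 57 (lp 200995472621178945) (lp
  347098855853269121)))) (br 152 (br 193 (br 59 (lp 255896355972321345) (lp 274196696224501825)) (br
  57 (lp 237596015720140865) (lp 401999670501712001))) (br 193 (br 192 (br 87 (lp
  365403593094471810) (tr 0 [87, 104] [89, 101])) (br 87 (lp 347103252842291330) (tr 0 [87, 104]
  [89, 101]))) (br 55 (br 57 (lp 310502572337930370) (lp 602709270099149059)) (tr 0 [55, 104] [58,
  99]))))))) (br 258 (br 150 (br 102 (lp 237873092633567360) (lp 146384789506101312)) (br 102 (lp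
  128084517956620352) (lp 182981004318478400))) (br 104 (br 152 (br 56 (lp 36596214829154304) (br
  260 (lp 365680533660246081) (br 88 (lp 274187900132003905) (lp 310788445344895041)))) (br 99 (lp
  200995472621178945) (lp 255887560936529985))) (br 260 (br 152 (lp 292488104035491905) (br 55 (lp
  420286748968632450) (tr 0 [55, 104] [57, 101]))) (br 152 (lp 237596015720140865) (br 55 (lp
  310502572337930370) (tr 0 [55, 104] [58, 99]))))))) (br 104 (br 152 (br 260 (br 89 (lp
  420581554416787521) (lp 219581684822839360)) (br 88 (lp 54896555081334784) (lp
  347389125849256001))) (br 258 (lp 164685198460981312) (br 99 (lp 237596153125539905) (lp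
  310788581693071425)))) (br 260 (br 102 (br 258 (lp 292774113390108800) (br 152 (lp
  347389124792033345) (br 87 (lp 511788450229534850) (tr 0 [87, 104] [89, 101])))) (br 258 (lp
  182985470010462272) (lp 347389124792033345))) (br 152 (lp 274196696224501825) (br 87 (lp
  365403593094471810) (tr 0 [87, 104] [89, 101])))))) (br 193 (br 192 (lp 54896555081334784) (br 59
  (br 261 (lp 401995408804159553) (br 57 (lp 328802980236628033) (lp 219295811816656960))) (lp
  109788643396685824))) (br 261 (br 260 (br 56 (lp 36596214829154304) (lp 109788643396685824)) (br
  194 (lp 219295811816656960) (br 56 (lp 36596214829154304) (lp 383695068551979073)))) (br 56 (lp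
  36596214829154304) (lp 219295811816656960))))) (br 258 (br 150 (br 102 (lp 292774113390108800) (lp
  182985470010462272)) (br 102 (lp 164685198460981312) (lp 219581684822839360))) (br 104 (br 152 (br
  88 (lp 54896555081334784) (br 163 (lp 365689466101436481) (lp 438881894668968001))) (br 99 (lp
  255896493377720385) (lp 329088921945251905))) (br 260 (br 152 (lp 365689465044213825) (br 87 (lp
  548389130733895810) (tr 0 [87, 104] [89, 101]))) (br 152 (lp 292497036476682305) (br 87 (lp
  402004273598832770) (tr 0 [87, 104] [89, 101]))))))) (br 260 (br 196 (br 63 (br 62 (br 61 (br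
  258 (br 102 (br 60 (lp 274469306372206720) (lp 219577218056855680)) (br 60 (lp 182981003244740672)
  (lp 128088914929389632))) (br 60 (br 152 (lp 365680531512770625) (br 79 (lp 530075390184550530)
  (tr 0 [79, 112] [89, 101]))) (br 152 (lp 255896354882068545) (br 79 (lp 365399125238497410) (tr 0
  [79, 112] [89, 101]))))) (br 258 (br 152 (lp 128088914929389632) (lp 219577218056855680)) (br 152
  (lp 274196695134249025) (br 79 (lp 401999805742858370) (tr 0 [79, 112] [89, 101]))))) (br 258 (br
  102 (lp 256177898561216640) (lp 146389255181570112)) (br 152 (lp 274196695134249025) (br 79 (lp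
  401999805742858370) (tr 0 [79, 112] [89, 101]))))) (br 258 (br 102 (lp 256177898561216640) (lp
  146389255181570112)) (br 152 (lp 292497035386429505) (br 79 (lp 438600486247219330) (tr 0 [79,
  112] [89, 101]))))) (br 258 (br 102 (lp 201276877804675200) (lp 109788574677209152)) (br 152 (lp
  219295674377707585) (br 47 (lp 511493507309920451) (tr 0 [47, 112] [57, 101]))))) (br 63 (br 194
  (br 193 (br 192 (br 152 (lp 219304606818897985) (br 79 (lp 255614948607795330) (tr 0 [79, 112]
  [89, 99]))) (br 152 (lp 182703926314537025) (br 79 (lp 237314608355614850) (tr 0 [79, 112] [89,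
  99])))) (br 152 (lp 292211026015035521) (br 47 (lp 419728195954688259) (tr 0 [47, 112] [58,
  99])))) (br 152 (lp 164403586062356545) (br 47 (lp 346817242363867331) (tr 0 [47, 112] [58,
  99])))) (br 152 (lp 219304606818897985) (br 79 (lp 292215629112156290) (tr 0 [79, 112] [89,
  99])))))) (br 112 (br 193 (br 192 (br 259 (lp 182704063752966209) (lp 237319143857590337)) (br
  259 (lp 146103383248605249) (br 261 (lp 401432459940475010) (br 57 (lp 182418123101048897) (lp
  291925291520761985))))) (br 57 (br 259 (br 194 (lp 237310211416137857) (br 51 (lp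
  127803042996424769) (lp 328517039583670402))) (br 56 (br 194 (lp 309939691121025153) (br 51 (lp
  164117782848868417) (lp 401146519288557698))) (br 194 (lp 273624951268581505) (lp
  364831779436114050)))) (br 259 (lp 237310211416137857) (lp 383132119688294593)))) (br 63 (br 193
  (br 192 (br 79 (lp 219018733795418242) (tr 0 [79, 112] [85, 85])) (br 79 (lp 200718393543237762)
  (tr 0 [79, 112] [85, 85]))) (br 196 (br 53 (br 31 (lp 401146379668574468) (tr 0 [31, 112] [54,
  85])) (br 31 (lp 346535766329934083) (tr 0 [31, 112] [54, 85]))) (br 31 (lp 164117713038876802)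
  (tr 0 [31, 112] [54, 85])))) (br 79 (lp 255619414299779202) (tr 0 [79, 112] [85, 85]))))) (br
  112 (br 63 (br 62 (br 258 (br 194 (lp 109788643396423744) (br 196 (lp 164680731711774784) (br 200
  (lp 219572820027121792) (lp 91488303144243264)))) (br 61 (br 60 (br 192 (tr 1 [] [60, 192, 259])
  (br 260 (br 196 (lp 329079988446838849) (br 55 (br 200 (lp 401986476362186882) (lp
  182695131311775809)) (tr 0 [55, 104] [57, 101]))) (br 193 (br 55 (lp 146103383248605249) (lp
  328802980235845762)) (br 55 (br 200 (br 57 (br 264 (lp 292202299731484802) (br 194 (lp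
  237310211416137857) (br 51 (lp 127803042996424769) (lp 328517039583670402)))) (br 54 (lp
  237310211416137857) (lp 401709468151197890))) (lp 127803042996424769)) (tr 0 [55, 104] [58,
  99]))))) (br 260 (lp 219295811816136769) (br 192 (lp 164403723500785729) (br 55 (lp
  146103383248605249) (lp 328802980235845762))))) (br 260 (lp 237596152068317249) (lp
  164403723500785729)))) (br 258 (lp 128088983648604224) (br 260 (lp 237596152068317249) (lp
  164403723500785729)))) (br 258 (lp 128088983648604224) (br 260 (lp 255896492320497729) (lp
  182704063752966209)))) (br 260 (br 196 (br 63 (br 62 (br 61 (br 258 (br 60 (lp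
  237873091559829632) (lp 182981003244478592)) (br 60 (br 79 (lp 493479175372173442) (tr 0 [79, 112]
  [85, 85])) (br 79 (lp 328802910426120322) (tr 0 [79, 112] [85, 85])))) (br 258 (lp
  182981003244478592) (br 79 (lp 365403590930481282) (tr 0 [79, 112] [85, 85])))) (br 258 (lp
  219581683748839552) (br 79 (lp 365403590930481282) (tr 0 [79, 112] [85, 85])))) (br 258 (lp
  219581683748839552) (br 79 (lp 402004271434842242) (tr 0 [79, 112] [85, 85])))) (br 258 (br 200
  (lp 292765179875176640) (lp 164680662992298112)) (br 31 (br 200 (lp 456597019891097795) (lp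
  273901889669578882)) (tr 0 [31, 112] [57, 85])))) (br 200 (br 63 (br 193 (br 192 (br 79 (br 135
  (lp 219018733795418242) (lp 365122115953766595)) (tr 0 [79, 112] [85, 85])) (br 264 (br 79 (lp
  346821775701586115) (tr 0 [79, 112] [85, 85])) (br 79 (lp 200718393543237762) (tr 0 [79, 112]
  [85, 85])))) (br 31 (br 57 (br 264 (lp 291920754945044675) (br 194 (lp 346535766329934083) (br 51
  (lp 164117713038876802) (lp 401146379668574468)))) (br 264 (lp 474338808236101956) (lp
  346535766329934083))) (tr 0 [31, 112] [58, 83]))) (br 79 (br 135 (lp 255619414299779202) (lp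
  420023136710308035)) (tr 0 [79, 112] [85, 85]))) (br 31 (br 135 (lp 164117713038876802) (lp
  273620414692864195)) (tr 0 [31, 112] [54, 85])))))

def threeBinsPart11 : RefTree :=
  br 166 (br 271 (br 165 (br 176 (br 164 (br 280 (threeBinsPart9) (br 268 (lp 0) (br 96 (lp
  18300341325922304) (br 160 (lp 182431318263730241) (br 192 (lp 127530500444393537) (lp
  181855174187819138)))))) (br 164 (lp 0) (br 263 (br 272 (threeBinsPart10) (br 193 (br 192 (br
  259 (br 135 (br 71 (lp 109511634095181889) (lp 401445788230627523)) (lp 291934222854922370)) (lp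
  218741794304430145)) (br 259 (br 135 (br 71 (lp 182418121993756802) (lp 309944086969725123)) (lp
  218732861846200450)) (br 261 (lp 400869508880285891) (br 57 (lp 255047601698644098) (lp
  327958555289465026))))) (br 259 (br 31 (br 196 (br 194 (br 135 (br 71 (lp 218728395080216770) (lp
  400864973394825539)) (lp 327954088523481346)) (br 135 (br 71 (lp 273339008418857155) (lp
  382564633142644996)) (lp 309653748271300803))) (br 104 (lp 182132181341839490) (br 168 (lp
  255043066213183683) (br 39 (lp 145817441489395842) (lp 327949621757493508))))) (tr 0 [31, 100]
  [46, 77])) (br 57 (br 31 (br 56 (br 194 (lp 327672614637547714) (br 196 (lp 382283227976188099)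
  (lp 218446921194283138))) (br 194 (lp 291357874785104066) (lp 345968488123744451))) (tr 0 [31,
  100] [46, 77])) (br 31 (lp 437179781966745922) (tr 0 [31, 100] [46, 77])))))) (br 264 (br 192
  (lp 54896555081334784) (lp 36596214829154304)) (br 272 (br 193 (br 192 (lp 291934223962214465) (lp
  218732862953492545)) (br 194 (lp 346254430973468801) (br 51 (lp 200432522701312065) (lp
  473775998993444994)))) (br 193 (br 192 (lp 218741794304430145) (lp 327677081403531394)) (br 31 (br
  194 (lp 400302094342435010) (br 196 (lp 491227447533519043) (lp 291076400899170434))) (tr 0 [31,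
  100] [46, 77])))))))) (br 176 (lp 0) (br 63 (br 62 (br 258 (br 194 (lp 73192428567531584) (br
  196 (lp 128084516882882624) (br 200 (lp 182976605198229632) (br 208 (lp 237868693513318592) (lp
  146380391442817152))))) (br 200 (br 61 (br 60 (br 192 (tr 1 [] [60, 192, 259]) (br 260 (br 196
  (lp 255887558789054529) (br 31 (lp 292197831875510402) (tr 0 [31, 112] [57, 85]))) (br 194 (br 58
  (br 264 (br 31 (lp 255324608835629250) (tr 0 [31, 112] [58, 83])) (br 272 (br 193 (lp
  291925289339728067) (br 31 (lp 309935222174007555) (tr 0 [31, 112] [54, 85]))) (br 193 (lp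
  182418121993756802) (br 31 (lp 218728395080216770) (tr 0 [31, 100] [46, 77]))))) (br 264 (lp
  219014335749169282) (br 47 (lp 182418121993756802) (lp 291925289339728067)))) (br 264 (br 31 (lp
  182413655244808322) (tr 0 [31, 112] [57, 85])) (br 31 (br 51 (br 272 (lp 237024268583186627) (br
  43 (lp 327949621757493508) (lp 273339008418857155))) (br 272 (lp 364545835512647940) (lp
  273339008418857155))) (tr 0 [31, 112] [54, 85])))))) (br 260 (lp 146103382158352449) (br 59 (br
  264 (lp 219014335749169282) (br 192 (lp 91211293843001409) (br 47 (lp 182418121993756802) (lp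
  291925289339728067)))) (br 264 (lp 237314676001349762) (lp 91211293843001409))))) (br 260 (lp
  164403722410532929) (br 264 (lp 237314676001349762) (lp 91211293843001409)))) (br 99 (br 46 (br
  31 (br 45 (br 260 (lp 200709529804746882) (br 43 (br 264 (lp 255320143143383235) (br 39 (lp
  145817441489395842) (lp 237024268583186627))) (br 264 (lp 346526970237174020) (lp
  237024268583186627)))) (br 260 (lp 346808445213888707) (br 264 (lp 346526970237174020) (lp
  237024268583186627)))) (tr 0 [31, 100] [46, 77])) (br 31 (br 260 (lp 346808445213888707) (br 264
  (lp 346526970237174020) (lp 237024268583186627))) (tr 0 [31, 112] [54, 85]))) (br 31 (br 208 (lp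
  401700533529239747) (lp 255601618120097922)) (tr 0 [31, 112] [54, 85]))))) (br 258 (lp
  91492768819712064) (br 260 (lp 164403722410532929) (br 264 (lp 237314676001349762) (lp
  91211293843001409))))) (br 258 (lp 91492768819712064) (br 260 (lp 182704062662713409) (br 264
  (lp 273915356505710722) (lp 109511634095181889))))))) (br 164 (lp 0) (br 263 (br 200 (br 259 (br
  258 (br 62 (br 102 (br 142 (br 168 (br 60 (br 58 (lp 201276877804675200) (lp 274469306372206720))
  (lp 219577218056855680)) (br 176 (br 60 (br 58 (lp 292765179875176640) (lp 237873091559829632))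
  (lp 182981003244478592)) (br 60 (br 58 (lp 182976605198229632) (lp 128084516882882624)) (lp
  73192428567531584)))) (br 150 (br 168 (br 60 (br 58 (lp 237873092633567360) (lp
  311065521201098880)) (lp 256173432885747840)) (br 60 (br 58 (lp 219572820027121792) (lp
  164680731711774784)) (lp 109788643396423744))) (br 60 (br 58 (lp 128084517956620352) (lp
  201276946524151872)) (lp 146384858208800832)))) (br 60 (br 142 (br 58 (lp 109788574677209152) (lp
  182981003244740672)) (br 150 (br 58 (lp 146384789506101312) (lp 219577218073632832)) (br 58 (lp
  182981004318478400) (lp 256173432886009920)))) (br 142 (lp 128088914929389632) (br 150 (lp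
  164685129758281792) (lp 201281344570658880))))) (br 112 (br 104 (br 102 (lp 164685198460981312)
  (lp 219581684822839360)) (br 152 (lp 182985470010462272) (br 168 (lp 292774113390108800) (lp
  128088983648604224)))) (br 102 (br 168 (lp 256177898561216640) (br 176 (lp 219581683748839552) (lp
  91492768819712064))) (lp 146389255181570112)))) (br 59 (br 60 (br 57 (br 56 (lp
  36596214829154304) (br 195 (lp 274187900132003905) (lp 329079988447354945))) (br 260 (lp
  109788643396685824) (br 58 (lp 219295811816656960) (lp 401995408804159553)))) (lp
  292488240384184385)) (br 60 (br 192 (lp 54896555081334784) (lp 109788643396685824)) (br 192 (lp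
  54896555081334784) (lp 365680668951715905))))) (br 193 (br 192 (lp 54896555081334784) (br 261 (br
  59 (lp 401995408804159553) (lp 109788643396685824)) (br 57 (lp 328802980236628033) (lp
  219295811816656960)))) (br 261 (br 260 (br 56 (lp 36596214829154304) (lp 109788643396685824)) (br
  194 (lp 219295811816656960) (br 56 (lp 36596214829154304) (lp 383695068551979073)))) (br 56 (lp
  36596214829154304) (lp 219295811816656960))))) (br 112 (lp 91488303144243264) (br 176 (lp
  164680662992298112) (br 208 (lp 237868693513318592) (lp 146380391442817152))))) (br 192 (lp
  54896555081334784) (lp 36596214829154304))))) (br 96 (lp 18300341325922304) (lp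
  36600612875403264))) (br 164 (lp 0) (br 195 (br 193 (br 192 (lp 54896555081334784) (br 59 (br 57
  (br 56 (lp 36596214829154304) (lp 328802980236628033)) (br 259 (lp 292488240384184385) (br 58 (lp
  219295811816656960) (lp 401995408804159553)))) (br 61 (br 60 (lp 109788643396685824) (lp
  365680668951715905)) (lp 182981071964213312)))) (br 58 (br 57 (br 56 (lp 36596214829154304) (br
  194 (lp 219295811816656960) (br 196 (lp 383695068551979073) (lp 274187900132003905)))) (br 194 (lp
  219295811816656960) (br 196 (lp 109788643396685824) (lp 164680731712032832)))) (br 60 (lp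
  109788643396685824) (lp 182981071964213312)))) (br 197 (br 57 (br 56 (lp 36596214829154304) (br
  196 (lp 109788643396685824) (lp 329079988447354945))) (br 196 (lp 109788643396685824) (lp
  164680731712032832))) (br 56 (lp 36596214829154304) (lp 164680731712032832)))))

def threeBinsPart12 : RefTree :=
  br 146 (br 145 (br 60 (br 139 (br 137 (br 57 (br 56 (lp 145544762622742593) (br 135 (lp
  109230022770298945) (lp 273070727598710914))) (br 112 (tr 1 [] [112, 137, 262]) (br 58 (br 134
  (lp 182145305688154241) (lp 309671270664122562)) (br 133 (lp 127530294303006785) (br 134 (lp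
  327971542196830402) (lp 255056259278975106)))))) (br 138 (br 58 (br 263 (br 57 (br 320 (br 134
  (tr 1 [] [57, 134, 320]) (br 265 (br 262 (br 104 (tr 1 [] [104, 145, 262]) (lp
  291370999131156674)) (br 135 (lp 327685738983600322) (lp 364000478836043970))) (br 135 (lp
  200159774007632001) (lp 454930230073377026)))) (br 56 (lp 236474513860075649) (br 112 (lp
  200159774007632001) (br 134 (lp 163845034155188353) (lp 273070658878976194))))) (br 104 (tr 1 []
  [104, 145, 262]) (br 134 (br 54 (lp 236760317073043649) (lp 437201564966867266)) (br 265 (lp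
  291370999131156674) (lp 382300750368489730))))) (br 54 (lp 236474513860075649) (lp
  400315218688487618))) (br 112 (tr 1 [] [112, 138, 261]) (br 134 (lp 382586553581719810) (lp
  437197235639832835)))) (br 263 (br 320 (br 265 (br 261 (br 104 (tr 1 [] [104, 145, 262]) (lp
  236755987746009218)) (br 262 (br 104 (tr 1 [] [104, 145, 262]) (lp 455211703959310595)) (br 135
  (lp 273070727598452866) (lp 309385467450896514)))) (br 262 (br 104 (tr 1 [] [104, 145, 262]) (lp
  327685738983342274)) (br 88 (br 53 (lp 345700207303082114) (lp 400315218688229570)) (br 53 (lp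
  145544762622484545) (lp 364000478835785922))))) (br 112 (br 56 (lp 181859502474928193) (lp
  145544762622484545)) (lp 218455647493828738))) (br 54 (br 53 (lp 181859502474928193) (lp
  436629958540673218)) (lp 345700207303340162))))) (br 266 (tr 1 [] [84, 161, 266]) (br 56 (br 52
  (lp 218174242327113793) (lp 418329687007711362)) (lp 382014947155267714)))) (br 112 (tr 1 [] [112,
  140, 259]) (br 138 (br 134 (br 137 (br 131 (lp 72915282917855297) (br 90 (lp 273356530811678914)
  (lp 218741519426531458))) (lp 327971542196568322)) (br 137 (lp 200441247893823618) (lp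
  382582224254681347))) (lp 327967212869533891)))) (br 60 (br 263 (br 139 (br 113 (br 320 (br 266
  (br 262 (br 138 (br 261 (br 112 (tr 1 [] [112, 138, 261]) (br 89 (lp 327967212869796034) (lp
  200441247893827713))) (br 135 (br 265 (br 89 (lp 182140976361119873) (lp 255056259278975169)) (br
  134 (br 46 (lp 291370999114383617) (lp 236755987746009281)) (br 273 (lp 273070727598452929) (lp
  364000478819270913)))) (br 265 (lp 291366669804384449) (br 46 (lp 473226172262535489) (lp
  382296421041717505))))) (br 261 (br 104 (tr 1 [] [104, 146, 261]) (lp 309666941336830146)) (br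
  265 (br 135 (lp 345981681189273794) (lp 455207374632538370)) (br 273 (br 135 (lp
  218455716213305473) (lp 327681409656570049)) (br 88 (lp 454925900729573633) (lp
  345700207286309057)))))) (br 138 (br 273 (br 54 (br 88 (lp 309385467450896577) (lp
  509545241441751362)) (br 88 (lp 218455716213563521) (lp 418615490204418306))) (br 88 (lp
  400315218671714561) (lp 291089525228449985))) (br 273 (br 54 (br 88 (lp 254770456065749121) (lp
  400315218671456450)) (br 88 (lp 382296421041717442) (lp 527841183647424771))) (br 88 (lp
  382014947138752705) (lp 527559709744460034))))) (br 273 (br 88 (br 84 (lp 291085195917934721) (lp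
  472944698376085698)) (lp 436629958523642050)) (br 88 (br 84 (lp 418329686990938305) (lp
  600189189449089282)) (lp 272789253695488129)))) (br 161 (br 135 (br 262 (br 138 (br 134 (lp
  218460045523562689) (br 265 (lp 364000410099794178) (br 104 (lp 291089525228449985) (lp
  454930161337127234)))) (br 100 (lp 272789253695488129) (br 112 (lp 345700138566832322) (lp
  418611023438176515)))) (br 138 (lp 291089525228449985) (br 100 (lp 272789253695488129) (lp
  382014878419275970)))) (br 138 (lp 327404265080893633) (br 100 (lp 309103993547931777) (lp
  418329618271719618)))) (br 138 (br 262 (br 56 (lp 90929751237595200) (br 134 (lp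
  54615011385151552) (br 265 (lp 163840636108939393) (br 104 (lp 345700138567090433) (lp
  254770387346272449))))) (br 56 (lp 90929751237595200) (lp 272789252622004417))) (br 135 (br 88
  (br 84 (lp 345418732326375617) (br 100 (lp 581888848123167042) (lp 454644357050163458))) (br 261
  (lp 273066260832469186) (br 273 (lp 200155375961124993) (lp 327399867034128577)))) (br 100 (br 84
  (lp 381733472178819265) (lp 400029346739015873)) (lp 272784855666012289)))))) (br 261 (br 320 (lp
  200441247893827713) (br 30 (lp 54615011385151552) (lp 218460045523562689))) (br 54 (br 46 (br 30
  (lp 54615011385151552) (br 161 (lp 218460045523562689) (lp 291370999114383617))) (lp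
  309671270663864577)) (lp 255056259278975169)))) (br 265 (tr 1 [] [100, 146, 265]) (br 320 (br 273
  (br 262 (lp 363996149508755649) (br 53 (lp 291085195917934721) (lp 400310889361199297))) (br 262
  (lp 491240640581759233) (br 53 (lp 418329686990938305) (lp 527555380434202881)))) (br 30 (lp
  127244491089780800) (lp 345418733400117377))))) (br 267 (br 54 (br 266 (br 52 (tr 1 [] [52, 193,
  266]) (br 46 (br 101 (br 139 (br 138 (br 30 (lp 90929751237595200) (br 161 (lp
  327404265080893633) (lp 382014947139010753))) (br 100 (br 320 (lp 418329686991196353) (br 30 (lp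
  400029346739015873) (lp 309103993547931777))) (br 320 (lp 291085195918192769) (br 30 (lp
  272784855666012289) (lp 454644358124163266))))) (lp 563870120286646529)) (br 30 (lp
  90929751237595200) (br 161 (lp 327404265080893633) (lp 436629958524158209)))) (br 139 (br 138 (lp
  345700207303340225) (lp 291085195918192769)) (lp 436625629213642945)))) (br 84 (br 46 (br 320 (lp
  454644426843381953) (br 52 (br 30 (lp 127244491089780800) (lp 345418733400117377)) (br 30 (lp
  381733472178819265) (lp 309103993547931777)))) (lp 327399935770378369)) (br 46 (lp
  309103993547931777) (lp 509259438228529346)))) (br 100 (tr 1 [] [100, 146, 265]) (br 138 (lp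
  254770456066007169) (lp 454925900746604738)))) (br 46 (br 30 (lp 127244491089780800) (br 161 (lp
  345418733400117377) (lp 490959166695567553))) (lp 363714675622563969)))) (br 112 (tr 1 [] [112,
  140, 259]) (br 138 (br 134 (lp 145826236508676225) (lp 273352201484644546)) (lp
  400878166460354819))))) (br 60 (br 57 (br 56 (br 53 (br 100 (br 84 (br 52 (br 273 (br 320 (lp
  272784924385230913) (br 161 (lp 254488982162784321) (br 29 (lp 254484584133050433) (lp
  381729075206054017)))) (br 76 (br 45 (br 161 (lp 254488982162784321) (br 320 (lp
  309099664220901441) (br 29 (lp 236188709556338753) (lp 363433200629342337)))) (lp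
  454640097516351617)) (br 274 (br 320 (lp 400029415458234497) (br 30 (lp 381729075206054017) (lp
  254488982162784321))) (lp 254488982162784321)))) (br 273 (br 320 (lp 236470184533045313) (br 161
  (lp 218174242310598721) (br 29 (lp 381729074132570242) (lp 508973565205573826)))) (br 76 (br 274
  (br 161 (tr 1 [] [76, 161, 274]) (br 320 (lp 418325357664166017) (br 29 (lp 199873969704153153)
  (lp 327118460777156737)))) (br 320 (lp 272784924368715841) (br 161 (lp 218174242310598721) (br 29
  (lp 199873969704153153) (lp 327118460777156737))))) (br 274 (br 320 (lp 363714675606048897) (br 30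
  (lp 508973565205573826) (lp 218174242310598721))) (br 139 (lp 218174242310598721) (lp
  490959166679052418)))))) (br 265 (br 320 (lp 200155444680859713) (br 161 (lp 218174242310598721)
  (br 29 (lp 181855104428679233) (lp 309099595501682817)))) (br 266 (br 46 (br 320 (lp
  327399935753863297) (br 30 (lp 309099595501682817) (lp 218174242310598721))) (lp
  527555380434460866)) (br 46 (br 45 (lp 218174242310598721) (lp 545574178064199874)) (lp
  418329686991196290))))) (br 320 (lp 200155444680859713) (br 161 (lp 363714606886830210) (br 29 (lp
  181855104428679233) (lp 454639960077914306))))) (br 265 (br 139 (lp 200155444680859713) (lp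
  454921571419574402)) (br 84 (br 273 (lp 345695877976309889) (br 76 (lp 382010617811980417) (lp
  472940369049313473))) (br 46 (lp 327399935753863297) (lp 527555380434460866))))) (br 320 (br 273
  (br 265 (br 88 (br 84 (lp 382292091714687106) (lp 163840704828416065)) (br 261 (lp
  127525964975972417) (br 161 (lp 309385467434123394) (lp 382296421024944322)))) (br 88 (br 84 (br
  53 (lp 200155444680601665) (lp 309381138123866241)) (br 266 (lp 454925900729573570) (lp
  382014947138752642))) (br 262 (lp 418611160877129922) (br 53 (lp 345700207286308994) (lp
  600470663335280899))))) (br 88 (br 162 (br 266 (br 84 (lp 436625629196869825) (lp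
  291085195901419649)) (br 84 (br 274 (lp 327399935753605249) (br 76 (lp 236470184516272193) (lp
  454644426826608770))) (br 45 (lp 418329686974423170) (lp 509259438211756226)))) (br 266 (lp
  345695877959536769) (br 45 (lp 236470184516272193) (lp 382010617811722369)))) (br 262 (lp
  254770456048976001) (br 266 (lp 436629958507126978) (br 45 (lp 181859502458155073) (lp
  472944698359312578)))))) (br 162 (br 161 (br 100 (lp 181859502458155073) (br 104 (lp
  291085127181942914) (lp 254770387329499266))) (br 88 (br 265 (lp 509254970372288771) (br 266 (lp
  400029345648500930) (br 76 (lp 290803720924713089) (lp 436344085500686530)))) (br 261 (lp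
  309381000668139714) (br 100 (lp 236470115796795521) (lp 345695740520583362))))) (br 261 (lp
  109225624723791937) (br 265 (lp 272784854575497346) (br 76 (lp 163559229851709505) (lp
  309099594427682946))))))) (br 261 (br 135 (lp 127525964975972417) (br 139 (lp 309662612010057858)
  (lp 345977351862243458))) (br 88 (br 265 (br 139 (lp 236751658419236993) (lp 455203045305508034))
  (br 84 (br 273 (lp 273066398271422593) (br 76 (lp 309381138107093121) (lp 400310889344426177)))
  (br 46 (lp 363996149492240577) (lp 527836854320394498)))) (br 273 (br 265 (lp 382296421024944322)
  (lp 418611160877129922)) (lp 254770456048976001))))) (br 112 (tr 1 [] [112, 140, 259]) (lp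
  218737190099497090)))

def threeBinsPart13 : RefTree :=
  br 53 (br 146 (br 145 (br 56 (br 52 (br 51 (lp 163559230941962305) (lp 400029415474745474)) (br
  51 (br 139 (lp 127244491089776705) (lp 309099664237408386)) (br 139 (lp 327399935770374274) (lp
  363714675622559874)))) (br 135 (br 51 (lp 90929751237333057) (lp 254770456065486978)) (br 268 (br
  139 (lp 291085195917930626) (lp 327399935770116226)) (br 139 (lp 236470184532779138) (lp
  272784924384964738))))) (br 56 (br 52 (br 268 (br 273 (br 320 (lp 309099664237412481) (br 30 (lp
  290799323985232001) (lp 454358554910417090))) (br 320 (lp 381729143925264577) (br 30 (lp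
  363428803673084097) (lp 236188710629814401)))) (br 82 (br 46 (br 30 (lp 308818189260701889) (br
  161 (lp 236188710629814401) (lp 327114132540113089))) (lp 254484652852260993)) (br 46 (lp
  236188710629814401) (lp 418043883777446082)))) (br 84 (br 268 (br 273 (br 320 (lp
  272784924385226881) (br 30 (lp 454358553836933378) (lp 381729075206045890))) (br 320 (lp
  345414404073078977) (br 30 (lp 526988033524785474) (lp 199873970777628801)))) (br 82 (br 46 (br
  320 (lp 290799392687927489) (br 30 (lp 272503449408516289) (lp 199873970777628801))) (lp
  218169913000075393)) (br 46 (br 139 (lp 199873970777628801) (lp 454358623613112578)) (lp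
  381729143925260482)))) (br 266 (br 273 (br 320 (lp 236470184533041281) (br 30 (lp
  218169844280860801) (lp 345414335353860290))) (br 320 (lp 309099664220893377) (br 30 (lp
  290799323968712897) (lp 199873970777628801)))) (br 51 (br 98 (br 46 (lp 199873970777628801) (lp
  345414404073074882)) (br 46 (lp 381729075206045890) (lp 400029415458226370))) (br 273 (lp
  400029415458226370) (lp 472658895146078466)))))) (br 161 (br 320 (br 273 (br 262 (br 88 (tr 1 []
  [88, 161, 262]) (lp 163840704828153985)) (br 266 (br 84 (tr 1 [] [84, 161, 266]) (br 88 (lp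
  200155444680597633) (lp 291085195901153474))) (br 268 (br 84 (lp 236470184532783233) (br 88 (lp
  363714675605782722) (lp 327399935753339074))) (br 84 (lp 345414404072816834) (br 88 (lp
  309099664220631234) (lp 272784924368187586)))))) (br 84 (br 51 (lp 418043883760668930) (lp
  309099664220635329)) (br 268 (br 88 (lp 436344155293634818) (lp 400029415441191170)) (br 88 (lp
  381729143908483330) (lp 163559230925185153))))) (br 104 (br 266 (br 273 (lp 272784855648972994)
  (lp 163559230925185153)) (br 98 (lp 163559230925185153) (lp 309099595501158594))) (lp
  236470115796529346))) (br 320 (br 84 (br 268 (br 273 (lp 236470184532783233) (lp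
  309099664220635329)) (br 46 (lp 254484652835483841) (lp 181855173147631745))) (br 273 (br 88 (lp
  200155444680597633) (lp 163840704828153985)) (br 88 (lp 272784924368449729) (lp
  236470184516006081)))) (br 88 (br 84 (br 82 (lp 236188709556072641) (br 98 (lp 454358553819898178)
  (lp 381729074132046082))) (br 273 (lp 345414334279860482) (lp 418043813967712578))) (br 273 (lp
  145540364575973505) (lp 218169844263825601))))))) (br 104 (br 88 (br 273 (br 139 (br 320 (br 268
  (br 56 (br 265 (lp 345695877976305794) (br 84 (lp 181855173147893825) (br 161 (lp
  309099664220893314) (lp 418325357664157890)))) (br 265 (lp 273066398271418498) (br 84 (lp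
  145540433295450177) (br 161 (lp 272784924368449666) (lp 345695877959270594))))) (br 56 (lp
  418043883760926915) (lp 381729143908483267))) (br 56 (br 161 (br 265 (lp 436339688544944323) (br
  268 (lp 290799323968712834) (lp 272503450465480834))) (br 29 (br 265 (lp 309095197471944834) (br
  84 (lp 454354155790684355) (lp 381724677159796930))) (br 265 (lp 527265041736028419) (br 84 (lp
  526983635478536451) (lp 381724677159796930))))) (br 29 (br 98 (tr 1 [] [29, 98, 384]) (br 265 (lp
  454635560957141252) (br 84 (lp 345409936233353411) (br 161 (lp 218169844263825538) (lp
  527265040644993348))))) (br 30 (br 97 (lp 236188710613037186) (br 265 (lp 636490665368781189) (br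
  84 (lp 418039415921205507) (br 161 (lp 218169844263825538) (lp 527265040644993348))))) (br 265 (lp
  327395468987613379) (br 268 (lp 218169844263825538) (lp 236188710613037186))))))) (br 56 (br 52
  (br 268 (br 320 (lp 218169913000079425) (br 161 (lp 363428803673084034) (br 29 (lp
  199869572747898945) (lp 490668896716353730)))) (br 320 (lp 327114132540113026) (lp
  145258959392481345))) (br 268 (lp 181855173147893825) (lp 290799392687927426))) (br 268 (lp
  145540433295450177) (lp 254484652835483778)))) (br 56 (br 267 (br 161 (br 97 (br 51 (br 45 (br
  139 (lp 272503450465480834) (br 52 (lp 145258959392481345) (lp 436058352063631555))) (br 84 (lp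
  363428872375779522) (lp 490673363448779011))) (br 45 (br 84 (lp 327114132523597954) (lp
  454358623596597443)) (br 84 (lp 254484652835745921) (lp 381729143908745410)))) (br 84 (br 320 (lp
  254484652835745921) (br 52 (lp 399743543508750530) (lp 363428803656564930))) (br 320 (lp
  381729143908745410) (lp 363428803656564930)))) (br 84 (br 320 (lp 254484652835745921) (br 52 (lp
  272499052435751041) (lp 599613115166388547))) (br 320 (lp 472654497099829506) (lp
  454354156847649026)))) (br 97 (br 51 (br 45 (lp 145258959392481345) (lp 399743612227965122)) (br
  45 (lp 363428872375783554) (lp 290799392687931521))) (br 320 (lp 290799392687931521) (br 30 (lp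
  272499052435751041) (lp 436058283360936130))))) (br 161 (br 320 (br 274 (br 268 (br 84 (lp
  218169912983302273) (lp 345414404056301762)) (br 84 (lp 327114132523335874) (lp
  454358623596335363))) (br 51 (br 84 (lp 399743612211187907) (lp 526988103284187396)) (br 84 (lp
  290799392671154306) (lp 418043883744153795)))) (br 97 (lp 236188710613037186) (lp
  290799323951677634))) (br 320 (br 84 (lp 218169912983302273) (lp 400025017394942210)) (br 84 (lp
  490668895609057603) (lp 672524000020697540)))))) (br 273 (br 320 (br 265 (br 261 (lp
  236751658418974850) (br 161 (lp 363996149491974339) (lp 436907103082795267))) (br 262 (lp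
  309381138106826946) (br 268 (lp 236470184516006018) (lp 345414404056039619)))) (br 29 (br 98 (tr 1
  [] [29, 98, 384]) (br 261 (lp 200150977914613890) (br 262 (br 100 (lp 272780457602465986) (lp
  382006082326253827)) (br 100 (lp 218169844263825538) (lp 327395468987613379))))) (br 161 (br 265
  (lp 327395468987613379) (br 268 (lp 218169844263825538) (lp 236188710613037186))) (br 100 (lp
  272780457602465986) (lp 382006082326253827))))) (br 268 (br 320 (br 262 (lp 363710277542498562)
  (br 274 (lp 309099664203858114) (lp 381729143891710147))) (br 97 (lp 236188710613037186) (br 161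
  (lp 290799323951677634) (lp 345409937290318082)))) (br 45 (lp 236188710613037186) (lp
  418043883743891715))))) (br 320 (lp 236751658418974850) (br 161 (lp 291080729135169731) (br 29 (lp
  200150977914613890) (lp 345691342473810179)))))) (br 100 (br 145 (tr 1 [] [100, 145, 266]) (br
  273 (br 84 (br 263 (br 261 (br 162 (tr 1 [] [84, 162, 265]) (lp 291362340477091970)) (br 262 (br
  265 (br 162 (tr 1 [] [84, 162, 265]) (lp 400588033920356546)) (br 77 (lp 218451386886271105) (lp
  309381138123604161))) (br 265 (br 162 (tr 1 [] [84, 162, 265]) (lp 327677080329535618)) (br 77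
  (lp 254766126738714753) (lp 345695877976047809))))) (br 265 (br 162 (tr 1 [] [84, 162, 265]) (lp
  400306560034422914)) (br 77 (lp 291080866591158401) (lp 382010617828491457)))) (br 88 (br 263 (br
  261 (br 162 (tr 1 [] [88, 162, 261]) (lp 418888305453060291)) (br 262 (br 265 (br 146 (tr 1 []
  [100, 146, 265]) (lp 345977351862239426)) (br 77 (lp 418606831550091522) (lp 273066398271418561)))
  (br 265 (br 146 (tr 1 [] [100, 146, 265]) (lp 273066398271418498)) (br 77 (lp 345695877959270594)
  (lp 200155444680597633))))) (br 265 (br 146 (tr 1 [] [100, 146, 265]) (lp 345695877976305794))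
  (br 77 (lp 418325357664157890) (lp 236470184533041281)))) (br 265 (br 146 (tr 1 [] [100, 146,
  265]) (br 261 (lp 236751658418974850) (br 262 (lp 436907103082795267) (lp 363996149491974339))))
  (br 262 (br 77 (lp 309381138106826946) (lp 163840704828153985)) (br 77 (lp 436625629179826435) (lp
  291085195901153474)))))) (br 88 (br 263 (br 262 (br 139 (br 77 (lp 491236311237943618) (lp
  345695877959270657)) (br 77 (lp 291080866574123201) (lp 382010617811456257))) (br 84 (br 77 (lp
  327395606426566849) (lp 418325357663899905)) (br 77 (lp 418325357647122690) (lp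
  272784924368449729)))) (br 84 (br 77 (lp 363710346279010497) (lp 454640097516343553)) (br 77 (lp
  490954837352009986) (lp 309099664220893377)))) (br 262 (br 77 (lp 382010617794679042) (lp
  236470184516006081)) (br 77 (lp 509255108867678531) (lp 363714675589005570)))))) (br 263 (br 261
  (br 104 (br 146 (tr 1 [] [104, 146, 261]) (br 88 (lp 418888305453060291) (lp
  236751658418974850))) (br 78 (br 77 (lp 236751658418974850) (lp 418892634779832579)) (lp
  345981681189011651))) (br 146 (br 145 (br 262 (br 104 (tr 1 [] [104, 145, 262]) (br 54 (lp
  273070727598190786) (lp 400596692574159107))) (br 54 (br 135 (lp 309385467450634434) (lp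
  345700207303078082)) (br 135 (lp 218455716213301378) (lp 254770456065745026)))) (br 262 (br 54 (br
  135 (lp 163840704828153985) (lp 273066398271418561)) (br 135 (lp 291366669804122306) (lp
  400592363247386882))) (br 88 (br 54 (lp 200155444680597633) (lp 327681409656565954)) (br 54 (lp
  291085195901153474) (lp 418611160877121795))))) (br 88 (br 57 (lp 273066398271418498) (lp
  345977351862239426)) (br 262 (lp 436907103082795267) (lp 363996149491974339))))) (br 265 (br 78
  (br 77 (lp 345695877976305794) (lp 400310889361453250)) (lp 291085195918188674)) (br 78 (lp
  236470184533041281) (lp 382014947155521730)))))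

def threeBinsPart14 : RefTree :=
  br 192 (br 139 (br 137 (br 259 (br 112 (tr 1 [] [112, 140, 259]) (br 131 (lp 109515963422216257)
  (br 133 (lp 182431315059548225) (br 134 (lp 255346666696876161) (lp 164131043526840385))))) (br
  261 (br 112 (tr 1 [] [112, 138, 261]) (br 133 (lp 182431315059548225) (br 134 (lp
  255346666696876161) (lp 164131043526840385)))) (br 262 (br 112 (tr 1 [] [112, 137, 262]) (br 134
  (lp 255346666696876161) (lp 164131043526840385))) (br 135 (lp 164131043526840385) (lp
  218746123631464513))))) (br 113 (br 112 (br 145 (br 262 (br 104 (tr 1 [] [104, 145, 262]) (br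
  138 (br 89 (lp 291661475268534401) (lp 237046395163910273)) (br 140 (lp 218746123631206465) (lp
  145830771993874497)))) (br 135 (br 138 (lp 291661475268534401) (br 140 (lp 218746123631206465) (lp
  145830771993874497))) (br 138 (lp 346276555373158529) (br 140 (lp 273361203735830593) (lp
  200445852098498625))))) (br 104 (br 89 (br 88 (br 146 (br 266 (br 138 (lp 145830771994136640) (br
  140 (br 100 (lp 601333089513001153) (lp 419187577683456129)) (br 273 (lp 346272226046124161) (lp
  455502386238337217)))) (br 84 (br 268 (br 140 (lp 200445852098502720) (br 98 (lp
  510117466342703297) (lp 400887306150490241))) (br 82 (lp 127530500461170752) (lp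
  309676012290711681))) (br 140 (lp 455506715565375617) (br 98 (lp 309676012290711681) (lp
  583032817980031170))))) (br 265 (br 148 (br 140 (lp 291657145941762113) (lp 492098599993749634))
  (lp 218741794304430145)) (br 148 (br 162 (br 266 (br 140 (lp 473802657771307137) (br 98 (lp
  710558920378175746) (lp 601328760185962690))) (br 161 (br 268 (br 140 (lp 327976283823681601) (br
  273 (lp 455502386238337154) (br 97 (lp 418906172482924674) (lp 564732546430550210)))) (lp
  418906172482924674)) (br 140 (br 76 (lp 72915420356808704) (lp 528417737875673217)) (br 98 (lp
  382587034601009281) (lp 273356874408796225))))) (br 273 (br 140 (lp 346272226046128193) (lp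
  273356874408796225)) (lp 72915420356808704))) (br 97 (lp 182145580549017665) (lp
  327971954496643201))))) (br 262 (br 259 (br 148 (tr 1 [] [104, 148, 259]) (lp
  273638279575511170)) (br 162 (br 146 (br 138 (lp 510403200836714753) (br 273 (br 140 (lp
  309957417474207873) (lp 237042065836875905)) (br 140 (lp 492102929303752897) (lp
  346272226029088961)))) (br 265 (br 148 (br 140 (lp 528699143042388162) (lp 601610165352419587))
  (lp 382868439767724226)) (br 148 (br 140 (lp 364572497562058881) (br 98 (lp 546713680064303362)
  (lp 437483519872090306))) (lp 492098599959937282)))) (br 140 (lp 182426985732513857) (br 75 (lp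
  474079733610725571) (lp 328253359679877250))))) (br 146 (br 266 (br 138 (lp 419191906993713345)
  (br 273 (br 140 (lp 565018280941080770) (lp 419187577666416834)) (br 140 (lp 400891635460751489)
  (lp 255060932186087553)))) (br 140 (lp 400891635460751489) (br 98 (lp 255060932186087553) (lp
  473802657770782914)))) (br 265 (br 148 (br 140 (lp 437487849199386754) (lp 510398871509418179))
  (lp 291657145924722818)) (br 148 (br 268 (br 140 (lp 273361203719057473) (br 273 (lp
  346272226029088898) (br 97 (lp 364291092378300546) (lp 455502386221301954)))) (lp
  364291092378300546)) (br 97 (lp 309676012273934466) (lp 400887306116935874))))))) (lp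
  91215691889512512)) (br 148 (br 146 (br 134 (lp 91215691889512512) (br 138 (lp
  382872769111535809) (br 140 (lp 309957417474207873) (lp 237042065836875905)))) (br 140 (lp
  182426985732513857) (lp 328253359679877250))) (lp 273638279575511170)))) (br 140 (br 138 (br 134
  (br 78 (lp 91215691889512512) (lp 237046395163910273)) (br 78 (lp 255342337369841793) (lp
  401173040644239554))) (br 78 (br 77 (lp 182426985732513857) (lp 419468982849913026)) (lp
  328257689006911618))) (br 78 (br 146 (lp 346553631212581058) (br 75 (lp 273638279575511170) (lp
  437764925055582403))) (lp 255342337369579650)))) (br 78 (lp 91215691889512512) (lp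
  328262018333946049)))) (br 147 (br 145 (br 140 (lp 327976283840196673) (lp 255060932202864705))
  (br 268 (br 273 (br 140 (br 77 (lp 400887306150494273) (lp 200445852098502720)) (br 77 (lp
  327971954513162305) (lp 455502386254856321))) (br 140 (br 77 (br 76 (lp 72915420356808704) (br
  161 (lp 382591363928047681) (lp 583032817980039297))) (lp 200445852098502720)) (br 97 (br 146 (tr
  1 [] [97, 146, 268]) (lp 236760660653383745)) (br 77 (lp 437202114705375361) (lp
  564732546447069377))))) (br 146 (br 82 (lp 127530500461170752) (lp 364291092395077761)) (lp
  236760660653383745)))) (lp 72915420356808704))) (br 148 (br 147 (br 140 (threeBinsPart12) (br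
  112 (br 60 (threeBinsPart13) (br 104 (tr 1 [] [104, 148, 259]) (br 78 (br 77 (lp
  327962883542499523) (lp 255051929951678658)) (lp 182140976360857730)))) (br 78 (br 77 (br 320 (lp
  327962883542499523) (br 29 (lp 273061862785958083) (br 146 (br 30 (lp 218451249447317698) (br 46
  (lp 309381000667873539) (lp 163840636108677250))) (br 30 (lp 418602227345154372) (lp
  363991614006513924))))) (br 320 (lp 255051929951678658) (br 30 (lp 218451249447317698) (br 46 (lp
  309381000667873539) (lp 163840636108677250))))) (br 320 (lp 182140976360857730) (lp
  163840636108677250))))) (br 259 (tr 1 [] [112, 140, 259]) (br 57 (br 56 (br 53 (br 52 (br 275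
  (br 273 (br 44 (tr 1 [] [44, 194, 273]) (lp 327395606443348033)) (br 274 (br 44 (tr 1 [] [44,
  193, 274]) (lp 509250779574468737)) (br 320 (lp 363710346279018561) (br 161 (lp
  290803721998454849) (br 29 (lp 272503449392009281) (lp 163559230925451328)))))) (br 320 (lp
  400025086114689089) (br 161 (lp 290803721998454849) (br 29 (lp 272503449392009281) (lp
  163559230925451328))))) (br 273 (lp 291080866591162433) (br 45 (lp 327395606426832961) (lp
  472936039722283137)))) (br 265 (lp 254766126738976833) (br 46 (lp 436621299870097537) (lp
  400306560034427009)))) (br 273 (br 265 (lp 218451386886533185) (br 53 (lp 254766126738718785) (lp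
  363991820181983361))) (br 266 (lp 400306560017653889) (br 45 (lp 291080866574389313) (lp
  436621299869839489))))) (br 261 (lp 182136647034089537) (br 265 (lp 291362340477354113) (br 46 (lp
  363991820165210241) (lp 327677080329539713))))))) (br 58 (br 265 (br 104 (br 57 (br 88 (br 56 (br
  320 (lp 145540433295708225) (br 161 (lp 254484584116527234) (br 162 (lp 345409937307611330) (br 27
  (lp 127240093043527745) (lp 436335290498695363))))) (br 320 (lp 109225693443264577) (br 161 (lp
  181855104411639938) (br 162 (lp 345409936216834307) (br 27 (lp 272780456528982211) (lp
  400020549555474692)))))) (br 320 (br 259 (lp 200436918566789250) (br 261 (lp 345977351845462211)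
  (br 161 (lp 200155444663820418) (lp 273066398254641346)))) (br 161 (lp 181855104411639938) (br 259
  (br 162 (lp 236465717750280386) (br 27 (lp 163836238062428290) (lp 291076331088920771))) (br 162
  (lp 236465717750280386) (lp 291076331088920771)))))) (br 88 (lp 182136647034085505) (br 259 (lp
  200436918566789250) (br 162 (lp 273066398254641346) (lp 345977351845462211))))) (br 320 (lp
  200436918566789250) (br 161 (lp 254765989282984131) (br 162 (lp 309376602621624579) (br 27 (lp
  163836238062428290) (lp 363987215960264964)))))) (br 320 (br 97 (br 262 (tr 1 [] [97, 152, 262])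
  (br 56 (br 53 (br 268 (br 273 (lp 436339825966858435) (br 45 (lp 290799392671412354) (lp
  508969305654710531))) (br 273 (lp 254484652835741826) (br 274 (lp 327114132523593922) (br 43 (lp
  108944219540295745) (lp 399743612211445955))))) (br 46 (lp 218169912983560321) (lp
  363710346279006402))) (br 273 (br 135 (br 266 (lp 382010617794674947) (br 51 (lp
  309099664203854019) (lp 454640097482526980))) (br 266 (lp 291080866574119106) (br 51 (lp
  218169912983298178) (lp 363710346261971139)))) (br 51 (br 135 (br 274 (lp 381729143891706115) (br
  43 (lp 199873970760851586) (lp 454358623579558148))) (br 274 (lp 290799392671150274) (br 43 (lp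
  327114132506816707) (lp 363428872359002307)))) (br 266 (br 88 (lp 181855173131116673) (lp
  272784924351672514)) (br 135 (br 45 (lp 345414404039524547) (lp 527269577170379076)) (br 45 (lp
  254484652818968706) (lp 436339825949823235)))))))) (br 263 (br 262 (br 46 (br 88 (lp
  254766126721937601) (lp 345695877942493442)) (br 88 (lp 363991820164940034) (lp
  454921571385495875))) (br 88 (br 46 (lp 181855173131116673) (lp 291080866574119106)) (br 46 (lp
  272784924351672514) (lp 382010617794674947)))) (br 46 (lp 218169912983560321) (lp
  363710346279006402)))) (br 161 (br 56 (br 97 (lp 108944219540295745) (lp 327114063804379330)) (br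
  97 (lp 199873970760851586) (lp 254484584099492034))) (br 88 (br 56 (lp 199869572731379841) (lp
  418039415904686403)) (lp 309095197438132482))))) (br 259 (br 88 (lp 327958554215723203) (lp
  200436918566789250)) (br 88 (lp 255047600624906370) (lp 345977351845462211)))))

def threeBinsPart15 : RefTree :=
  br 267 (br 268 (br 266 (br 139 (br 138 (br 57 (br 56 (lp 90929751237595200) (br 135 (br 134 (lp
  54615011385151552) (br 265 (lp 163840636108939393) (br 104 (lp 345700138567090433) (lp
  254770387346272449)))) (lp 163840704828416128))) (br 135 (br 134 (lp 54615011385151552) (br 265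
  (lp 236751589699760321) (br 104 (lp 418611092157911361) (lp 327681340937093377)))) (lp
  163840704828416128))) (br 112 (br 140 (br 57 (br 104 (br 162 (br 56 (br 100 (br 77 (br 320 (lp
  418325288944947393) (br 45 (lp 309099595501682817) (lp 400029346739015873))) (br 53 (lp
  400029346739015873) (lp 509255040182280449))) (br 146 (br 53 (lp 272784855666012289) (lp
  382010549109276865)) (br 320 (lp 291080797871943809) (lp 454639960077914306)))) (br 100 (br 77 (br
  88 (br 320 (lp 345695809240060097) (br 45 (lp 236470115796795521) (lp 327399867034128577))) (br 45
  (lp 236470115796795521) (br 320 (lp 309381069387616449) (lp 327399867034128577)))) (br 135 (br 53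
  (lp 327399867034128577) (lp 400310820624949505)) (lp 436625560477393153))) (br 146 (br 135 (br 53
  (lp 200155375961124993) (lp 273066329551945921)) (lp 309381069404389569)) (br 135 (br 45 (lp
  345695740520583362) (lp 418606694111404290)) (lp 218451318167056513))))) (br 88 (br 56 (br 265 (br
  320 (lp 291080797871943809) (lp 181855104428679233)) (br 76 (br 320 (lp 145540433295712320) (lp
  290799322895237249)) (br 320 (lp 436621231167393985) (lp 472654427323654338)))) (br 265 (br 320
  (lp 218451318167056513) (lp 327395467914137794)) (br 76 (br 320 (lp 109225693443268672) (lp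
  218169843190349953)) (br 320 (lp 327677011610063041) (lp 363710207766323394))))) (br 320 (lp
  182136578314612865) (lp 109225624723791937)))) (br 146 (br 53 (lp 200155375961124993) (lp
  273066329551945921)) (br 320 (lp 182136578314612865) (br 29 (lp 109225624723791937) (lp
  309381000668139714))))) (br 146 (br 273 (br 135 (lp 273066329551945921) (lp 382292022995210497))
  (br 88 (lp 509536514068214081) (lp 400310820624949505))) (br 88 (br 265 (lp 291362271757877441)
  (br 162 (lp 418606762830881025) (br 76 (lp 109225693443268672) (lp 327677011610063041)))) (br 261
  (lp 182136578314612865) (br 100 (lp 309381069387616449) (lp 491517647702225218)))))) (br 146 (br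
  57 (br 56 (br 273 (br 320 (lp 327395537724125377) (lp 218169844280860801)) (br 320 (lp
  400025017411977473) (lp 290799323968712897))) (br 135 (br 273 (br 320 (lp 218451318166794433) (lp
  145540364575973505)) (br 320 (lp 291080797854646529) (lp 218169844263825601))) (br 273 (lp
  254766058019238081) (lp 327395537707090177)))) (br 273 (br 135 (lp 218451318166794433) (lp
  327677011610059009)) (br 88 (lp 400306491297911105) (lp 291080797854646529)))) (br 263 (br 88 (br
  320 (br 262 (br 265 (lp 455198578539520322) (br 162 (br 98 (lp 600457537915224514) (lp
  527828058227372418)) (lp 273062000224911553))) (br 162 (br 265 (lp 454917104653586690) (br 98 (lp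
  600176064029290882) (lp 527546584341438786))) (br 84 (lp 382006219782242497) (lp
  454917104653586690)))) (br 273 (br 56 (br 100 (br 162 (lp 381724677159796930) (br 84 (lp
  436335289424437507) (lp 309095197471944834))) (br 29 (lp 309095197471944834) (lp
  527265041736028419))) (br 100 (br 162 (lp 272780457602465986) (br 84 (lp 400020549571993859) (lp
  509246174295781700))) (br 29 (lp 509246174295781700) (lp 382006082326253827)))) (br 56 (lp
  454354156847649026) (lp 345409937290318082)))) (br 261 (br 320 (lp 345972885096255746) (br 29 (lp
  200150977914613890) (lp 345691342473810179))) (br 265 (br 320 (lp 600738943098716611) (lp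
  382006082326253827)) (br 98 (br 320 (lp 491231844471959938) (lp 345409937290318082)) (br 320 (lp
  418602364784107842) (lp 272780457602465986)))))) (br 273 (br 320 (br 265 (lp 527546584358473986)
  (br 84 (lp 382006219782242497) (lp 600176064046326082))) (br 100 (br 162 (lp 381724677159796930)
  (br 84 (lp 545279508981768451) (lp 309095197471944834))) (br 29 (lp 309095197471944834) (lp
  527265041736028419)))) (br 320 (lp 672805543734178178) (lp 454354156847649026)))))) (br 140 (br 77
  (br 320 (lp 182136578314612865) (br 146 (lp 273066260832469186) (br 29 (lp 109225624723791937) (lp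
  309381000668139714)))) (br 320 (lp 345977214423290114) (lp 273066260832469186))) (br 77 (br 320
  (lp 418883769967599939) (br 29 (lp 273061862785958083) (br 45 (lp 418602227345154372) (lp
  218451249447317698)))) (br 320 (lp 291362203038138626) (lp 218451249447317698)))))) (br 141 (br
  140 (br 56 (br 77 (br 76 (br 146 (tr 1 [] [76, 146, 289]) (br 320 (lp 145540433295712320) (br 44
  (br 29 (lp 254484584116535361) (lp 163559230925451328)) (br 29 (lp 327114062747422849) (lp
  345414335353868417))))) (br 162 (br 320 (lp 563865722240397569) (br 45 (lp 345414335353868417) (lp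
  127244491089780800))) (br 320 (lp 436621231167393985) (lp 254484584133050433)))) (br 320 (lp
  236470184533045376) (lp 127244491089780800))) (br 77 (br 76 (lp 109225693443268672) (br 162 (lp
  454921502683066625) (lp 327677011610063041))) (lp 200155444680601728))) (br 146 (br 56 (br 98 (br
  320 (lp 545565450707427649) (lp 327114063820898497)) (br 320 (lp 472935971019575553) (lp
  254484584133046401))) (br 98 (lp 436621231150096705) (lp 363991751462244609))) (br 320 (br 56 (br
  98 (lp 454635699470094593) (lp 382006219782242497)) (br 98 (lp 345691479912763649) (lp
  273062000224911553))) (br 98 (lp 272499052435751041) (br 29 (lp 199869572747898945) (lp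
  418039417011982530)))))) (br 56 (br 320 (lp 181855173147893888) (lp 72629479704629312)) (lp
  145540433295450240)))) (br 141 (br 140 (br 76 (br 146 (lp 127244491089780800) (br 44 (br 320 (lp
  218169912983568448) (br 29 (lp 254484584116535361) (lp 163559230925451328))) (br 320 (lp
  181855173147897920) (br 29 (lp 327114062747422849) (lp 345414335353868417))))) (br 273 (br 146 (lp
  127244491089780800) (br 320 (lp 363710277576315009) (br 29 (lp 254484584133050433) (lp
  345414335353868417)))) (br 45 (lp 345414335353868417) (br 146 (lp 127244491089780800) (lp
  490954768649318593))))) (br 77 (br 98 (br 320 (lp 381724745879015617) (br 45 (lp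
  272499052435751041) (lp 327114063820898497))) (br 320 (lp 309095266191163521) (br 146 (lp
  254484584133046401) (br 29 (lp 199869572747898945) (lp 418039417011982530))))) (br 98 (br 51 (lp
  327114063820898497) (lp 472654497116348673)) (br 51 (lp 254484584133046401) (lp
  400025017428496577))))) (br 320 (lp 218169913000079488) (lp 72629479704629312)))) (lp
  72629479704629312)) (br 147 (br 268 (br 141 (br 140 (br 76 (br 146 (lp 127244491089780800) (br
  274 (br 320 (lp 181855173147897920) (br 29 (lp 363428802599608449) (lp 381729075206054017))) (br
  320 (lp 218169912983568448) (br 29 (lp 290799323968720961) (lp 163559230925451328))))) (br 273 (br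
  146 (lp 127244491089780800) (br 320 (lp 400025017428500609) (br 29 (lp 254484584133050433) (lp
  381729075206054017)))) (br 45 (lp 381729075206054017) (br 146 (lp 127244491089780800) (lp
  527269508501504193))))) (br 77 (br 98 (br 320 (lp 418039485731201217) (br 45 (lp
  272499052435751041) (lp 363428803673084097))) (br 320 (lp 345410006043349121) (br 146 (lp
  290799323985232001) (br 29 (lp 199869572747898945) (lp 490668896716353730))))) (br 98 (br 51 (lp
  363428803673084097) (lp 508969236968534273)) (br 51 (lp 290799323985232001) (lp
  436339757280682177))))) (br 320 (lp 218169913000079488) (lp 72629479704629312))) (lp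
  72629479704629312)) (br 44 (br 320 (lp 218169912983568448) (br 29 (lp 327114063804391489) (lp
  163559230925451328))) (lp 181855173147897920)))

def threeBinsPart16 : RefTree :=
  br 200 (br 194 (br 28 (lp 36314739852447744) (br 193 (br 152 (br 269 (br 141 (threeBinsPart14)
  (br 265 (tr 1 [] [100, 146, 265]) (br 145 (br 268 (tr 1 [] [98, 145, 268]) (br 320 (br 192 (br
  142 (lp 309676012307226753) (lp 182145580565532737)) (br 56 (br 52 (br 142 (lp 381729143941775554)
  (lp 290799392704442498)) (br 142 (lp 345414404089589954) (lp 254484652852256898))) (br 142 (lp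
  309099664237146306) (lp 218169912999813250)))) (br 142 (lp 199873970794143873) (lp
  108944219556810817)))) (br 320 (br 192 (lp 127530500461170752) (br 57 (br 56 (br 53 (br 52 (br
  268 (br 46 (lp 472654565835563265) (lp 400025086147711169)) (br 46 (lp 327114132540113089) (lp
  254484652852260993))) (br 268 (br 46 (lp 436339825983377665) (lp 363710346295525569)) (br 46 (lp
  290799392687927489) (lp 218169913000075393)))) (br 46 (lp 400025086131192065) (lp
  327395606443339969))) (br 46 (br 266 (lp 363710346278748417) (br 51 (lp 254484652835483841) (lp
  400025086130934017))) (br 266 (lp 291080866590896321) (br 51 (lp 181855173147631745) (lp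
  327395606443081921))))) (br 46 (lp 327395606426304769) (lp 254766126738452673)))) (br 30 (lp
  72629479704629312) (lp 272503450481995969)))))) (br 142 (br 192 (br 78 (lp 127530500461170752)
  (lp 309676012307226753)) (br 46 (br 30 (lp 72629479704629312) (br 161 (lp 272503450481995969) (lp
  363428872392294657))) (br 145 (lp 199873970794143873) (lp 290799392704442561)))) (br 192 (lp
  182145580565532737) (br 49 (lp 108944219556810817) (lp 327114132556624066))))) (br 63 (br 161 (br
  320 (br 192 (br 259 (lp 91211293843001409) (br 261 (lp 273352407626035330) (br 97 (lp
  127530500444393537) (lp 200441454035214465)))) (br 259 (lp 72910953590820929) (br 261 (lp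
  218451386869493890) (br 262 (br 265 (lp 363991820148162819) (br 46 (lp 145540433278673025) (lp
  254766126721675458))) (br 265 (lp 291080866557341891) (br 53 (br 268 (br 273 (lp
  327395606409527491) (br 45 (lp 218169912966525058) (lp 400025086097379587))) (br 273 (lp
  181855173130854530) (br 274 (lp 254484652818706626) (br 276 (lp 327114132506558659) (br 39 (lp
  72629479687852097) (lp 290799392654373059)))))) (br 46 (lp 363710346245193987) (lp
  472936039688196420)))))))) (br 259 (lp 145540364559196290) (br 261 (lp 272780457585688771) (br 97
  (lp 72629479687852097) (lp 218169844247048386))))) (br 320 (br 192 (br 259 (lp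
  91211293843001409) (br 98 (lp 200441454035214465) (lp 273352407626035330))) (br 259 (lp
  72910953590820929) (br 261 (lp 218451386869493890) (br 265 (lp 363991820148162819) (br 46 (lp
  145540433278673025) (lp 254766126721675458)))))) (br 259 (br 162 (lp 200150977897836738) (br 164
  (lp 254761591236477123) (br 168 (lp 309372204575113476) (br 15 (lp 54610613338640449) (lp
  218446851400806595))))) (br 98 (lp 127240093026492545) (br 29 (lp 181850706365132930) (lp
  327391070924329219)))))) (br 259 (lp 109511634095181889) (br 261 (lp 309953088130396290) (br 97
  (lp 127530500444393537) (lp 218741794287394945)))))) (br 152 (br 148 (threeBinsPart15) (br 265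
  (br 263 (br 262 (br 259 (br 56 (tr 1 [] [56, 194, 261]) (br 135 (br 320 (lp 309658145244070146)
  (br 162 (lp 309376602621624579) (br 27 (lp 163836238062428290) (lp 363987215960264964)))) (lp
  236747260372725953))) (br 88 (br 320 (lp 236747260372725953) (br 56 (br 162 (lp
  272780457602724034) (br 27 (lp 127240093043527745) (lp 436335290498695363))) (br 162 (lp
  236465717750280386) (br 27 (lp 327391069867622659) (lp 454631162894115140))))) (br 261 (br 320 (lp
  509809191861383555) (br 29 (lp 291076331088920771) (lp 236465717750280386))) (br 320 (lp
  382287624931922242) (lp 236465717750280386))))) (br 320 (lp 200151046634348673) (br 162 (lp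
  272780457602724034) (br 27 (lp 127240093043527745) (lp 436335290498695363))))) (br 320 (lp
  236465786486792321) (br 162 (lp 345409937307611330) (br 27 (lp 127240093043527745) (lp
  436335290498695363))))) (br 88 (br 57 (br 56 (br 320 (lp 309095266174644417) (lp
  199869572731379841)) (br 320 (lp 236465786469757121) (lp 309095197438132482))) (lp
  309376740060578049)) (br 320 (lp 454917104619774338) (lp 309095197438132482))))) (br 259 (br 320
  (lp 127521566929461377) (br 162 (lp 200150977897836738) (br 164 (lp 254761591236477123) (br 168
  (lp 309372204575113476) (br 15 (lp 54610613338640449) (lp 218446851400806595)))))) (br 98 (br 320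
  (lp 200151046617313473) (lp 127240093026492545)) (br 320 (lp 327672613546774786) (br 29 (lp
  181850706365132930) (lp 327391070924329219)))))))) (br 194 (lp 0) (br 148 (br 112 (br 140 (br 147
  (br 56 (br 52 (br 273 (lp 254484584133050433) (lp 290799323968720961)) (br 139 (lp
  181855104428679233) (lp 418320890915213442))) (br 135 (lp 109225624723791937) (br 139 (lp
  273061931505696898) (lp 309376671357882498)))) (br 56 (br 52 (br 44 (br 28 (lp 36314739852447744)
  (br 163 (lp 327114063804391489) (lp 381724745862508609))) (lp 309095266191167553)) (lp
  236465786486796353)) (lp 163836306781909057))) (br 56 (br 52 (br 51 (lp 199869572747898945) (lp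
  472650099086618754)) (br 139 (br 51 (lp 309095197471944834) (lp 509246244106293443)) (lp
  363705879530061954))) (br 135 (br 51 (lp 200150977914613890) (lp 327672544844075203)) (br 139 (lp
  363987284696518851) (lp 254761659972731010))))) (br 140 (lp 109225624723791937) (br 51 (lp
  273061862785958083) (lp 400583429715419396)))) (br 104 (br 56 (br 196 (br 320 (lp
  327391139677876354) (br 27 (lp 127240093043527745) (lp 436335290498695363))) (lp
  127240093043527745)) (br 259 (br 196 (br 135 (br 152 (br 27 (lp 163836238062428290) (br 320 (lp
  291357804991889603) (lp 291076331088920771))) (br 320 (lp 182132180268101762) (br 27 (lp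
  236461319703769283) (lp 254761591236477123)))) (lp 218446920120545410)) (br 71 (br 39 (lp
  236461319703769283) (br 152 (lp 163836238062428290) (lp 236742793606738115))) (br 135 (lp
  163836238062428290) (lp 273057533459181763)))) (br 152 (br 88 (br 320 (lp 218446920120545410) (br
  27 (lp 382001683206263044) (lp 291076331088920771))) (br 320 (lp 418597898018382084) (lp
  291076331088920771))) (br 320 (lp 309372273294594243) (lp 181850706365132930))))) (br 71 (br 196
  (br 320 (lp 182132180268101762) (br 15 (lp 54610613338640449) (br 23 (lp 218446851400806595) (br
  39 (br 27 (lp 309372204575113476) (lp 254761591236477123)) (br 27 (lp 163836238062428290) (lp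
  363987215960264964)))))) (br 152 (lp 163836238062428290) (br 320 (lp 236742793606738115) (br 168
  (lp 309372204575113476) (br 15 (lp 54610613338640449) (lp 218446851400806595)))))) (br 27 (lp
  163836238062428290) (br 320 (lp 291357804991889603) (lp 363987215960264964)))))))) (br 200 (lp 0)
  (br 15 (lp 54610613338640449) (br 176 (lp 218446851400806595) (lp 291353406945116420))))

def threeBinsPart17 : RefTree :=
  br 84 (br 56 (br 147 (br 146 (br 30 (br 51 (br 52 (br 98 (br 82 (br 50 (lp 72629479704629312)
  (br 193 (lp 217888438023368833) (br 140 (lp 399462067475079425) (lp 345128531066638529)))) (br 161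
  (lp 363147328696373442) (br 140 (lp 326832588844191937) (lp 272499052435751041)))) (br 145 (lp
  290517849008521346) (br 140 (lp 254203109156339841) (lp 199869572747898945)))) (br 266 (br 273 (br
  29 (lp 363424404553351362) (br 45 (lp 436053884241203458) (lp 272499051362267329))) (br 140 (br
  138 (br 29 (lp 472091477370233154) (br 45 (lp 544720957058085250) (lp 326832587770708225))) (br 29
  (lp 417757940961792258) (br 45 (lp 490387420649644354) (lp 272499051362267329)))) (br 82 (lp
  272499051362267329) (lp 436053884241203458)))) (br 98 (br 82 (lp 181573698171183233) (br 161 (lp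
  435776807310741763) (br 140 (lp 399462067458560258) (lp 345128531050119362)))) (br 145 (lp
  363147327622889667) (br 140 (lp 326832587770708162) (lp 272499051362267266)))))) (br 53 (br 52 (br
  29 (br 28 (lp 36314739852447744) (br 44 (lp 290517848992010369) (lp 363147327622897857))) (br 83
  (br 45 (lp 435776807310749953) (lp 181573698171187328)) (lp 108944219540299840))) (br 193 (br 29
  (lp 145258958319001665) (br 45 (lp 217888438006853761) (lp 290517916637741249))) (br 138 (br 29
  (lp 290517847918526657) (br 45 (lp 363147327606378753) (lp 435776806237266241))) (br 29 (lp
  236184311510085761) (br 45 (lp 308813791197937857) (lp 381443269828825345)))))) (lp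
  145258958319001728))) (br 268 (tr 1 [] [97, 146, 268]) (br 52 (br 78 (br 46 (br 50 (lp
  181573699244662913) (br 45 (lp 145258959392481345) (lp 326832657563402434))) (br 50 (lp
  290517917727731906) (lp 254203177875550338))) (lp 108944219556810817)) (br 46 (br 45 (lp
  254203177859035266) (lp 290517917711216834)) (lp 217888438023364738))))) (br 52 (br 98 (br 97 (br
  83 (br 51 (lp 145258959392481345) (lp 326832657546891394)) (lp 181573699228151873)) (br 140 (br 76
  (br 44 (lp 108944219540299840) (br 193 (lp 254203177859039361) (lp 381443270902309057))) (br 161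
  (lp 399462068532043970) (lp 272499052435751041))) (lp 272499052435751041))) (br 273 (br 44 (tr 1
  [] [44, 194, 273]) (br 51 (lp 199869572747898945) (lp 308813791214456961))) (br 76 (br 44 (br 28
  (lp 36314739852447744) (br 193 (lp 217888438006857793) (br 162 (lp 290517848992010369) (lp
  345128531050127489)))) (br 193 (lp 181573698171187265) (lp 308813791214456961))) (br 161 (lp
  326832588844191874) (lp 454072681887461570))))) (br 193 (br 98 (br 97 (br 51 (lp
  254203177859035266) (lp 290517917694705794)) (br 140 (br 76 (lp 217888438006853761) (br 161 (lp
  472091547146412291) (lp 345128531050119362))) (lp 345128531050119362))) (br 273 (br 51 (lp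
  272499051362267266) (lp 145258958319001665)) (br 76 (lp 145258958319001665) (br 161 (lp
  399462067458560195) (lp 490387420649644291))))) (br 162 (br 76 (br 29 (lp 236184311510085761) (lp
  308813791197937857)) (br 98 (lp 436053884241203458) (br 140 (lp 581312773840728387) (lp
  363424404553351362)))) (br 76 (lp 236184311510085761) (lp 363424404553351362)))))) (br 289 (br 28
  (lp 36314739852447744) (br 30 (br 29 (lp 272499052419240001) (lp 108944219540299840)) (lp
  181573699228151873))) (br 29 (br 28 (lp 36314739852447744) (br 193 (lp 217888438006857793) (br 162
  (lp 326832588827680897) (lp 381443270885798017)))) (lp 108944219540299840)))) (br 146 (br 46 (br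
  53 (br 30 (br 51 (br 262 (br 321 (br 98 (br 82 (lp 199869571657380033) (br 140 (lp
  381443201092313410) (lp 327109664683872514))) (br 140 (lp 308813721404461314) (lp
  254480184996020418))) (br 82 (lp 254203108065820929) (br 29 (lp 363147257812902210) (lp
  435776737500754306)))) (br 98 (br 82 (lp 145258958318739585) (br 161 (lp 363147327605854467) (br
  140 (lp 326832587753672962) (lp 272499051345232066)))) (br 145 (lp 290517847918002371) (br 140 (lp
  254203108065820866) (lp 199869571657379970))))) (br 262 (br 134 (br 82 (lp 363147326532378945) (br
  29 (lp 217888368213639361) (lp 290517847901491457))) (br 29 (lp 163554831805198465) (br 45 (lp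
  236184311493050561) (lp 308813790123938049)))) (br 29 (lp 108944218466558017) (br 45 (lp
  181573698154410113) (lp 254203176785297601))))) (br 268 (tr 1 [] [97, 146, 268]) (br 45 (lp
  217888438006591618) (lp 254203177858773186)))) (br 289 (tr 1 [] [76, 146, 289]) (br 193 (lp
  217888436933112001) (br 134 (lp 326832586680193345) (lp 272499050271752449))))) (br 268 (tr 1 []
  [97, 146, 268]) (lp 181573698170921090))) (br 193 (br 98 (br 97 (br 51 (lp 217888438006591618)
  (lp 254203177842262146)) (br 140 (br 76 (lp 181573698154410113) (br 161 (lp 399462067441524995)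
  (lp 272499051345232066))) (lp 272499051345232066))) (br 273 (br 51 (lp 199869571657379970) (lp
  108944218466558017)) (br 76 (lp 108944218466558017) (br 161 (lp 326832587753672899) (lp
  381443201092313347))))) (br 98 (br 76 (lp 236184311493050561) (lp 327109664683872514)) (br 76 (lp
  163554831805198465) (br 273 (lp 254480184996020418) (lp 436053814430953795))))))) (br 162 (br 56
  (br 289 (br 161 (br 98 (br 97 (lp 108944219540295745) (br 146 (lp 290517848992002242) (br 140 (lp
  326832588827672770) (lp 454072681870938371)))) (br 145 (lp 472091478443708676) (br 140 (lp
  254203109139820674) (lp 381443202183086275)))) (br 98 (lp 199869572731379841) (br 140 (lp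
  345128462330904770) (lp 472368555374170371)))) (br 29 (lp 399461998739345666) (lp
  254203109139820737))) (br 161 (br 145 (br 30 (br 39 (br 29 (lp 363147258886377732) (lp
  217888369287114946)) (br 29 (lp 472091477352931653) (lp 326832587753668867))) (br 39 (lp
  72629479687852097) (lp 181573698154406018))) (br 98 (br 97 (br 39 (lp 72629479687852097) (lp
  181573698154406018)) (br 146 (br 39 (lp 217888369287114946) (lp 326832587753668867)) (br 274 (br
  39 (lp 345128462313607427) (lp 454072680780161348)) (br 39 (lp 254203109122785474) (lp
  363147327589339395))))) (br 273 (br 39 (lp 272498982625755331) (lp 381443201092309252)) (br 39 (lp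
  181573629434933378) (lp 290517847901487299))))) (br 289 (br 262 (br 98 (br 39 (lp
  127240093026492545) (lp 290794924831686914)) (br 39 (br 140 (lp 236184242773573826) (lp
  327109595964395779)) (br 140 (lp 399739074578768195) (lp 490664427769590148)))) (br 98 (lp
  236184311493046466) (br 140 (lp 345128461240127747) (lp 436053814430949700)))) (br 262 (br 134 (br
  39 (br 29 (lp 290517779182014722) (lp 181573629434933441)) (br 29 (lp 508406147395649987) (lp
  399461997648568706))) (br 29 (lp 454072610987209091) (lp 345128461240127810))) (br 29 (lp
  399461997648568643) (lp 290517847901487362)))))) (br 56 (lp 290794925922463874) (br 88 (br 193 (lp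
  290794924831686851) (lp 345405538170327299)) (lp 181850706365132930))))

def threeBinsPart18 : RefTree :=
  br 384 (br 289 (br 120 (br 288 (threeBinsPart11) (br 288 (lp 0) (threeBinsPart16))) (br 272 (br
  192 (br 160 (br 144 (br 258 (lp 128097642302672960) (br 131 (lp 182717051734069313) (br 136 (tr 1
  [] [115, 136, 260]) (lp 255913809628635201)))) (br 258 (lp 109797370753192000) (br 260 (lp
  219313266529673281) (br 103 (lp 146116508635107393) (lp 328829162306150530))))) (br 258 (lp
  91497098146746432) (br 260 (lp 182712721316782145) (br 264 (lp 273928344486813826) (lp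
  255628072953847938))))) (br 258 (lp 73196757894565952) (br 260 (lp 146112040812421185) (br 264
  (lp 219027323730272386) (lp 200727052197306498))))) (br 272 (lp 0) (br 192 (br 160 (lp
  146116508635107393) (lp 109515963422216257)) (br 31 (lp 72915282917855297) (lp
  182426780647825538)))))) (br 288 (lp 0) (br 147 (br 193 (br 146 (br 192 (br 88 (br 138 (lp
  145830771994136640) (br 140 (lp 200445852098502720) (lp 127530500461170752))) (lp
  91215691889512512)) (br 267 (br 57 (br 56 (br 266 (br 52 (tr 1 [] [52, 193, 266]) (br 139 (br
  138 (lp 90929751237595200) (br 140 (br 53 (lp 381733472178819265) (lp 236470184533045376)) (br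
  320 (lp 181855173147893888) (lp 272503449408516289)))) (br 140 (lp 236470184533045376) (lp
  181855173147893888)))) (br 268 (br 50 (lp 72629479704629312) (br 141 (br 140 (br 52 (lp
  127244491089780800) (br 139 (lp 381733472178819265) (lp 527273905474269441))) (br 320 (lp
  418043882703966465) (br 52 (lp 308818189260701889) (lp 272503449408516289)))) (lp
  508969304614265153))) (br 139 (lp 272503449408516289) (br 320 (lp 363428871318814977) (br 50 (lp
  72629479704629312) (lp 308818189260701889)))))) (br 88 (br 53 (br 84 (br 268 (br 141 (br 320 (br
  140 (lp 490959165621825793) (lp 381729142851522817)) (br 140 (lp 345418732326375617) (lp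
  236188709556072641))) (lp 472654564761821505)) (br 135 (lp 236188709556072641) (lp
  327114131466371329))) (br 320 (tr 1 [] [53, 138, 320]) (lp 272789252622004417))) (br 139 (br 138
  (br 135 (lp 272789252622004417) (lp 382014946065268993)) (br 140 (lp 454644425769640193) (lp
  436339824909635905))) (br 140 (lp 600184859065090369) (lp 436339824909635905)))) (lp
  54615011385151552))) (br 134 (lp 54615011385151552) (br 138 (lp 163840704828416128) (br 140 (lp
  200155444680601728) (lp 145540433295450240))))) (br 268 (br 50 (lp 72629479704629312) (br 141 (br
  140 (lp 127244491089780800) (br 51 (lp 308818189260701889) (lp 218169913000079488))) (lp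
  218169913000079488))) (br 50 (lp 72629479704629312) (br 141 (lp 308818189260701889) (lp
  399743611171000577)))))) (br 192 (lp 72915420356808704) (br 57 (br 56 (br 53 (br 52 (br 45 (br
  29 (lp 236188709556338753) (br 162 (lp 363433200629342337) (lp 418043882687459457))) (lp
  181855173147897920)) (br 45 (br 290 (br 320 (lp 381729142835273857) (br 29 (lp 199873969704153153)
  (lp 327118460777156737))) (br 139 (lp 199873969704153153) (lp 254484651762270273))) (lp
  345414402999603329))) (lp 145540433295712320)) (br 266 (br 320 (lp 327395605353091201) (br 29 (lp
  163559229851709505) (lp 290803720924713089))) (br 45 (br 290 (br 320 (lp 345414402982830209) (br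
  29 (lp 163559229851709505) (lp 290803720924713089))) (br 135 (lp 163559229851709505) (lp
  218169911909826625))) (lp 309099663147159681)))) (lp 109225693443268672)))) (br 146 (br 57 (br 56
  (br 53 (br 52 (br 268 (br 141 (br 140 (lp 127244491089780800) (br 51 (br 50 (lp
  72629479704629312) (lp 436058282303971585)) (lp 218169913000079488))) (br 320 (lp
  218169913000079488) (lp 72629479704629312))) (lp 72629479704629312)) (br 139 (br 140 (br 138 (lp
  90929751237595200) (lp 472658825369903361)) (br 51 (lp 363428802599600385) (lp
  181855173147893888))) (br 140 (lp 236470184533045376) (lp 181855173147893888)))) (br 138 (lp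
  90929751237595200) (br 140 (lp 236470184533045376) (lp 181855173147893888)))) (br 135 (br 138 (br
  134 (lp 54615011385151552) (lp 327399865960644865)) (br 140 (br 53 (lp 400029345665016065) (lp
  200155444680601728)) (br 320 (lp 145540433295450240) (lp 290799322894713089)))) (br 138 (lp
  163840704828416128) (br 140 (lp 200155444680601728) (lp 145540433295450240))))) (br 134 (lp
  54615011385151552) (br 138 (lp 163840704828416128) (br 140 (lp 200155444680601728) (lp
  145540433295450240))))) (br 56 (br 52 (br 45 (br 44 (br 320 (tr 1 [] [44, 147, 320]) (br 28 (lp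
  36314739852447744) (br 162 (lp 163559230925451328) (lp 399743542435278977)))) (br 29 (lp
  363428802599608449) (br 162 (lp 490673293672612033) (lp 181855173147897920)))) (lp
  181855173147897920)) (br 320 (lp 145540433295712320) (br 29 (lp 290799322895237249) (lp
  418043813968240833)))) (br 320 (lp 109225693443268672) (br 29 (lp 218169843190349953) (lp
  345414334263353537)))))) (br 193 (br 192 (lp 72915420356808704) (br 57 (br 56 (br 53 (br 52 (br
  45 (br 44 (br 290 (br 28 (lp 36314739852447744) (br 320 (lp 218169912983568448) (br 29 (lp
  272503449392009281) (lp 163559230925451328)))) (br 28 (lp 36314739852447744) (br 163 (lp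
  272503449392009281) (lp 327114131450126401)))) (br 29 (lp 290799391614455873) (lp
  472654564745576577))) (lp 181855173147897920)) (br 274 (lp 400025085057720449) (br 29 (lp
  254484651762270273) (lp 436339824893390977)))) (lp 145540433295712320)) (br 266 (lp
  327395605353091201) (br 274 (lp 363710345205276801) (br 29 (lp 218169911909826625) (lp
  400025085040947329))))) (lp 109225693443268672))) (br 56 (br 52 (br 44 (br 29 (br 28 (lp
  36314739852447744) (br 163 (br 162 (lp 163559230925451328) (lp 436058282270949505)) (lp
  218169912983568448))) (br 162 (lp 163559230925451328) (lp 218169912983568448))) (lp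
  181855173147897920)) (lp 145540433295712320)) (lp 109225693443268672)))))) (br 384 (lp 0) (br 112
  (br 164 (br 100 (br 194 (br 148 (br 57 (threeBinsPart17) (br 289 (tr 1 [] [76, 146, 289]) (lp
  108944218466558080))) (br 148 (lp 0) (br 98 (br 56 (br 266 (br 30 (lp 199869572731379841) (lp
  108944219540295745)) (lp 108944219540295745)) (br 97 (br 39 (lp 72629479687852097) (lp
  181573698154406018)) (br 262 (br 39 (lp 127240093026492545) (lp 290794924831686914)) (br 88 (lp
  236184311493046466) (lp 308813722461421827))))) (br 56 (lp 290794925922463874) (br 88 (br 193 (lp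
  290794924831686851) (lp 345405538170327299)) (br 261 (lp 181850706365132930) (br 262 (lp
  418034949138702660) (lp 363424335800062212)))))))) (br 194 (lp 0) (br 76 (br 28 (lp
  36314739852447744) (br 44 (lp 272499052419240001) (br 52 (lp 436053884257726594) (br 56 (lp
  327109664701169794) (lp 218165445143838850))))) (br 84 (br 52 (lp 199869572747898945) (br 56 (lp
  454349757744435395) (lp 309090798334660803))) (br 56 (lp 290794925922463874) (br 39 (lp
  181850706365132930) (lp 400016151508967684))))))) (br 273 (br 263 (br 145 (br 88 (br 56 (lp
  217888369304150146) (lp 254203108065816771)) (br 23 (lp 145258889599262850) (lp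
  326832519034192132))) (br 152 (br 265 (br 104 (br 88 (br 56 (lp 127240093043527745) (br 261 (lp
  272776058482475203) (br 193 (lp 163554831805194370) (lp 218165445143834818)))) (br 261 (lp
  345405469450850564) (br 161 (lp 236184242773569731) (lp 290794856112210179)))) (br 146 (lp
  199869502937903298) (br 148 (lp 254480116276543683) (lp 145535966529462402)))) (br 39 (br 104 (br
  161 (lp 381443132372832580) (br 262 (lp 436053745711473028) (br 56 (lp 236184242790346946) (lp
  308813721404457219)))) (lp 199869502937903298)) (br 56 (lp 272498982642790594) (br 193 (lp
  308813721404457219) (lp 363424334743097667))))) (br 23 (lp 145535966529462402) (lp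
  236461319703769283)))) (br 265 (lp 127240093043527745) (br 145 (lp 217888369304150146) (lp
  308813722495234242)))) (br 56 (lp 181573629451968641) (br 262 (br 134 (br 88 (lp
  326832517960716610) (br 23 (lp 254203039346344194) (lp 399461928929091971))) (br 88 (lp
  272498981552275714) (lp 345128392520651075))) (br 88 (lp 217888368213635266) (lp
  290517779182010627)))))) (br 164 (lp 0) (br 56 (lp 127240093043527745) (br 259 (br 88 (lp
  327386671821111556) (br 23 (lp 145535966529462402) (lp 236461319703769283))) (br 261 (lp
  272776058482475203) (br 193 (lp 163554831805194370) (lp 218165445143834818))))))) (br 259 (lp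
  54610613338640449) (br 261 (lp 163554763085721730) (br 137 (lp 217888299494158531) (br 134 (lp
  108944149747081345) (lp 272498912832798979)))))))

def threeBins : RefTree :=
  br 256 (lp 0) (br 385 (br 119 (br 224 (br 115 (threeBinsPart18) (br 193 (br 192 (br 121 (br 139
  (br 145 (br 120 (br 137 (br 136 (lp 54900884408369152) (br 117 (br 259 (br 144 (lp
  365706782352351297) (br 258 (br 160 (lp 164693857115050048) (lp 146393584508604480)) (br 160 (lp
  329106239253389377) (lp 292505694040498241)))) (br 144 (lp 109797370769969152) (br 160 (lp
  91497099220488192) (lp 73196826614042624)))) (br 144 (lp 182994128664531008) (br 160 (lp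
  164693857115050048) (lp 146393584508604480))))) (br 116 (br 144 (lp 109797370769969152) (br 109
  (br 108 (br 258 (tr 1 [] [108, 145, 258]) (br 160 (lp 91497099220488192) (br 92 (lp
  73196826614042624) (lp 365698123664736321)))) (br 160 (lp 384002725614989377) (br 93 (lp
  347402180402098241) (lp 201290070870204480)))) (br 160 (lp 219590343476650048) (lp
  201290070870204480)))) (br 144 (lp 182994128664531008) (br 160 (lp 164693857115050048) (lp
  146393584508604480))))) (br 259 (br 118 (br 258 (br 144 (lp 128097642302672960) (br 160 (lp
  109797370753192000) (lp 91497098146746432))) (br 144 (br 117 (br 260 (lp 255913809628635201) (lp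
  201017323267035201)) (br 131 (lp 201017323267035201) (lp 274214081161601089))) (br 160 (lp
  219313266529673281) (lp 182712721316782145)))) (br 258 (lp 146397913835638848) (br 131 (lp
  201017323267035201) (lp 274214081161601089)))) (lp 73201155941076992))) (br 120 (br 116 (br 108
  (br 93 (br 92 (lp 73196826614042624) (br 161 (br 160 (lp 91497099220488192) (lp
  365698123664736321)) (lp 182989799320723520))) (br 160 (lp 91497099220488192) (lp
  182989799320723520))) (br 94 (lp 201290070870204480) (lp 219590343476650048))) (br 94 (lp
  146393584508604480) (lp 164693857115050048))) (br 94 (lp 91497098146746432) (lp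
  109797370753192000)))) (br 145 (br 144 (lp 109797370769969152) (br 109 (br 108 (br 258 (tr 1 []
  [108, 145, 258]) (br 160 (lp 91497099220488192) (br 92 (lp 73196826614042624) (lp
  365698123664736321)))) (br 160 (lp 438899211976589377) (br 93 (lp 402298666763698241) (lp
  201290070870204480)))) (br 160 (lp 219590343476650048) (lp 201290070870204480)))) (br 108 (br 93
  (br 92 (lp 73196826614042624) (br 161 (br 160 (lp 91497099220488192) (lp 365698123664736321))
  (lp 182989799320723520))) (br 160 (lp 91497099220488192) (lp 182989799320723520))) (br 94 (lp
  201290070870204480) (lp 219590343476650048))))) (br 124 (br 132 (lp 73201155941076992) (br 136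
  (lp 146397913835638848) (br 144 (lp 128097642302672960) (br 160 (lp 109797370753192000) (lp
  91497098146746432))))) (lp 91501427473780800))) (br 259 (br 120 (br 139 (br 258 (br 138 (lp
  128093244256424000) (br 146 (lp 182989730618024000) (br 92 (lp 146389186462097472) (lp
  164689459068543040)))) (br 92 (lp 292496897947484225) (br 137 (lp 255905013536137281) (br 108 (lp
  329097443160375361) (lp 310801499897737281))))) (br 108 (br 258 (br 92 (lp 146389186462097472) (lp
  164689459068543040)) (br 92 (lp 292496897947484225) (lp 329097443160375361))) (br 258 (lp
  182989730618024000) (lp 365697986259337281)))) (br 258 (lp 73196757894565952) (lp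
  146112040812421185))) (lp 54896486361862144))) (br 120 (br 116 (br 108 (br 60 (lp
  54896486361862144) (br 92 (lp 146389186462097472) (lp 164689459068543040))) (lp
  182989730618024000)) (lp 128093244256424000)) (lp 73196757894565952)))) (br 224 (lp 0) (br 258
  (lp 54892088315351104) (br 260 (lp 109502701653991489) (br 264 (lp 164113314992627842) (br 15 (lp
  54610613338640449) (lp 218723928331006147))))))) (br 121 (br 120 (lp 54900884408369152) (br 133
  (br 132 (lp 73201155941076992) (br 131 (lp 219317594800001089) (lp 292514352694566977))) (lp
  146397913835638848))) (br 130 (lp 91501427473780800) (br 132 (lp 73201155941076992) (lp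
  146397913835638848))))) (br 384 (lp 0) (br 56 (br 52 (br 98 (br 82 (br 50 (lp 72629479704629312)
  (lp 181573698171187328)) (lp 108944219540299840)) (lp 36314739852447744)) (lp 145258958319001728))
  (lp 108944218466558080))))

def fourBins : RefTree :=
  br 256 (lp 0) (br 128 (lp 0) (br 60 (br 264 (br 56 (br 96 (br 73 (br 136 (br 72 (lp
  36600681595142144) (br 49 (br 80 (br 48 (lp 18300341342699520) (br 133 (br 132 (lp
  73201294470549504) (br 131 (lp 219318010388418625) (lp 292514906812457025))) (lp
  146398190894583872))) (br 131 (br 130 (lp 146402520204845120) (br 132 (lp 54900954201591808) (br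
  41 (lp 164416989581545537) (lp 109797510356668480)))) (br 133 (br 132 (lp 54900954201591808) (br
  41 (lp 219313545736626241) (lp 109797510356668480))) (lp 109797510356668480)))) (br 80 (br 130 (lp
  128102247598395456) (br 132 (lp 73201294470549504) (lp 146398190894583872))) (br 130 (lp
  109801907329437760) (br 132 (lp 54900954201591808) (lp 109797510356668480)))))) (br 136 (lp 0) (br
  80 (br 48 (lp 18300341342699520) (br 258 (lp 109797578018918464) (br 260 (lp 219313681061126209)
  (lp 146116784637087809)))) (br 258 (lp 73196897481003072) (br 260 (lp 146112319985295425) (lp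
  91215763830214721)))))) (br 136 (br 49 (br 48 (lp 18300341342699520) (br 80 (br 130 (lp
  109801907345952832) (br 132 (lp 73201294470549504) (lp 146398190894583872))) (br 130 (lp
  91501567076995136) (br 132 (lp 54900954201591808) (lp 109797510356668480))))) (br 52 (br 76 (br
  45 (br 44 (br 132 (lp 54900954201591808) (br 42 (lp 109797510356668480) (lp 146398190894583872)))
  (br 132 (br 130 (lp 146402520204845120) (lp 73201294470549504)) (lp 146398190894583872))) (br 80
  (br 132 (lp 73201294470549504) (lp 146398190894583872)) (lp 146402520204845120))) (br 46 (lp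
  91501567076995136) (lp 109801907345952832))) (br 46 (lp 109801907329437760) (lp
  128102247598395456)))) (br 48 (lp 18300341342699520) (br 80 (lp 109797578018918464) (lp
  73196897481003072))))) (br 96 (lp 0) (br 28 (br 260 (br 132 (lp 36600612875669504) (br 136 (br
  258 (lp 73196827704823872) (lp 146112180432937025)) (br 144 (br 258 (lp 109793042533720192) (br
  15 (lp 182422522238615682) (tr 0 [15, 96] [21, 21]))) (br 258 (lp 36596214829158464) (lp
  72910954681606209))))) (br 260 (lp 0) (br 136 (lp 109515965603778625) (br 15 (br 144 (lp
  109230092580298882) (lp 109225694534049922)) (tr 0 [15, 96] [19, 19]))))) (br 52 (br 50 (lp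
  73201225751072832) (br 44 (lp 109801838609965120) (lp 128102178878922816))) (lp
  91501566003515456))))) (br 72 (br 68 (lp 54901021847326720) (lp 109801974975172672)) (br 80 (lp
  91501634722730048) (br 96 (lp 73201294453772352) (lp 54900953127850048))))) (br 136 (lp 0) (br
  132 (lp 0) (br 48 (lp 18300341342699520) (br 80 (lp 146116784637087809) (br 96 (lp
  91215763830214721) (br 15 (br 144 (lp 109230092580298882) (lp 36314739852447809)) (tr 0 [15, 96]
  [19, 19])))))))) (lp 73201362099507264)))

def fiveBins : RefTree :=
  br 256 (lp 0) (br 128 (lp 0) (br 64 (lp 0) (br 48 (br 25 (br 24 (lp 18300341342961664) (br 40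
  (br 66 (lp 73201364264030272) (lp 36600682668888064)) (lp 54901022937845824))) (br 28 (br 36 (lp
  36600682668888064) (br 40 (lp 73201364264030272) (lp 54901022937845824))) (lp 54901023994810432)))
  (br 48 (lp 0) (lp 36600681595146304)))))

def sixBins : RefTree :=
  br 256 (lp 0) (br 128 (lp 0) (br 64 (lp 0) (br 32 (lp 0) (br 12 (lp 18300341342965760) (lp
  36600682685665344)))))

def sevenBins : RefTree :=
  br 256 (lp 0) (br 128 (lp 0) (br 64 (lp 0) (br 32 (lp 0) (br 16 (lp 0) (lp
  18300341342965824)))))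

def eightBins : RefTree :=
  br 256 (lp 0) (br 128 (lp 0) (br 64 (lp 0) (br 32 (lp 0) (br 16 (lp 0) (br 4 (lp 0) (lp 0))))))

end RefTree

/-! ### The rounding property -/

lemma DualBound.exists_sum_le {ι : Type*} [Fintype ι] [DecidableEq ι] {l : ι → ℝ} {L m : ℝ}
    (h : DualBound l L m) (hl : ∀ i, 0 ≤ l i) (hL : 0 ≤ L) :
    ∃ S : Finset ι, ∑ i ∈ S, l i ≤ L ∧ ∑ i, l i ≤ m * ∑ i ∈ S, l i := by
  obtain ⟨S, hS, hmax⟩ := exists_max_image (univ.filter fun S : Finset ι => ∑ i ∈ S, l i ≤ L)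
    (fun S => ∑ i ∈ S, l i) ⟨∅, by simpa using hL⟩
  refine ⟨S, (mem_filter.1 hS).2, h l _ hl fun T hT => hmax T (by simpa using hT)⟩

lemma DualBound.packable_one {ι : Type*} [Fintype ι] [DecidableEq ι] {l : ι → ℝ} {L : ℝ}
    (h : DualBound l L (1 : ℕ)) (hl : ∀ i, 0 ≤ l i) (hL : 0 ≤ L) : Packable l L 1 univ := by
  obtain ⟨S, h1, h2⟩ := h.exists_sum_le hl hL
  rw [_root_.packable_one]
  push_cast at h2
  linarith

lemma DualBound.packable_two {ι : Type*} [Fintype ι] [DecidableEq ι] {l : ι → ℝ} {L : ℝ}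
    (h : DualBound l L (2 : ℕ)) (hl : ∀ i, 0 ≤ l i) (hL : 0 ≤ L) : Packable l L 2 univ := by
  obtain ⟨S, h1, h2⟩ := h.exists_sum_le hl hL
  push_cast at h2
  have h3 := sum_add_sum_compl S l
  have := (_root_.packable_one.2 h1).union (A := Sᶜ) (by linarith) disjoint_compl_right
  rwa [union_compl] at this

lemma DualBound.pos {ι : Type*} [Fintype ι] [Nonempty ι] {l : ι → ℝ} {L : ℝ} {m : ℕ}
    (h : DualBound l L m) : 1 ≤ m := by
  by_contra h0
  obtain rfl : m = 0 := by omega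
  have := h (fun _ => 1) (Fintype.card ι) (fun _ => zero_le_one) fun S _ => by
    simpa using S.card_le_univ
  simp at this

lemma DualBound.cons_zero {n m : ℕ} {l : Fin n → ℝ} {L : ℝ} (h : DualBound l L m) (hm : 1 ≤ m) :
    DualBound (Fin.cons 0 l : Fin (n + 1) → ℝ) L m := by
  intro u D hu hD
  have h1 := h (fun i => u i.succ) (D - u 0) (fun i => hu _) fun S hS => by
    have := hD (cons 0 (S.map (Fin.succEmb n)) (by simp)) (by simpa using hS)
    rw [sum_cons, sum_map] at this
    simp only [Fin.coe_succEmb] at this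
    linarith
  rw [Fin.sum_univ_succ]
  have h2 : u 0 * 1 ≤ u 0 * m := mul_le_mul_of_nonneg_left (by exact_mod_cast hm) (hu 0)
  linarith

lemma Packable.of_cons_zero {n m : ℕ} {l : Fin n → ℝ} {L : ℝ}
    (h : Packable (Fin.cons 0 l : Fin (n + 1) → ℝ) L m univ) : Packable l L m univ := by
  obtain ⟨f, hf, hc⟩ := h
  refine ⟨fun i => f i.succ, fun i _ => hf _ (mem_univ _), fun c hcm => ?_⟩
  have := hc c hcm
  rw [sum_filter, Fin.sum_univ_succ] at this
  rw [sum_filter]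
  simpa using this

lemma DualBound.removeLast {n m : ℕ} {l : Fin (n + 1) → ℝ} {L : ℝ} (h : DualBound l L (m + 1 : ℕ))
    (hL : 0 ≤ L) (hl : Monotone l) (h0 : ∀ i, 0 ≤ l i) (hbig : L < l 0 + l (Fin.last n)) :
    DualBound (fun i : Fin n => l i.castSucc) L m := by
  intro u D hu hD
  have hpos : 0 ≤ D := by simpa using hD ∅ (by simpa using hL)
  have := h (Fin.snoc u D) D ?_ ?_
  · rw [Fin.sum_univ_castSucc] at this
    simp only [Fin.snoc_castSucc, Fin.snoc_last] at this
    push_cast at this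
    linarith
  · intro i
    induction i using Fin.lastCases with
    | last => simpa using hpos
    | cast i => simpa using hu i
  · intro S hS
    by_cases hlast : Fin.last n ∈ S
    · have : S = {Fin.last n} := by
        refine eq_singleton_iff_unique_mem.2 ⟨hlast, fun i hi => ?_⟩
        by_contra hne
        have h1 := sum_le_sum_of_subset_of_nonneg (f := l) (s := {i, Fin.last n}) (t := S)
          (by intro j; simp; rintro (rfl | rfl) <;> assumption) fun i _ _ => h0 i
        rw [sum_pair hne] at h1
        have := hl (Fin.zero_le i)
        linarith
      subst this
      simp
    · have ext (f : Fin (n + 1) → ℝ) :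
          ∑ i ∈ S, f i = ∑ i with Fin.castSucc i ∈ S, f (Fin.castSucc i) := by
        rw [← Fintype.sum_ite_mem, Fin.sum_univ_castSucc, if_neg hlast, add_zero, sum_filter]
      rw [ext] at hS ⊢
      simpa using hD _ hS

lemma Packable.of_removeLast {n m : ℕ} {l : Fin (n + 1) → ℝ} {L : ℝ} (hlast : l (Fin.last n) ≤ L)
    (h : Packable (fun i : Fin n => l i.castSucc) L m univ) : Packable l L (m + 1) univ := by
  obtain ⟨f, hf, hc⟩ := h
  refine ⟨Fin.snoc f m, fun i _ => ?_, fun c hcm => ?_⟩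
  · induction i using Fin.lastCases with
    | last => simp
    | cast i => simpa using (hf i (mem_univ _)).trans (Nat.lt_succ_self m)
  · rw [sum_filter, Fin.sum_univ_castSucc]
    simp only [Fin.snoc_castSucc, Fin.snoc_last]
    rcases Nat.lt_succ_iff_lt_or_eq.1 hcm with hcm | rfl
    · rw [if_neg hcm.ne', add_zero, ← sum_filter]
      exact hc c hcm
    · rw [sum_eq_zero fun i _ => if_neg (hf i (mem_univ _)).ne, if_pos rfl, zero_add]
      exact hlast

lemma packable_card {n m : ℕ} {l : Fin n → ℝ} {L : ℝ} (h : n ≤ m) (hL : 0 ≤ L) (hl : ∀ i, l i ≤ L) :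
    Packable l L m univ := by
  refine ⟨fun i => i, fun i _ => i.2.trans_le h, fun c _ => ?_⟩
  by_cases hc : c < n
  · have : (univ.filter fun i : Fin n => (i : ℕ) = c) = {⟨c, hc⟩} := by
      ext i
      simp [Fin.ext_iff]
    rw [this, sum_singleton]
    exact hl _
  · rw [sum_eq_zero]
    · exact hL
    · intro i hi
      have : (i : ℕ) = c := (mem_filter.1 hi).2
      omega

/-- Every instance with `n` items, of nonnegative length, can be packed into `m` bins provided that
this cannot be excluded by means of the continuous relaxation. -/
def RoundingProperty (n : ℕ) : Prop :=
  ∀ (m : ℕ) (L : ℝ) (l : Fin n → ℝ), 0 ≤ L → Monotone l → (∀ i, 0 ≤ l i) →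
    (∀ i, l i ≤ L) → 1 ≤ m → DualBound l L m → Packable l L m univ

lemma monotone_cons_zero {n : ℕ} {l : Fin n → ℝ} (hl : Monotone l) (h0 : ∀ i, 0 ≤ l i) :
    Monotone (Fin.cons 0 l : Fin (n + 1) → ℝ) := by
  intro i j hij
  induction i using Fin.cases with
  | zero =>
    induction j using Fin.cases with
    | zero => exact le_rfl
    | succ j => simpa using h0 j
  | succ i =>
    induction j using Fin.cases with
    | zero => exact absurd hij (by simp)
    | succ j => simpa using hl (Fin.succ_le_succ_iff.1 hij)

lemma RoundingProperty.of_succ {n : ℕ} (h : RoundingProperty (n + 1)) : RoundingProperty n := by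
  intro m L l hL hl h0 hle hm hD
  refine Packable.of_cons_zero
    (h m L (Fin.cons 0 l) hL (monotone_cons_zero hl h0) ?_ ?_ hm (hD.cons_zero hm))
  · exact Fin.cases (by simp) (by simpa using h0)
  · exact Fin.cases (by simpa using hL) (by simpa using hle)

/-- The rounding property only has to be verified when the smallest and the largest item fit into
one bin, and for a moderate number of bins. -/
lemma roundingProperty_of_fits (n : ℕ)
    (h : ∀ (d : ℕ) (L : ℝ) (l : Fin (n + 1) → ℝ), 1 ≤ d → d + 2 ≤ n → 0 ≤ L → Monotone l →
      (∀ i, 0 ≤ l i) → l 0 + l (Fin.last n) ≤ L → DualBound l L (d + 2 : ℕ) →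
      Packable l L (d + 2) univ) : RoundingProperty (n + 1) := by
  intro m
  induction m with
  | zero => intro _ _ _ _ _ _ h; omega
  | succ m ih =>
    intro L l hL hl h0 hle _ hD
    rcases m with _ | m
    · exact hD.packable_one h0 hL
    rcases lt_or_ge L (l 0 + l (Fin.last n)) with hbig | hfit
    · refine Packable.of_removeLast (hle _) (Packable.of_cons_zero ?_)
      have hl' : Monotone fun i : Fin n => l i.castSucc := hl.comp Fin.strictMono_castSucc.monotone
      refine ih L _ hL (monotone_cons_zero hl' fun i => h0 _) ?_ ?_ (by omega)
        ((hD.removeLast hL hl h0 hbig).cons_zero (by omega))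
      · exact Fin.cases (by simp) fun i => by simpa using h0 _
      · exact Fin.cases (by simpa using hL) fun i => by simpa using hle _
    · rcases m with _ | m
      · exact hD.packable_two h0 hL
      by_cases hmn : m + 3 ≤ n
      · exact h (m + 1) L l (by omega) (by omega) hL hl h0 hfit hD
      · exact packable_card (by omega) hL hle

section

variable {n : ℕ} {L : ℝ} {l : Fin n → ℝ}

lemma Packable.zDf_le {m : ℕ} (h : Packable l L m univ) : zDf n L l ≤ m := by
  obtain ⟨f, hf, hc⟩ := h
  let p : ℕ → Fin n → ℕ := fun c i => if f i = c then 1 else 0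
  let x : (Fin n → ℕ) →₀ ℕ := ∑ c ∈ range m, Finsupp.single (p c) 1
  refine sInf_le ⟨x, fun a ha => ?_, fun i => ?_, ?_⟩
  · have hsub := Finsupp.support_finsetSum ha
    rw [mem_biUnion] at hsub
    obtain ⟨c, hcm, hac⟩ := hsub
    obtain rfl : a = p c := by simpa using Finsupp.support_single_subset hac
    have := hc c (mem_range.1 hcm)
    rw [sum_filter] at this
    simpa [feasiblePatterns, p] using this
  · change x.sum (fun a k => k * a i) = 1
    rw [← Finsupp.sum_finsetSum_index (by simp) (by intros; ring)]
    simp only [zero_mul, Finsupp.sum_single_index, one_mul, p]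
    rw [sum_ite_eq, if_pos (mem_range.2 (hf i (mem_univ i)))]
  · change _ = x.sum (fun _ k => (k : ℝ≥0∞))
    rw [← Finsupp.sum_finsetSum_index (by simp) (by simp)]
    simp

lemma sum_le_mul_of_proper {x : (Fin n → ℕ) →₀ NNReal}
    (hx : ∀ a ∈ x.support, a ∈ properPatterns n L l)
    (h1 : ∀ i, ∑ a ∈ x.support, (x a : ℝ) * (a i : ℝ) = 1) {u : Fin n → ℝ} {D : ℝ}
    (hD : ∀ S : Finset (Fin n), ∑ i ∈ S, l i ≤ L → ∑ i ∈ S, u i ≤ D) :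
    ∑ i, u i ≤ (∑ a ∈ x.support, (x a : ℝ)) * D := by
  have key : ∀ a ∈ x.support, ∑ i, (a i : ℝ) * u i ≤ D := by
    intro a ha
    obtain ⟨hb, hf⟩ := hx a ha
    have h01 : ∀ i, (a i : ℝ) = if a i = 1 then 1 else 0 := fun i => by
      have := hb i
      interval_cases a i <;> simp
    have := hD (univ.filter fun i => a i = 1) (by
      rw [sum_filter]
      refine le_of_eq_of_le (sum_congr rfl fun i _ => ?_) hf
      rw [h01]
      simp)
    rw [sum_filter] at this
    refine le_of_eq_of_le (sum_congr rfl fun i _ => ?_) this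
    rw [h01]
    simp
  calc ∑ i, u i = ∑ i, (∑ a ∈ x.support, (x a : ℝ) * (a i : ℝ)) * u i := by simp [h1]
    _ = ∑ a ∈ x.support, (x a : ℝ) * ∑ i, (a i : ℝ) * u i := by
      simp only [sum_mul, mul_sum]
      rw [sum_comm]
      simp only [mul_assoc]
    _ ≤ ∑ a ∈ x.support, (x a : ℝ) * D :=
      sum_le_sum fun a ha => mul_le_mul_of_nonneg_left (key a ha) (x a).2
    _ = _ := by rw [sum_mul]

lemma dualBound_of_zCp_le {m : ℕ} (hL : 0 ≤ L) (h : zCp n L l ≤ m) : DualBound l L m := by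
  intro u D hu hD
  have hD0 : 0 ≤ D := by simpa using hD ∅ (by simpa using hL)
  rcases hD0.eq_or_lt with rfl | hpos
  · have : zCp n L l < ⊤ := h.trans_lt (by simp)
    rw [zCp, zC, sInf_lt_iff] at this
    obtain ⟨_, ⟨x, hx, h1, rfl⟩, _⟩ := this
    simpa using sum_le_mul_of_proper hx h1 hD
  · have : ENNReal.ofReal ((∑ i, u i) / D) ≤ zCp n L l := by
      refine le_sInf ?_
      rintro _ ⟨x, hx, h1, rfl⟩
      rw [← ENNReal.ofNNReal_finsetSum, ENNReal.ofReal_le_iff_le_toReal ENNReal.coe_ne_top,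
        ENNReal.coe_toReal, div_le_iff₀ hpos]
      push_cast
      exact sum_le_mul_of_proper hx h1 hD
    have := this.trans h
    rw [ENNReal.ofReal_le_natCast, div_le_iff₀ hpos] at this
    exact this

theorem RoundingProperty.properGap_lt_one (h : RoundingProperty n) (hE : IsInstance n L l) :
    properGap n L l < 1 := by
  obtain ⟨hn, hpos, hmono, hle⟩ := hE
  have h0 : ∀ i, 0 ≤ l i := fun i => (hpos i).le
  have hL : 0 ≤ L := (h0 ⟨0, hn⟩).trans (hle _)
  have : Nonempty (Fin n) := ⟨⟨0, hn⟩⟩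
  classical
  have hex : ∃ m, Packable l L m univ := ⟨n, packable_card le_rfl hL hle⟩
  obtain ⟨m, hm, hmin⟩ : ∃ m, Packable l L m univ ∧ ∀ k < m, ¬ Packable l L k univ :=
    ⟨Nat.find hex, Nat.find_spec hex, fun k hk => Nat.find_min hex hk⟩
  obtain ⟨k, rfl⟩ : ∃ k, m = k + 1 := by
    refine Nat.exists_eq_succ_of_ne_zero ?_
    rintro rfl
    obtain ⟨f, hf, -⟩ := hm
    exact absurd (hf ⟨0, hn⟩ (mem_univ _)) (Nat.not_lt_zero _)
  have hlt : (k : ℝ≥0∞) < zCp n L l := by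
    by_contra hge
    have hD := dualBound_of_zCp_le hL (not_lt.1 hge)
    exact hmin k (Nat.lt_succ_self k) (h k L l hL (fun i j hij => hmono i j hij) h0 hle hD.pos hD)
  have hz := hm.zDf_le
  push_cast at hz
  rw [properGap]
  rcases le_total (zCp n L l) (zDf n L l) with hc | hc
  · refine ENNReal.sub_lt_of_lt_add hc (hz.trans_lt ?_)
    rw [add_comm]
    exact ENNReal.add_lt_add_left ENNReal.one_ne_top hlt
  · rw [tsub_eq_zero_of_le hc]
    exact one_pos

end

namespace RefTree

/-- A refutation tree for `d + 2` bins, starting from the fact that items `0` and `8` fit into one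
bin, proves that the items can be packed. -/
theorem packable_of_run {d : ℕ} {T : RefTree}
    (h : run (d + 2) (512 * d) T (addF (512 * d) 0 257) = true) (hd : 1 ≤ d)
    {L : ℝ} {l : Fin 9 → ℝ} (hL : 0 ≤ L) (hl : Monotone l) (h0 : ∀ i, 0 ≤ l i)
    (hfit : l 0 + l 8 ≤ L) (hD : DualBound l L (d + 2 : ℕ)) : Packable l L (d + 2) univ := by
  by_contra hN
  have hs := sound_meaning hl h0 hL hd hD hN
  refine hs.not_run T _ (hs.all_addF (fun j hj => ?_) (by norm_num) ?_) h
  · exact absurd hj (by simp)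
  · have e : itemSet 257 = {0, 8} := by decide +kernel
    rwa [meaning_bottom hd (by norm_num), e, sum_pair (by decide)]

lemma run_threeBins : run 3 512 threeBins (addF 512 0 257) = true := by decide +kernel

lemma run_fourBins : run 4 1024 fourBins (addF 1024 0 257) = true := by decide +kernel

lemma run_fiveBins : run 5 1536 fiveBins (addF 1536 0 257) = true := by decide +kernel

lemma run_sixBins : run 6 2048 sixBins (addF 2048 0 257) = true := by decide +kernel

lemma run_sevenBins : run 7 2560 sevenBins (addF 2560 0 257) = true := by decide +kernel

lemma run_eightBins : run 8 3072 eightBins (addF 3072 0 257) = true := by decide +kernel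

end RefTree

theorem roundingProperty_nine : RoundingProperty 9 := by
  refine roundingProperty_of_fits 8 fun d L l hd hd' hL hl h0 hfit hD => ?_
  have hd6 : d ≤ 6 := by omega
  interval_cases d
  · exact RefTree.packable_of_run RefTree.run_threeBins hd hL hl h0 hfit hD
  · exact RefTree.packable_of_run RefTree.run_fourBins hd hL hl h0 hfit hD
  · exact RefTree.packable_of_run RefTree.run_fiveBins hd hL hl h0 hfit hD
  · exact RefTree.packable_of_run RefTree.run_sixBins hd hL hl h0 hfit hD
  · exact RefTree.packable_of_run RefTree.run_sevenBins hd hL hl h0 hfit hD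
  · exact RefTree.packable_of_run RefTree.run_eightBins hd hL hl h0 hfit hD

/-- every 1CSP instance with demand `n ≤ 9` is a proper IRUP
instance, i.e. `Δ_p(E) < 1`. -/
theorem stmt_15 (n : ℕ) (hn : n ≤ 9) (L : ℝ) (l : Fin n → ℝ)
    (hE : IsInstance n L l) :
    properGap n L l < 1 := by
  have h : RoundingProperty n :=
    Nat.decreasingInduction (fun _ _ => RoundingProperty.of_succ) roundingProperty_nine hn
  exact h.properGap_lt_one hE
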